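/- There exist constants c > 0 and C > 0 depending only on n and W such that for all sufficiently large R the following holds. Let u : B_{R^{2/5}}(0) → [-1,1] be a C² solution of Δu = W'(u) in B_{R^{2/5}}(0) such that (a) B_R(-R e_n) ∩ B_{R^{2/5}}(0) ⊂ {u<0} and 0 ∈ {u=0}, and (b) there is a point x₀ ∈ B_{R^{2/5}/4}(-(1/2)R^{2/5} e_n) with u(x₀) ≤ -1+c. Then in the unit ball B₁(0): (1) {u=0} ∩ B₁(0) is the graph in the e_n direction of a C² function with second derivatives bounded by C/R; (2) |u(x) - g(x_n)| ≤ C/R for all x ∈ B₁(0). -/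

import Mathlib

open MeasureTheory Metric Set Filter RealInnerProductSpace

noncomputable section

/-- The Laplacian of `u : ℝⁿ → ℝ`: the sum of the pure second partial derivatives. -/
def lap (n : ℕ) (u : EuclideanSpace ℝ (Fin n) → ℝ) (x : EuclideanSpace ℝ (Fin n)) : ℝ :=
  ∑ i : Fin n,
    fderiv ℝ (fun y => fderiv ℝ u y (EuclideanSpace.single i 1)) x (EuclideanSpace.single i 1)

/-- `W` is a double-well potential. -/
def DoubleWell (W : ℝ → ℝ) : Prop :=
  ContDiffOn ℝ 2 W (Set.Icc (-1) 1) ∧ W (-1) = 0 ∧ W 1 = 0 ∧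
  (∀ s ∈ Set.Ioo (-1:ℝ) 1, 0 < W s) ∧ deriv W (-1) = 0 ∧ deriv W 1 = 0 ∧
  0 < deriv (deriv W) (-1) ∧ 0 < deriv (deriv W) 1

/-- `g` is the one-dimensional solution of `g'' = W'(g)`, `g' > 0`, `g(0)=0`,
`g(±∞) = ±1`. -/
def IsOneDSolution (W g : ℝ → ℝ) : Prop :=
  ContDiff ℝ 2 g ∧ (∀ t, g t ∈ Set.Ioo (-1:ℝ) 1) ∧
  (∀ t, deriv (deriv g) t = deriv W (g t)) ∧ (∀ t, 0 < deriv g t) ∧ g 0 = 0 ∧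
  Tendsto g atTop (nhds 1) ∧ Tendsto g atBot (nhds (-1))

/-- The `i`-th vector of the standard basis of `ℝⁿ`. -/
abbrev stdVec {n : ℕ} (i : Fin n) : EuclideanSpace ℝ (Fin n) := EuclideanSpace.single i 1

lemma deriv_deriv_nonneg_of_isLocalMin {h : ℝ → ℝ} {a : ℝ} (hc : ContinuousAt h a)
    (hmin : IsLocalMin h a) : 0 ≤ deriv (deriv h) a := by
  by_contra! hneg
  have hmax := isLocalMax_of_deriv_deriv_neg hneg hmin.deriv_eq_zero hc
  have hconst : h =ᶠ[nhds a] fun _ => h a := by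
    filter_upwards [hmin, hmax] with x h1 h2
    exact le_antisymm h2 h1
  have h2 : deriv h =ᶠ[nhds a] fun _ => 0 := by
    simpa using hconst.deriv
  rw [h2.deriv_eq] at hneg
  simp at hneg

section Lap

variable {n : ℕ}

local notation "E" => EuclideanSpace ℝ (Fin n)

lemma hasDerivAt_line (p e : E) (t : ℝ) : HasDerivAt (fun t : ℝ => p + t • e) e t := by
  simpa using ((hasDerivAt_id t).smul_const e).const_add p

lemma deriv_line_eventuallyEq {v : E → ℝ} {p : E} (hv : ContDiffAt ℝ 2 v p) (e : E) :
    deriv (fun t : ℝ => v (p + t • e)) =ᶠ[nhds 0] fun t => fderiv ℝ v (p + t • e) e := by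
  have h1 : ∀ᶠ y in nhds p, DifferentiableAt ℝ v y := by
    filter_upwards [hv.eventually (by simp)] with y hy
    exact hy.differentiableAt (by norm_num)
  have hcont : Tendsto (fun t : ℝ => p + t • e) (nhds 0) (nhds p) := by
    have : Continuous fun t : ℝ => p + t • e := by fun_prop
    simpa using this.tendsto 0
  filter_upwards [hcont.eventually h1] with t ht
  exact (ht.hasFDerivAt.comp_hasDerivAt t (hasDerivAt_line p e t)).deriv

lemma deriv_deriv_line {v : E → ℝ} {p : E} (hv : ContDiffAt ℝ 2 v p) (e : E) :
    deriv (deriv fun t : ℝ => v (p + t • e)) 0 = fderiv ℝ (fun y => fderiv ℝ v y e) p e := by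
  rw [(deriv_line_eventuallyEq hv e).deriv_eq]
  have h2 : DifferentiableAt ℝ (fun y => fderiv ℝ v y e) (p + (0 : ℝ) • e) := by
    have : ContDiffAt ℝ 1 (fun y => fderiv ℝ v y e) p :=
      (hv.fderiv_right (m := 1) (by norm_num)).clm_apply contDiffAt_const
    simpa using this.differentiableAt (by norm_num)
  have := (h2.hasFDerivAt.comp_hasDerivAt 0 (hasDerivAt_line p e 0)).deriv
  simpa [Function.comp_def] using this

lemma lap_eq_sum_deriv {v : E → ℝ} {p : E} (hv : ContDiffAt ℝ 2 v p) :
    lap n v p = ∑ i, deriv (deriv fun t : ℝ => v (p + t • stdVec i)) 0 :=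
  Finset.sum_congr rfl fun _ _ => (deriv_deriv_line hv _).symm

lemma lap_nonneg_of_isLocalMin {v : E → ℝ} {p : E} (hv : ContDiffAt ℝ 2 v p)
    (hmin : IsLocalMin v p) : 0 ≤ lap n v p := by
  rw [lap_eq_sum_deriv hv]
  refine Finset.sum_nonneg fun i _ => ?_
  have hcont : Continuous fun t : ℝ => p + t • stdVec i := by fun_prop
  apply deriv_deriv_nonneg_of_isLocalMin
  · refine ContinuousAt.comp (g := v) ?_ hcont.continuousAt
    simpa using hv.continuousAt
  · have : Tendsto (fun t : ℝ => p + t • stdVec i) (nhds 0) (nhds p) := by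
      simpa using hcont.tendsto 0
    have := this.eventually hmin
    filter_upwards [this] with t ht
    simpa using ht

lemma differentiableAt_fderiv_apply {v : E → ℝ} {p : E} (hv : ContDiffAt ℝ 2 v p) (e : E) :
    DifferentiableAt ℝ (fun y => fderiv ℝ v y e) p := by
  have : ContDiffAt ℝ 1 (fun y => fderiv ℝ v y e) p :=
    (hv.fderiv_right (m := 1) (by norm_num)).clm_apply contDiffAt_const
  exact this.differentiableAt (by norm_num)

lemma lap_add {u v : E → ℝ} {p : E} (hu : ContDiffAt ℝ 2 u p) (hv : ContDiffAt ℝ 2 v p) :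
    lap n (fun x => u x + v x) p = lap n u p + lap n v p := by
  unfold lap
  rw [← Finset.sum_add_distrib]
  refine Finset.sum_congr rfl fun i _ => ?_
  have : (fun y => fderiv ℝ (fun x => u x + v x) y (stdVec i)) =ᶠ[nhds p]
      fun y => fderiv ℝ u y (stdVec i) + fderiv ℝ v y (stdVec i) := by
    filter_upwards [hu.eventually (by simp), hv.eventually (by simp)] with y h1 h2
    rw [fderiv_fun_add (h1.differentiableAt (by norm_num)) (h2.differentiableAt (by norm_num))]
    simp
  rw [this.fderiv_eq, fderiv_fun_add (differentiableAt_fderiv_apply hu _)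
    (differentiableAt_fderiv_apply hv _)]
  simp

lemma lap_const_mul {u : E → ℝ} {p : E} (c : ℝ) (hu : ContDiffAt ℝ 2 u p) :
    lap n (fun x => c * u x) p = c * lap n u p := by
  unfold lap
  rw [Finset.mul_sum]
  refine Finset.sum_congr rfl fun i _ => ?_
  have : (fun y => fderiv ℝ (fun x => c * u x) y (stdVec i)) =ᶠ[nhds p]
      fun y => c * fderiv ℝ u y (stdVec i) := by
    filter_upwards [hu.eventually (by simp)] with y h1
    rw [fderiv_const_mul (h1.differentiableAt (by norm_num))]
    simp
  rw [this.fderiv_eq, fderiv_const_mul (differentiableAt_fderiv_apply hu _)]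
  simp

lemma lap_const (c : ℝ) (p : E) : lap n (fun _ => c) p = 0 := by
  simp [lap]

lemma lap_sub {u v : E → ℝ} {p : E} (hu : ContDiffAt ℝ 2 u p) (hv : ContDiffAt ℝ 2 v p) :
    lap n (fun x => u x - v x) p = lap n u p - lap n v p := by
  have h1 := lap_add hu (hv.const_smul (-1 : ℝ))
  have h2 := lap_const_mul (-1) hv
  simp only [smul_eq_mul] at h1
  have e1 : (fun x => u x - v x) = fun x => u x + (-1) * v x := by
    ext x; ring
  rw [e1]
  rw [h1, h2]; ring

lemma lap_le_lap_of_isLocalMin_sub {F u : E → ℝ} {p : E} (hF : ContDiffAt ℝ 2 F p)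
    (hu : ContDiffAt ℝ 2 u p) (hmin : IsLocalMin (fun x => F x - u x) p) :
    lap n u p ≤ lap n F p := by
  have h := lap_nonneg_of_isLocalMin (hF.sub hu) hmin
  have h2 := lap_sub hF hu
  linarith

lemma lap_comp_add (v : E → ℝ) (p a : E) : lap n (fun x => v (x + a)) p = lap n v (p + a) := by
  unfold lap
  refine Finset.sum_congr rfl fun i _ => ?_
  simp only [fderiv_comp_add_right]
  rw [fderiv_comp_add_right (f := fun y => fderiv ℝ v y (EuclideanSpace.single i 1))]

lemma deriv_deriv_comp_quadratic {ψ : ℝ → ℝ} {s₀ : ℝ} (hψ : ContDiffAt ℝ 2 ψ s₀) (a b : ℝ) :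
    deriv (deriv fun t : ℝ => ψ (s₀ + a * t + b * t ^ 2)) 0
      = deriv (deriv ψ) s₀ * a ^ 2 + 2 * b * deriv ψ s₀ := by
  have hq : ∀ t : ℝ, HasDerivAt (fun t : ℝ => s₀ + a * t + b * t ^ 2) (a + b * (2 * t)) t := by
    intro t
    have := (((hasDerivAt_id t).const_mul a).const_add s₀).add (((hasDerivAt_id t).pow 2).const_mul b)
    exact this.congr_deriv (by simp)
  have hcont : Tendsto (fun t : ℝ => s₀ + a * t + b * t ^ 2) (nhds 0) (nhds s₀) := by
    simpa using (hq 0).continuousAt.tendsto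
  have h1 : deriv (fun t : ℝ => ψ (s₀ + a * t + b * t ^ 2)) =ᶠ[nhds 0]
      fun t => deriv ψ (s₀ + a * t + b * t ^ 2) * (a + b * (2 * t)) := by
    filter_upwards [hcont.eventually (hψ.eventually (by simp))] with t ht
    exact ((ht.differentiableAt (by norm_num)).hasDerivAt.comp t (hq t)).deriv
  rw [h1.deriv_eq]
  have h2 : DifferentiableAt ℝ (deriv ψ) s₀ := by
    have : ContDiffAt ℝ 1 (deriv ψ) s₀ := by
      have h := (hψ.fderiv_right (m := 1) (by norm_num)).clm_apply (contDiffAt_const (c := (1 : ℝ)))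
      exact h
    exact this.differentiableAt (by norm_num)
  have h2' : HasDerivAt (deriv ψ) (deriv (deriv ψ) s₀) (s₀ + a * 0 + b * 0 ^ 2) := by
    simpa using h2.hasDerivAt
  have h3 : HasDerivAt (fun t : ℝ => a + b * (2 * t)) (2 * b) 0 := by
    have := (((hasDerivAt_id (0 : ℝ)).const_mul 2).const_mul b).const_add a
    exact this.congr_deriv (by ring)
  have := ((h2'.comp (0 : ℝ) (hq 0)).mul h3).deriv
  simp only [Function.comp_def, Pi.mul_def] at this
  rw [this]
  simp
  ring

lemma lap_of_quadratic_lines {F : E → ℝ} {p : E} {ψ : ℝ → ℝ} {s₀ : ℝ} {a b : Fin n → ℝ}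
    (hF : ContDiffAt ℝ 2 F p) (hψ : ContDiffAt ℝ 2 ψ s₀)
    (h : ∀ i t, F (p + t • stdVec i) = ψ (s₀ + a i * t + b i * t ^ 2)) :
    lap n F p = deriv (deriv ψ) s₀ * ∑ i, a i ^ 2 + 2 * deriv ψ s₀ * ∑ i, b i := by
  rw [lap_eq_sum_deriv hF, Finset.mul_sum, Finset.mul_sum, ← Finset.sum_add_distrib]
  refine Finset.sum_congr rfl fun i _ => ?_
  simp only [h]
  rw [deriv_deriv_comp_quadratic hψ]
  ring

lemma norm_add_smul_stdVec_sq (x : E) (i : Fin n) (t : ℝ) :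
    ‖x + t • stdVec i‖ ^ 2 = ‖x‖ ^ 2 + 2 * x i * t + t ^ 2 := by
  rw [@norm_add_sq_real]
  simp [norm_smul, inner_smul_right, EuclideanSpace.inner_single_right]
  ring

/-- The Laplacian of a function of `α * ‖x - y‖ ^ 2 + β`. -/
lemma lap_radial {ψ : ℝ → ℝ} (α β : ℝ) (y p : E)
    (hψ : ContDiffAt ℝ 2 ψ (α * ‖p - y‖ ^ 2 + β)) :
    ContDiffAt ℝ 2 (fun x => ψ (α * ‖x - y‖ ^ 2 + β)) p ∧
    lap n (fun x => ψ (α * ‖x - y‖ ^ 2 + β)) p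
      = deriv (deriv ψ) (α * ‖p - y‖ ^ 2 + β) * (4 * α ^ 2 * ‖p - y‖ ^ 2)
        + 2 * α * n * deriv ψ (α * ‖p - y‖ ^ 2 + β) := by
  have hs : ContDiff ℝ 2 (fun x : E => α * ‖x - y‖ ^ 2 + β) :=
    (contDiff_const.mul ((contDiff_id.sub contDiff_const).norm_sq ℝ)).add contDiff_const
  have hF : ContDiffAt ℝ 2 (fun x => ψ (α * ‖x - y‖ ^ 2 + β)) p :=
    ContDiffAt.comp p hψ hs.contDiffAt
  refine ⟨hF, ?_⟩
  rw [lap_of_quadratic_lines (a := fun i => 2 * α * (p - y) i) (b := fun _ => α) hF hψ]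
  · simp only [mul_pow, ← Finset.mul_sum, Finset.sum_const, Finset.card_univ, Fintype.card_fin,
      nsmul_eq_mul]
    rw [EuclideanSpace.norm_sq_eq]
    simp only [Real.norm_eq_abs, sq_abs]
    ring
  · intro i t
    have : p + t • stdVec i - y = (p - y) + t • stdVec i := by abel
    simp only [this, norm_add_smul_stdVec_sq]
    congr 1
    ring

end Lap

section Interior

variable {n : ℕ}

local notation "E" => EuclideanSpace ℝ (Fin n)

/-- Reflection of the `i`-th coordinate. -/
def reflectCoord (i : Fin n) (z : E) : E := z - (2 * z i) • stdVec i

lemma contDiff_reflectCoord (i : Fin n) : ContDiff ℝ 2 (reflectCoord i) := by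
  unfold reflectCoord
  fun_prop

lemma norm_reflectCoord (i : Fin n) (z : E) : ‖reflectCoord i z‖ = ‖z‖ := by
  have h : ‖reflectCoord i z‖ ^ 2 = ‖z‖ ^ 2 := by
    have h1 := norm_add_smul_stdVec_sq z i (-(2 * z i))
    have h2 : z + (-(2 * z i)) • stdVec i = reflectCoord i z := by
      simp [reflectCoord, sub_eq_add_neg, neg_smul]
    rw [h2] at h1
    rw [h1]; ring
  exact (sq_eq_sq₀ (norm_nonneg _) (norm_nonneg _)).1 h

lemma lap_comp_reflectCoord {v : E → ℝ} {p : E} (i : Fin n)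
    (hv : ContDiffAt ℝ 2 v (reflectCoord i p)) :
    lap n (fun z => v (reflectCoord i z)) p = lap n v (reflectCoord i p) := by
  have hc : ContDiffAt ℝ 2 (fun z => v (reflectCoord i z)) p :=
    ContDiffAt.comp p hv (contDiff_reflectCoord i).contDiffAt
  rw [lap_eq_sum_deriv hc, lap_eq_sum_deriv hv]
  refine Finset.sum_congr rfl fun j _ => ?_
  by_cases hj : j = i
  · subst hj
    have : ∀ t : ℝ, reflectCoord j (p + t • stdVec j) = reflectCoord j p + t • (-stdVec j) := by
      intro t
      ext l
      by_cases hl : l = j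
      · subst hl; simp [reflectCoord]; ring
      · simp [reflectCoord, hl]
    simp only [this]
    rw [deriv_deriv_line hv, deriv_deriv_line hv]
    simp only [map_neg]
    rw [fderiv_fun_neg]
    simp
  · have : ∀ t : ℝ, reflectCoord i (p + t • stdVec j) = reflectCoord i p + t • stdVec j := by
      intro t
      ext l
      have : i ≠ j := fun h => hj h.symm
      simp [reflectCoord, this]; ring
    simp only [this]

lemma contDiffAt_shift {v : E → ℝ} {x p : E} (h : ContDiffAt ℝ 2 v (x + p)) :
    ContDiffAt ℝ 2 (fun z => v (x + z)) p :=
  ContDiffAt.comp p h (by fun_prop)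

lemma lap_shift (v : E → ℝ) (x p : E) : lap n (fun z => v (x + z)) p = lap n v (x + p) := by
  have := lap_comp_add v p x
  simpa only [add_comm] using this

lemma reflect_barrier {v : E → ℝ} {x : E} {r A N μ d : ℝ} (hd : 0 < d) (hdr : d < r)
    (hv : ContDiffOn ℝ 2 v (ball x r)) (hA : ∀ z ∈ ball x r, |v z| ≤ A)
    (hN : ∀ z ∈ ball x r, |lap n v z| ≤ N) (hμ : n * A / d ^ 2 + N / 2 < μ) (hμ0 : 0 ≤ μ)
    (i : Fin n) {z : E} (hz : ‖z‖ ≤ d) (hzi : 0 ≤ z i) :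
    (v (x + z) - v (x + reflectCoord i z)) / 2 ≤ A / d ^ 2 * ‖z‖ ^ 2 + μ * d * z i - μ * z i ^ 2 := by
  have hA0 : 0 ≤ A := (abs_nonneg _).trans (hA x (mem_ball_self (hd.trans hdr)))
  set b : E → ℝ := fun z => A / d ^ 2 * ‖z‖ ^ 2 + μ * d * z i - μ * z i ^ 2 with hb
  set φ : E → ℝ := fun z => (1 / 2) * (v (x + z) - v (x + reflectCoord i z)) with hφ
  have hmem : ∀ z : E, ‖z‖ ≤ d → x + z ∈ ball x r := by
    intro z hz
    simpa using hz.trans_lt hdr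
  have hbs : ContDiff ℝ 2 b := by
    have h1 : ContDiff ℝ 2 fun z : E => ‖z‖ ^ 2 := contDiff_id.norm_sq ℝ
    have h2 : ContDiff ℝ 2 fun z : E => z i := by fun_prop
    exact ((contDiff_const.mul h1).add (contDiff_const.mul h2)).sub (contDiff_const.mul (h2.pow 2))
  have hv1 : ∀ z : E, ‖z‖ ≤ d → ContDiffAt ℝ 2 v (x + z) := fun z hz =>
    hv.contDiffAt (isOpen_ball.mem_nhds (hmem z hz))
  have hs2 : ∀ z : E, ‖z‖ ≤ d → ContDiffAt ℝ 2 (fun z => v (x + reflectCoord i z)) z := by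
    intro z hz
    have h := contDiffAt_shift (hv1 (reflectCoord i z) (by rwa [norm_reflectCoord]))
    exact ContDiffAt.comp (g := fun z => v (x + z)) z h (contDiff_reflectCoord i).contDiffAt
  have hφs : ∀ z : E, ‖z‖ ≤ d → ContDiffAt ℝ 2 φ z := by
    intro z hz
    exact contDiffAt_const.mul ((contDiffAt_shift (hv1 z hz)).sub (hs2 z hz))
  have hlapφ : ∀ z : E, ‖z‖ ≤ d → -N ≤ lap n φ z := by
    intro z hz
    have hz' : ‖reflectCoord i z‖ ≤ d := by rwa [norm_reflectCoord]
    rw [hφ, lap_const_mul _ ((contDiffAt_shift (hv1 z hz)).sub (hs2 z hz)),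
      lap_sub (contDiffAt_shift (hv1 z hz)) (hs2 z hz), lap_shift,
      lap_comp_reflectCoord (v := fun z => v (x + z)) i (contDiffAt_shift (hv1 _ hz')), lap_shift]
    have h1 := abs_le.1 (hN _ (hmem z hz))
    have h2 := abs_le.1 (hN _ (hmem _ hz'))
    linarith [h1.1, h2.2]
  have hlapb : ∀ z : E, lap n b z = 2 * (n * A / d ^ 2 - μ) := by
    intro z
    rw [lap_of_quadratic_lines (ψ := fun s => s) (s₀ := b z)
      (a := fun j => 2 * A / d ^ 2 * z j + if j = i then μ * d - 2 * μ * z i else 0)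
      (b := fun j => A / d ^ 2 - if j = i then μ else 0) hbs.contDiffAt contDiffAt_id]
    · simp [Finset.sum_sub_distrib]
      ring
    · intro j t
      simp only [hb, norm_add_smul_stdVec_sq]
      by_cases hj : j = i
      · subst hj; simp; ring
      · have : i ≠ j := fun h => hj h.symm
        simp [hj, this]; ring
  have hK : IsCompact (closedBall (0 : E) d ∩ {z | 0 ≤ z i}) := by
    apply (isCompact_closedBall _ _).inter_right
    exact isClosed_le continuous_const (by fun_prop)
  obtain ⟨p, ⟨hp1, hp2⟩, hpmin⟩ := hK.exists_isMinOn ⟨z, by simpa using hz, hzi⟩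
    (f := fun z => b z - φ z) (fun y hy => (hbs.continuous.continuousAt.sub
      (hφs y (by simpa using hy.1)).continuousAt).continuousWithinAt)
  have hp1' : ‖p‖ ≤ d := by simpa using hp1
  have hp2' : 0 ≤ p i := hp2
  have key : 0 ≤ b p - φ p := by
    by_contra! hneg
    have hpi : 0 < p i := by
      rcases hp2'.lt_or_eq with h | h
      · exact h
      · exfalso
        have h1 : reflectCoord i p = p := by simp [reflectCoord, ← h]
        have h2 : 0 ≤ A / d ^ 2 * ‖p‖ ^ 2 := by positivity
        simp only [hb, hφ, h1, ← h] at hneg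
        linarith
    have hpd : ‖p‖ < d := by
      rcases hp1'.lt_or_eq with h | h
      · exact h
      · exfalso
        have h1 := abs_le.1 (hA _ (hmem p hp1'))
        have h2 := abs_le.1 (hA _ (hmem (reflectCoord i p) (by rwa [norm_reflectCoord])))
        have h3 : p i ≤ d := by
          have := EuclideanSpace.norm_sq_eq p
          have h4 : p i ^ 2 ≤ ∑ j, ‖p j‖ ^ 2 := by
            have := Finset.single_le_sum (f := fun j => ‖p j‖ ^ 2) (fun j _ => by positivity)
              (Finset.mem_univ i)
            simpa using this
          rw [← this, h] at h4
          exact abs_le_of_sq_le_sq' h4 hd.le |>.2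
        have h5 : A / d ^ 2 * ‖p‖ ^ 2 = A := by rw [h]; field_simp
        have h6 : 0 ≤ μ * p i * (d - p i) := by
          apply mul_nonneg (by positivity); linarith
        simp only [hb, hφ] at hneg
        nlinarith [h1.2, h2.1]
    have hloc : IsLocalMin (fun z => b z - φ z) p := by
      apply hpmin.isLocalMin
      have ho : IsOpen (ball (0 : E) d ∩ {z | 0 < z i}) :=
        isOpen_ball.inter (isOpen_lt continuous_const (by fun_prop))
      filter_upwards [ho.mem_nhds ⟨by simpa using hpd, hpi⟩] with y hy
      exact ⟨ball_subset_closedBall hy.1, le_of_lt (show 0 < y i from hy.2)⟩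
    have h1 := lap_le_lap_of_isLocalMin_sub hbs.contDiffAt (hφs p hp1') hloc
    rw [hlapb] at h1
    have h2 := hlapφ p hp1'
    linarith
  have h1 : b p - φ p ≤ b z - φ z := hpmin ⟨by simpa using hz, hzi⟩
  have : φ z = (v (x + z) - v (x + reflectCoord i z)) / 2 := by simp only [hφ]; ring
  rw [← this]
  linarith

lemma fderiv_le_interior {v : E → ℝ} {x : E} {r A N d : ℝ} (hd : 0 < d) (hdr : d < r)
    (hv : ContDiffOn ℝ 2 v (ball x r)) (hA : ∀ z ∈ ball x r, |v z| ≤ A)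
    (hN : ∀ z ∈ ball x r, |lap n v z| ≤ N) (i : Fin n) :
    fderiv ℝ v x (stdVec i) ≤ n * A / d + N * d / 2 := by
  have hr : 0 < r := hd.trans hdr
  have hA0 : 0 ≤ A := (abs_nonneg _).trans (hA x (mem_ball_self hr))
  have hN0 : 0 ≤ N := (abs_nonneg _).trans (hN x (mem_ball_self hr))
  have hdiff : DifferentiableAt ℝ v x :=
    (hv.contDiffAt (isOpen_ball.mem_nhds (mem_ball_self hr))).differentiableAt (by norm_num)
  have main : ∀ μ, n * A / d ^ 2 + N / 2 < μ → fderiv ℝ v x (stdVec i) ≤ μ * d := by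
    intro μ hμ
    have hμ0 : 0 ≤ μ := le_trans (by positivity) hμ.le
    have hder : HasDerivAt (fun t : ℝ => A / d ^ 2 * t ^ 2 + μ * d * t - μ * t ^ 2
        - (v (x + t • stdVec i) - v (x + t • (-stdVec i))) / 2)
        (μ * d - fderiv ℝ v x (stdVec i)) 0 := by
      have hx : HasFDerivAt v (fderiv ℝ v x) (x + (0 : ℝ) • stdVec i) := by
        simpa using hdiff.hasFDerivAt
      have hx' : HasFDerivAt v (fderiv ℝ v x) (x + (0 : ℝ) • (-stdVec i)) := by
        simpa using hdiff.hasFDerivAt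
      have h1 := hx.comp_hasDerivAt (0 : ℝ) (hasDerivAt_line x (stdVec i) 0)
      have h2 := hx'.comp_hasDerivAt (0 : ℝ) (hasDerivAt_line x (-stdVec i) 0)
      have h3 := (((hasDerivAt_id (0 : ℝ)).pow 2).const_mul (A / d ^ 2)).add
        ((hasDerivAt_id (0 : ℝ)).const_mul (μ * d))
      have h4 := ((hasDerivAt_id (0 : ℝ)).pow 2).const_mul μ
      have := (h3.sub h4).sub ((h1.sub h2).div_const 2)
      refine this.congr_deriv ?_
      simp
    have hnonneg : ∀ t ∈ Ico (0 : ℝ) d, 0 ≤ A / d ^ 2 * t ^ 2 + μ * d * t - μ * t ^ 2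
        - (v (x + t • stdVec i) - v (x + t • (-stdVec i))) / 2 := by
      intro t ht
      have h := reflect_barrier hd hdr hv hA hN hμ hμ0 i (z := t • stdVec i)
        (by simpa [norm_smul, abs_of_nonneg ht.1] using ht.2.le) (by simpa using ht.1)
      have h2 : reflectCoord i (t • stdVec i) = t • (-stdVec i) := by
        simp only [reflectCoord, PiLp.smul_apply, PiLp.single_apply, if_true,
          smul_eq_mul, mul_one, smul_neg, ← neg_smul, ← sub_smul]
        congr 1; ring
      rw [h2] at h
      simp [norm_smul] at h ⊢
      linarith
    by_contra! hlt
    have hneg : μ * d - fderiv ℝ v x (stdVec i) < 0 := by linarith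
    have h0 : ∀ᶠ t in nhdsWithin (0 : ℝ) (Ioi 0), A / d ^ 2 * t ^ 2 + μ * d * t - μ * t ^ 2
        - (v (x + t • stdVec i) - v (x + t • (-stdVec i))) / 2 < 0 := by
      have hs := (hasDerivAt_iff_tendsto_slope.1 hder).mono_left
        (nhdsWithin_mono _ (fun t (ht : 0 < t) => ht.ne'))
      filter_upwards [hs.eventually (gt_mem_nhds hneg), self_mem_nhdsWithin] with t ht ht0
      have ht0' : (0 : ℝ) < t := ht0
      simp only [slope_def_field] at ht
      have := (div_lt_iff₀ (by linarith : (0 : ℝ) < t - 0)).1 ht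
      simp at this
      simp only [smul_neg]
      linarith
    have h1 : ∀ᶠ t in nhdsWithin (0 : ℝ) (Ioi 0), t ∈ Ioo (0 : ℝ) d := Ioo_mem_nhdsGT hd
    obtain ⟨t, ht1, ht2⟩ := (h0.and h1).exists
    linarith [hnonneg t ⟨ht2.1.le, ht2.2⟩]
  have : fderiv ℝ v x (stdVec i) / d ≤ n * A / d ^ 2 + N / 2 := by
    apply le_of_forall_gt_imp_ge_of_dense
    intro μ hμ
    rw [div_le_iff₀ hd]
    exact main μ hμ
  rw [div_le_iff₀ hd] at this
  calc _ ≤ _ := this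
    _ = _ := by field_simp

/-- Interior gradient estimate for `C²` functions. -/
lemma abs_fderiv_le_interior {v : E → ℝ} {x : E} {r A N : ℝ} (hr : 0 < r)
    (hv : ContDiffOn ℝ 2 v (ball x r)) (hA : ∀ z ∈ ball x r, |v z| ≤ A)
    (hN : ∀ z ∈ ball x r, |lap n v z| ≤ N) (i : Fin n) :
    |fderiv ℝ v x (stdVec i)| ≤ 2 * n * A / r + N * r / 4 := by
  have hc : ∀ z ∈ ball x r, ContDiffAt ℝ 2 v z := fun z hz =>
    hv.contDiffAt (isOpen_ball.mem_nhds hz)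
  have e : n * A / (r / 2) + N * (r / 2) / 2 = 2 * n * A / r + N * r / 4 := by
    field_simp; ring
  rw [← e, abs_le']
  refine ⟨fderiv_le_interior (half_pos hr) (half_lt_self hr) hv hA hN i, ?_⟩
  have h := fderiv_le_interior (v := fun z => (-1) * v z) (half_pos hr) (half_lt_self hr)
    (contDiffOn_const.mul hv) (by simpa using hA)
    (fun z hz => by rw [lap_const_mul _ (hc z hz)]; simpa using hN z hz) i
  rw [fderiv_const_mul ((hc x (mem_ball_self hr)).differentiableAt (by norm_num))] at h
  simpa using h

lemma norm_le_sum_abs_stdVec (L : E →L[ℝ] ℝ) : ‖L‖ ≤ ∑ i, |L (stdVec i)| := by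
  refine L.opNorm_le_bound (Finset.sum_nonneg fun _ _ => abs_nonneg _) fun x => ?_
  have hx : x = ∑ i, x i • stdVec i := by
    ext j; simp [Finset.sum_apply, Pi.single_apply]
  conv_lhs => rw [hx]
  rw [map_sum, Finset.sum_mul]
  refine (norm_sum_le _ _).trans (Finset.sum_le_sum fun i _ => ?_)
  rw [map_smul, norm_smul, mul_comm]
  exact mul_le_mul_of_nonneg_left (PiLp.norm_apply_le x i) (norm_nonneg _)

end Interior

section Harnack

variable {n : ℕ}

local notation "E" => EuclideanSpace ℝ (Fin n)

lemma contDiffAt_inv_pow (c c' : ℝ) (k : ℕ) {q : ℝ} (hq : q ≠ 0) :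
    ContDiffAt ℝ 2 (fun q : ℝ => c * q ^ (-(k : ℤ)) - c') q := by
  have : (fun q : ℝ => c * q ^ (-(k : ℤ)) - c') = fun q : ℝ => c * (q ^ k)⁻¹ - c' := by
    ext q; simp
  rw [this]
  exact (contDiffAt_const.mul ((contDiffAt_id.pow k).inv (pow_ne_zero _ hq))).sub contDiffAt_const

lemma lap_inv_pow (c c' : ℝ) (k : ℕ) (y p : E) (hp : p ≠ y) :
    ContDiffAt ℝ 2 (fun x => c * (‖x - y‖ ^ 2) ^ (-(k : ℤ)) - c') p ∧
    lap n (fun x => c * (‖x - y‖ ^ 2) ^ (-(k : ℤ)) - c') p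
      = c * (2 * k * (2 * k + 2 - n)) * (‖p - y‖ ^ 2) ^ (-(k : ℤ)) / ‖p - y‖ ^ 2 := by
  have hq : 0 < ‖p - y‖ ^ 2 := by
    have := norm_pos_iff.2 (sub_ne_zero.2 hp)
    positivity
  have h := lap_radial (ψ := fun q : ℝ => c * q ^ (-(k : ℤ)) - c') 1 0 y p
    (by simpa using contDiffAt_inv_pow c c' k (by simpa using hq.ne'))
  simp only [one_mul, add_zero] at h
  refine ⟨h.1, h.2.trans ?_⟩
  have d1 : deriv (fun q : ℝ => c * q ^ (-(k : ℤ)) - c')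
      = fun q => c * ((-(k : ℤ) : ℤ) * q ^ (-(k : ℤ) - 1)) := by
    ext q
    rw [deriv_sub_const, deriv_const_mul_field, deriv_zpow]
  have d2 : deriv (fun q : ℝ => c * ((-(k : ℤ) : ℤ) * q ^ (-(k : ℤ) - 1)))
      = fun q => c * ((-(k : ℤ) : ℤ) * ((-(k : ℤ) - 1 : ℤ) * q ^ (-(k : ℤ) - 1 - 1))) := by
    ext q
    rw [deriv_const_mul_field, deriv_const_mul_field, deriv_zpow]
  rw [d1, d2]
  simp only
  rw [zpow_sub_one₀ hq.ne', zpow_sub_one₀ hq.ne']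
  push_cast
  field_simp
  ring

/-- Lower bound for supersolutions in an annulus. -/
lemma supersolution_lower_bound {w : E → ℝ} {y : E} {r D m K : ℝ} {k : ℕ} {U : Set E}
    (hr : 0 < r) (hK : 0 < K) (hk : K * D ^ 2 ≤ 2 * k * (2 * k + 2 - n))
    (hU : IsOpen U) (hDU : closedBall y D ⊆ U) (hw : ContDiffOn ℝ 2 w U)
    (hw0 : ∀ x ∈ U, 0 ≤ w x) (hlap : ∀ x ∈ U, lap n w x ≤ K * w x)
    (hm : ∀ x ∈ closedBall y r, m ≤ w x) (hm0 : 0 ≤ m) {x : E} (hx : x ∈ closedBall y D)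
    (hrx : r ≤ ‖x - y‖) :
    m * (r ^ 2) ^ k * (((‖x - y‖ ^ 2) ^ k)⁻¹ - ((D ^ 2) ^ k)⁻¹) ≤ w x := by
  set c := m * (r ^ 2) ^ k with hc
  have hc0 : 0 ≤ c := by positivity
  have hxD : ‖x - y‖ ≤ D := by simpa [dist_eq_norm] using hx
  have hD : 0 < D := hr.trans_le (hrx.trans hxD)
  set c' := c * ((D ^ 2) ^ k)⁻¹ with hc'
  have hc'0 : 0 ≤ c' := by positivity
  set β : E → ℝ := fun x => c * (‖x - y‖ ^ 2) ^ (-(k : ℤ)) - c' with hβ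
  have hwc : ∀ z ∈ U, ContDiffAt ℝ 2 w z := fun z hz => hw.contDiffAt (hU.mem_nhds hz)
  have hne : ∀ z : E, r ≤ ‖z - y‖ → z ≠ y := by
    rintro z hz rfl
    simp at hz; linarith
  have hcomp : IsCompact (closedBall y D ∩ {z | r ≤ ‖z - y‖}) :=
    (isCompact_closedBall _ _).inter_right (isClosed_le continuous_const (by fun_prop))
  obtain ⟨p, ⟨hp1, hp2⟩, hpmin⟩ := hcomp.exists_isMinOn ⟨x, hx, hrx⟩
    (f := fun z => w z - β z) (fun z hz => ((hwc z (hDU hz.1)).continuousAt.sub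
      (lap_inv_pow c c' k y z (hne z hz.2)).1.continuousAt).continuousWithinAt)
  have hpr : r ≤ ‖p - y‖ := hp2
  have hpD : ‖p - y‖ ≤ D := by simpa [dist_eq_norm] using hp1
  have hq0 : 0 < ‖p - y‖ ^ 2 := by have := hr.trans_le hpr; positivity
  have hval : w x - β x = w x - c * (((‖x - y‖ ^ 2) ^ k)⁻¹ - ((D ^ 2) ^ k)⁻¹) := by
    simp only [hβ, hc', zpow_neg, zpow_natCast]; ring
  suffices hkey : 0 ≤ w p - β p by
    have h1 : w p - β p ≤ w x - β x := hpmin ⟨hx, hrx⟩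
    linarith
  by_contra! hneg
  have hp1r : r < ‖p - y‖ := by
    rcases hpr.lt_or_eq with h | h
    · exact h
    · exfalso
      have h1 := hm p (by simp [dist_eq_norm, ← h])
      have h2 : β p = m - c' := by
        simp only [hβ, ← h, hc, zpow_neg, zpow_natCast]
        field_simp
      linarith
  have hp1D : ‖p - y‖ < D := by
    rcases hpD.lt_or_eq with h | h
    · exact h
    · exfalso
      have h1 := hw0 p (hDU hp1)
      have h2 : β p = 0 := by
        simp only [hβ, h, hc', zpow_neg, zpow_natCast]; ring
      linarith
  have hloc : IsLocalMin (fun z => w z - β z) p := by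
    apply hpmin.isLocalMin
    have ho : IsOpen (ball y D ∩ {z | r < ‖z - y‖}) :=
      isOpen_ball.inter (isOpen_lt continuous_const (by fun_prop))
    filter_upwards [ho.mem_nhds ⟨by simpa [dist_eq_norm] using hp1D, hp1r⟩] with z hz
    exact ⟨ball_subset_closedBall hz.1, le_of_lt (show r < ‖z - y‖ from hz.2)⟩
  obtain ⟨hβs, hβl⟩ := lap_inv_pow c c' k y p (hne p hpr)
  have h1 := lap_le_lap_of_isLocalMin_sub (hwc p (hDU hp1)) hβs hloc
  rw [hβl] at h1
  have h2 := hlap p (hDU hp1)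
  set z := (‖p - y‖ ^ 2) ^ (-(k : ℤ)) with hz
  have hz0 : 0 < z := by positivity
  have h3 : K * (c * z) ≤ c * (2 * k * (2 * k + 2 - n)) * z / ‖p - y‖ ^ 2 := by
    rw [le_div_iff₀ hq0]
    have : K * ‖p - y‖ ^ 2 ≤ K * D ^ 2 := by gcongr
    have := mul_le_mul_of_nonneg_left (this.trans hk) (mul_nonneg hc0 hz0.le)
    linarith
  have h4 : β p = c * z - c' := rfl
  have h5 : K * w p < K * β p := by
    apply mul_lt_mul_of_pos_left _ hK; linarith
  have h6 : K * β p ≤ K * (c * z) := by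
    apply mul_le_mul_of_nonneg_left _ hK.le; linarith
  linarith

lemma exists_pow_radial (n : ℕ) (B : ℝ) : ∃ k : ℕ, B ≤ 2 * (k : ℝ) * (2 * k + 2 - n) := by
  obtain ⟨j, hj⟩ := exists_nat_ge B
  refine ⟨n + j, ?_⟩
  push_cast
  have hn : (0 : ℝ) ≤ n := n.cast_nonneg
  have hj0 : (0 : ℝ) ≤ j := j.cast_nonneg
  nlinarith [mul_nonneg hn hn, mul_nonneg hn hj0, mul_nonneg hj0 hj0]

lemma inv_pow_two_mul_lt {r₀ : ℝ} (hr₀ : 0 < r₀) {k : ℕ} (hk : k ≠ 0) :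
    (((2 * r₀) ^ 2) ^ k)⁻¹ < ((r₀ ^ 2) ^ k)⁻¹ := by
  apply inv_strictAnti₀ (by positivity)
  apply pow_lt_pow_left₀ _ (by positivity) hk
  nlinarith

set_option maxHeartbeats 1000000 in
/-- Harnack inequality for nonnegative functions with `|Δ w| ≤ K w`. -/
theorem harnack_lap (n : ℕ) {r₀ K : ℝ} (hr₀ : 0 < r₀) (hK : 0 < K) :
    ∃ C : ℝ, 0 < C ∧ ∀ (x₀ : EuclideanSpace ℝ (Fin n)) (w : EuclideanSpace ℝ (Fin n) → ℝ),
      ContDiffOn ℝ 2 w (ball x₀ (4 * r₀)) → (∀ x ∈ ball x₀ (4 * r₀), 0 ≤ w x) →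
      (∀ x ∈ ball x₀ (4 * r₀), |lap n w x| ≤ K * w x) →
      ∀ x ∈ closedBall x₀ (r₀ / 2), w x ≤ C * w x₀ := by
  obtain ⟨k, hk⟩ := exists_pow_radial n (K * (2 * r₀) ^ 2)
  have hk0 : k ≠ 0 := by
    rintro rfl
    have : 0 < K * (2 * r₀) ^ 2 := by positivity
    simp at hk; linarith
  set κ : ℝ := ((r₀ ^ 2) ^ k)⁻¹ - (((2 * r₀) ^ 2) ^ k)⁻¹ with hκ
  have hκ0 : 0 < κ := sub_pos.2 (inv_pow_two_mul_lt hr₀ hk0)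
  set G : ℝ := n * (4 ^ k * (8 * n + K * r₀ ^ 2)) with hG
  have hG0 : 0 ≤ G := by positivity
  set θ : ℝ := 1 / (8 + 2 * G) with hθ
  have hθ0 : 0 < θ := by positivity
  have hθ8 : θ ≤ 1 / 8 := by
    rw [hθ]; apply one_div_le_one_div_of_le (by norm_num); linarith
  have hθG : G * θ ≤ 1 / 2 := by
    rw [hθ, mul_one_div, div_le_iff₀ (by positivity)]; linarith
  set C₁ : ℝ := 2 / ((θ ^ 2) ^ k * κ) with hC₁
  refine ⟨C₁ / ((r₀ / 2) ^ 2) ^ k, by positivity, ?_⟩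
  intro x₀ w hw hw0 hlap x hx
  have hwc : ∀ z ∈ ball x₀ (4 * r₀), ContDiffAt ℝ 2 w z := fun z hz =>
    hw.contDiffAt (isOpen_ball.mem_nhds hz)
  have hsub : closedBall x₀ r₀ ⊆ ball x₀ (4 * r₀) := closedBall_subset_ball (by linarith)
  obtain ⟨y, hy, hymax⟩ := (isCompact_closedBall x₀ r₀).exists_isMaxOn
    ⟨x₀, mem_closedBall_self hr₀.le⟩ (f := fun z => ((r₀ - dist z x₀) ^ 2) ^ k * w z)
    (fun z hz => by
      have h1 : ContinuousAt (fun z => ((r₀ - dist z x₀) ^ 2) ^ k) z := by fun_prop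
      exact (h1.mul (hwc z (hsub hz)).continuousAt).continuousWithinAt)
  set d := r₀ - dist y x₀ with hd
  have hyd : dist y x₀ ≤ r₀ := hy
  have hd0 : 0 ≤ d := by linarith
  have hdr : d ≤ r₀ := by linarith [dist_nonneg (x := y) (y := x₀)]
  have hmax : ∀ z ∈ closedBall x₀ r₀, ((r₀ - dist z x₀) ^ 2) ^ k * w z ≤ (d ^ 2) ^ k * w y :=
    fun z hz => hymax hz
  have hw00 := hw0 x₀ (mem_ball_self (by linarith))
  have hMy : 0 ≤ w y := hw0 y (hsub hy)
  have hxr : dist x x₀ ≤ r₀ / 2 := hx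
  have hx1 : ((r₀ / 2) ^ 2) ^ k * w x ≤ (d ^ 2) ^ k * w y := by
    have h1 := hmax x (closedBall_subset_closedBall (by linarith) hx)
    refine le_trans ?_ h1
    have hwx := hw0 x (hsub (closedBall_subset_closedBall (by linarith) hx))
    apply mul_le_mul_of_nonneg_right _ hwx
    apply pow_le_pow_left₀ (by positivity)
    apply pow_le_pow_left₀ (by positivity)
    linarith
  suffices hmain : (d ^ 2) ^ k * w y ≤ C₁ * w x₀ by
    rw [div_mul_eq_mul_div, le_div_iff₀ (by positivity)]
    linarith
  rcases hd0.eq_or_lt with hd' | hdpos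
  · rw [← hd']
    simp [hk0]
    positivity
  set M := w y with hM
  -- bound on a ball of radius `d / 2`
  have hub : ∀ z ∈ ball y (d / 2), z ∈ ball x₀ (4 * r₀) ∧ w z ≤ 4 ^ k * M := by
    intro z hz
    have h1 : dist z x₀ ≤ d / 2 + dist y x₀ := (dist_triangle z y x₀).trans (by
      have : dist z y < d / 2 := hz
      linarith)
    have h2 : z ∈ closedBall x₀ r₀ := by
      rw [mem_closedBall]; linarith
    have h3 := hmax z h2
    have hwz := hw0 z (hsub h2)
    refine ⟨hsub h2, ?_⟩
    have h4 : ((d / 2) ^ 2) ^ k * w z ≤ ((r₀ - dist z x₀) ^ 2) ^ k * w z := by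
      apply mul_le_mul_of_nonneg_right _ hwz
      apply pow_le_pow_left₀ (by positivity)
      apply pow_le_pow_left₀ (by positivity)
      linarith
    have h5 : ((d / 2) ^ 2) ^ k = (d ^ 2) ^ k / 4 ^ k := by
      rw [← div_pow]; congr 1; ring
    rw [h5] at h4
    have h6 : (d ^ 2) ^ k / 4 ^ k * w z ≤ (d ^ 2) ^ k * M := h4.trans h3
    have h7 : (0 : ℝ) < (d ^ 2) ^ k := by positivity
    have h8 : (0 : ℝ) < 4 ^ k := by positivity
    rw [div_mul_eq_mul_div, div_le_iff₀ h8, mul_assoc] at h6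
    have := le_of_mul_le_mul_left h6 h7
    linarith
  have hgrad : ∀ z ∈ ball y (d / 4), ‖fderiv ℝ w z‖ ≤ G * M / d := by
    intro z hz
    have hzb : ball z (d / 4) ⊆ ball y (d / 2) := by
      apply ball_subset_ball'
      have : dist z y < d / 4 := hz
      linarith
    have hp : ∀ i, |fderiv ℝ w z (stdVec i)| ≤ 4 ^ k * (8 * n + K * r₀ ^ 2) * M / d := by
      intro i
      have h := abs_fderiv_le_interior (v := w) (x := z) (r := d / 4) (A := 4 ^ k * M)
        (N := K * (4 ^ k * M)) (by positivity) (hw.mono fun q hq => (hub q (hzb hq)).1)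
        (fun q hq => by
          have := hub q (hzb hq)
          rw [abs_of_nonneg (hw0 q this.1)]; exact this.2)
        (fun q hq => by
          have := hub q (hzb hq)
          exact (hlap q this.1).trans (mul_le_mul_of_nonneg_left this.2 hK.le)) i
      refine h.trans ?_
      rw [le_div_iff₀ hdpos]
      have e : (2 * n * (4 ^ k * M) / (d / 4) + K * (4 ^ k * M) * (d / 4) / 4) * d
          = 4 ^ k * M * (8 * n + K * (d ^ 2) / 16) := by
        field_simp
        ring
      rw [e]
      have : d ^ 2 ≤ r₀ ^ 2 := by gcongr
      have h9 : K * d ^ 2 / 16 ≤ K * r₀ ^ 2 := by nlinarith [mul_le_mul_of_nonneg_left this hK.le, sq_nonneg d]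
      have h10 : 0 ≤ 4 ^ k * M := by positivity
      nlinarith [mul_le_mul_of_nonneg_left h9 h10]
    refine (norm_le_sum_abs_stdVec _).trans ((Finset.sum_le_sum fun i _ => hp i).trans ?_)
    simp [hG]
    apply le_of_eq; ring
  have hlow : ∀ z ∈ closedBall y (θ * d), M / 2 ≤ w z := by
    intro z hz
    have hzd : dist z y ≤ θ * d := hz
    have hθd : θ * d ≤ 1 / 8 * d := mul_le_mul_of_nonneg_right hθ8 hd0
    have hzb : z ∈ ball y (d / 4) := by
      rw [mem_ball]; linarith
    have h := (convex_ball y (d / 4)).norm_image_sub_le_of_norm_fderiv_le (𝕜 := ℝ) (f := w)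
      (fun q hq => (hwc q (hub q (ball_subset_ball (by linarith) hq)).1).differentiableAt
        (by norm_num)) hgrad (mem_ball_self (by positivity)) hzb
    rw [← dist_eq_norm z y] at h
    have h2 : G * M / d * dist z y ≤ M / 2 := by
      calc G * M / d * dist z y ≤ G * M / d * (θ * d) := by gcongr
        _ = (G * θ) * M := by field_simp
        _ ≤ 1 / 2 * M := by gcongr
        _ = M / 2 := by ring
    have h3 := abs_le.1 (h.trans h2)
    linarith [h3.1]
  have hlower : M / 2 * ((θ * d) ^ 2) ^ k * κ ≤ w x₀ := by
    have hyx : ‖x₀ - y‖ ≤ r₀ := by rw [← dist_eq_norm, dist_comm]; exact hyd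
    by_cases hcase : θ * d ≤ ‖x₀ - y‖
    · have hDU : closedBall y (2 * r₀) ⊆ ball x₀ (4 * r₀) := by
        apply closedBall_subset_ball'; linarith
      have h := supersolution_lower_bound (k := k) (r := θ * d) (by positivity) hK hk isOpen_ball hDU
        hw hw0 (fun z hz => (abs_le.1 (hlap z hz)).2) hlow (by positivity) (x := x₀)
        (by rw [mem_closedBall, dist_eq_norm]; linarith) hcase
      refine le_trans ?_ h
      have h0 : 0 < ‖x₀ - y‖ := lt_of_lt_of_le (by positivity) hcase
      have : ((r₀ ^ 2) ^ k)⁻¹ ≤ ((‖x₀ - y‖ ^ 2) ^ k)⁻¹ := by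
        apply inv_anti₀ (by positivity)
        gcongr
      apply mul_le_mul_of_nonneg_left _ (by positivity)
      simp only [hκ]; linarith
    · push Not at hcase
      have h := hlow x₀ (by rw [mem_closedBall, dist_eq_norm]; exact hcase.le)
      refine le_trans ?_ h
      have h1 : ((θ * d) ^ 2) ^ k * κ ≤ 1 := by
        have h2 : ((θ * d) ^ 2) ^ k ≤ (r₀ ^ 2) ^ k := by
          have : θ * d ≤ r₀ := by nlinarith
          gcongr
        have h3 : κ ≤ ((r₀ ^ 2) ^ k)⁻¹ := by
          have : 0 ≤ (((2 * r₀) ^ 2) ^ k)⁻¹ := by positivity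
          simp only [hκ]; linarith
        calc _ ≤ (r₀ ^ 2) ^ k * ((r₀ ^ 2) ^ k)⁻¹ := by gcongr
          _ = 1 := mul_inv_cancel₀ (by positivity)
      have h4 : 0 ≤ M / 2 := by positivity
      nlinarith
  have e : ((θ * d) ^ 2) ^ k = (θ ^ 2) ^ k * (d ^ 2) ^ k := by rw [← mul_pow, ← mul_pow]
  rw [e] at hlower
  rw [hC₁, div_mul_eq_mul_div, le_div_iff₀ (by positivity)]
  linarith

end Harnack

section Profile

/-- The properties of `f = W'` used in the comparison arguments: it is Lipschitz on `[-1,1]`,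
vanishes at `±1`, and is strictly increasing near `±1`. -/
structure IsBistable (f : ℝ → ℝ) (K κ δ₀ : ℝ) : Prop where
  K_pos : 0 < K
  κ_pos : 0 < κ
  δ₀_pos : 0 < δ₀
  δ₀_lt : δ₀ < 1
  lipschitz : ∀ a ∈ Icc (-1 : ℝ) 1, ∀ b ∈ Icc (-1 : ℝ) 1, |f a - f b| ≤ K * |a - b|
  left_zero : f (-1) = 0
  right_zero : f 1 = 0
  mono_left : ∀ a b, -1 ≤ a → a ≤ b → b ≤ -1 + δ₀ → κ * (b - a) ≤ f b - f a
  mono_right : ∀ a b, 1 - δ₀ ≤ a → a ≤ b → b ≤ 1 → κ * (b - a) ≤ f b - f a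

lemma DoubleWell.exists_isBistable {W : ℝ → ℝ} (hW : DoubleWell W) :
    ∃ K κ δ₀, IsBistable (deriv W) K κ δ₀ := by
  obtain ⟨hC, -, -, -, hl, hr, hl2, hr2⟩ := hW
  set I := Icc (-1 : ℝ) 1 with hI
  have hu : UniqueDiffOn ℝ I := uniqueDiffOn_Icc (by norm_num)
  have hdl : DifferentiableAt ℝ (deriv W) (-1) := differentiableAt_of_deriv_ne_zero hl2.ne'
  have hdr : DifferentiableAt ℝ (deriv W) 1 := differentiableAt_of_deriv_ne_zero hr2.ne'
  have hD1 : ContDiffOn ℝ 1 (derivWithin W I) I := hC.derivWithin hu (by norm_num)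
  have hmemI : ∀ x, x ∈ I → x ≠ -1 → x ≠ 1 → x ∈ Ioo (-1 : ℝ) 1 := fun x hx h1 h2 =>
    ⟨lt_of_le_of_ne hx.1 (Ne.symm h1), lt_of_le_of_ne hx.2 h2⟩
  have hioo : ∀ x ∈ Ioo (-1 : ℝ) 1, derivWithin W I x = deriv W x := fun x hx =>
    derivWithin_of_mem_nhds (Icc_mem_nhds hx.1 hx.2)
  have hbdry : ∀ a : ℝ, a ∈ I → ContinuousAt (deriv W) a →
      a ∈ closure (Ioo (-1 : ℝ) 1) → derivWithin W I a = deriv W a := by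
    intro a ha hca hcl
    have hne : (nhdsWithin a (Ioo (-1 : ℝ) 1)).NeBot := mem_closure_iff_nhdsWithin_neBot.1 hcl
    have h1 : Tendsto (derivWithin W I) (nhdsWithin a (Ioo (-1 : ℝ) 1)) (nhds (derivWithin W I a)) :=
      (hD1.continuousOn a ha).mono Ioo_subset_Icc_self
    have h2 : Tendsto (deriv W) (nhdsWithin a (Ioo (-1 : ℝ) 1)) (nhds (deriv W a)) :=
      hca.tendsto.mono_left nhdsWithin_le_nhds
    refine tendsto_nhds_unique h1 (h2.congr' ?_)
    filter_upwards [self_mem_nhdsWithin] with x hx using (hioo x hx).symm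
  have hcl : closure (Ioo (-1 : ℝ) 1) = I := closure_Ioo (by norm_num)
  have hml : (-1 : ℝ) ∈ I := by simp [hI]
  have hmr : (1 : ℝ) ∈ I := by simp [hI]
  have heq : EqOn (deriv W) (derivWithin W I) I := by
    intro x hx
    by_cases h1 : x = -1
    · subst h1; exact (hbdry _ hx hdl.continuousAt (by rw [hcl]; exact hx)).symm
    by_cases h2 : x = 1
    · subst h2; exact (hbdry _ hx hdr.continuousAt (by rw [hcl]; exact hx)).symm
    exact (hioo x (hmemI x hx h1 h2)).symm
  have hf : ContDiffOn ℝ 1 (deriv W) I := hD1.congr heq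
  have hDc : ContinuousOn (derivWithin (deriv W) I) I :=
    hf.continuousOn_derivWithin hu (by norm_num)
  have hDl : 0 < derivWithin (deriv W) I (-1) := by rwa [hdl.derivWithin (hu _ hml)]
  have hDr : 0 < derivWithin (deriv W) I 1 := by rwa [hdr.derivWithin (hu _ hmr)]
  obtain ⟨K, hK⟩ := isCompact_Icc.exists_bound_of_continuousOn hDc
  set κ := min (derivWithin (deriv W) I (-1)) (derivWithin (deriv W) I 1) / 2 with hκ
  have hκ0 : 0 < κ := half_pos (lt_min hDl hDr)
  have hκl : κ < derivWithin (deriv W) I (-1) := by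
    have := min_le_left (derivWithin (deriv W) I (-1)) (derivWithin (deriv W) I 1)
    linarith
  have hκr : κ < derivWithin (deriv W) I 1 := by
    have := min_le_right (derivWithin (deriv W) I (-1)) (derivWithin (deriv W) I 1)
    linarith
  obtain ⟨ε₁, hε₁, h1⟩ := Metric.mem_nhdsWithin_iff.1 ((hDc _ hml).eventually (lt_mem_nhds hκl))
  obtain ⟨ε₂, hε₂, h2⟩ := Metric.mem_nhdsWithin_iff.1 ((hDc _ hmr).eventually (lt_mem_nhds hκr))
  set δ := min (min ε₁ ε₂) 1 / 2 with hδ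
  have hδ0 : 0 < δ := half_pos (lt_min (lt_min hε₁ hε₂) one_pos)
  have hδ1 : δ < ε₁ := by
    have : min (min ε₁ ε₂) 1 ≤ ε₁ := (min_le_left _ _).trans (min_le_left _ _)
    linarith
  have hδ2 : δ < ε₂ := by
    have : min (min ε₁ ε₂) 1 ≤ ε₂ := (min_le_left _ _).trans (min_le_right _ _)
    linarith
  have hδ3 : δ < 1 := by
    have : min (min ε₁ ε₂) 1 ≤ 1 := min_le_right _ _
    linarith
  have hder : ∀ x ∈ Ioo (-1 : ℝ) 1, DifferentiableAt ℝ (deriv W) x ∧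
      deriv (deriv W) x = derivWithin (deriv W) I x := fun x hx =>
    ⟨(hf.contDiffAt (Icc_mem_nhds hx.1 hx.2)).differentiableAt (by norm_num),
      (derivWithin_of_mem_nhds (Icc_mem_nhds hx.1 hx.2)).symm⟩
  refine ⟨|K| + 1, κ, δ, by positivity, hκ0, hδ0, hδ3, ?_, hl, hr, ?_, ?_⟩
  · intro a ha b hb
    have := (convex_Icc (-1 : ℝ) 1).norm_image_sub_le_of_norm_derivWithin_le
      (hf.differentiableOn (by norm_num)) hK hb ha
    simp only [Real.norm_eq_abs] at this
    refine this.trans (mul_le_mul_of_nonneg_right ?_ (abs_nonneg _))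
    linarith [le_abs_self K]
  · intro a b ha hab hb
    have hsub : Icc (-1 : ℝ) (-1 + δ) ⊆ I := Icc_subset_Icc le_rfl (by linarith)
    refine (convex_Icc (-1 : ℝ) (-1 + δ)).mul_sub_le_image_sub_of_le_deriv
      (hf.continuousOn.mono hsub) ?_ ?_ a ⟨ha, hab.trans hb⟩ b ⟨ha.trans hab, hb⟩ hab
    · rw [interior_Icc]
      intro x hx
      exact (hder x ⟨hx.1, by linarith [hx.2]⟩).1.differentiableWithinAt
    · rw [interior_Icc]
      intro x hx
      rw [(hder x ⟨hx.1, by linarith [hx.2]⟩).2]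
      refine le_of_lt (h1 ⟨?_, hsub (Ioo_subset_Icc_self hx)⟩)
      rw [mem_ball, Real.dist_eq, abs_lt]
      constructor <;> linarith [hx.1, hx.2]
  · intro a b ha hab hb
    have hsub : Icc (1 - δ) 1 ⊆ I := Icc_subset_Icc (by linarith) le_rfl
    refine (convex_Icc (1 - δ) 1).mul_sub_le_image_sub_of_le_deriv
      (hf.continuousOn.mono hsub) ?_ ?_ a ⟨ha, hab.trans hb⟩ b ⟨ha.trans hab, hb⟩ hab
    · rw [interior_Icc]
      intro x hx
      exact (hder x ⟨by linarith [hx.1], hx.2⟩).1.differentiableWithinAt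
    · rw [interior_Icc]
      intro x hx
      rw [(hder x ⟨by linarith [hx.1], hx.2⟩).2]
      refine le_of_lt (h2 ⟨?_, hsub (Ioo_subset_Icc_self hx)⟩)
      rw [mem_ball, Real.dist_eq, abs_lt]
      constructor <;> linarith [hx.1, hx.2]

lemma ContDiff.hasDerivAt_two {p : ℝ → ℝ} (hp : ContDiff ℝ 2 p) (t : ℝ) :
    HasDerivAt p (deriv p t) t ∧ HasDerivAt (deriv p) (deriv (deriv p) t) t := by
  refine ⟨(hp.differentiable (by norm_num)).differentiableAt.hasDerivAt, ?_⟩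
  have : ContDiff ℝ 1 (deriv p) := by
    have h : ContDiff ℝ (1 + 1) p := by rwa [one_add_one_eq_two]
    exact (contDiff_succ_iff_deriv.1 h).2.2
  exact (this.differentiable (by norm_num)).differentiableAt.hasDerivAt

/-- Positive increasing functions vanishing at `-∞` with `κ p ≤ p'' ≤ K p` satisfy `p' ≤ √K p`
and decay exponentially at `-∞`. -/
lemma decay_of_deriv2_bounds {p : ℝ → ℝ} {K κ T : ℝ} (hK : 0 < K) (hκ : 0 < κ)
    (hp : ContDiff ℝ 2 p) (hpos : ∀ t, 0 < p t) (hp' : ∀ t, 0 < deriv p t)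
    (hlim : Tendsto p atBot (nhds 0))
    (h2 : ∀ t ≤ -T, κ * p t ≤ deriv (deriv p) t ∧ deriv (deriv p) t ≤ K * p t) :
    (∀ t ≤ -T, deriv p t ≤ √K * p t) ∧
      ∀ k : ℕ, Tendsto (fun t => t ^ k * p (-t)) atTop (nhds 0) := by
  have hd := hp.hasDerivAt_two
  have hmono : MonotoneOn (deriv p) (Iic (-T)) := by
    apply monotoneOn_of_deriv_nonneg (convex_Iic _)
    · exact fun t _ => (hd t).2.continuousAt.continuousWithinAt
    · exact fun t _ => (hd t).2.differentiableAt.differentiableWithinAt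
    · intro t ht
      rw [interior_Iic] at ht
      exact (mul_nonneg hκ.le (hpos t).le).trans (h2 t (le_of_lt ht)).1
  have hlim' : Tendsto (deriv p) atBot (nhds 0) := by
    have h1 : Tendsto (fun a => p (a + 1)) atBot (nhds 0) :=
      hlim.comp (tendsto_atBot_add_const_right _ 1 tendsto_id)
    refine tendsto_of_tendsto_of_tendsto_of_le_of_le' tendsto_const_nhds h1
      (Eventually.of_forall fun t => (hp' t).le) ?_
    filter_upwards [eventually_le_atBot (-T - 1)] with a ha
    obtain ⟨ξ, hξ, hξ'⟩ := exists_deriv_eq_slope p (show a < a + 1 by linarith)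
      (fun t _ => (hd t).1.continuousAt.continuousWithinAt)
      (fun t _ => (hd t).1.differentiableAt.differentiableWithinAt)
    have h3 : deriv p a ≤ deriv p ξ := hmono (by simp; linarith) (by simp; linarith [hξ.2]) hξ.1.le
    have h4 := hpos a
    simp at hξ'
    linarith
  have henergy : ∀ c : ℝ, ∀ t, HasDerivAt (fun t => deriv p t ^ 2 - c * p t ^ 2)
      (2 * deriv p t * (deriv (deriv p) t - c * p t)) t := by
    intro c t
    have := ((hd t).2.pow 2).sub (((hd t).1.pow 2).const_mul c)
    refine this.congr_deriv ?_
    simp; ring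
  have henlim : ∀ c : ℝ, Tendsto (fun t => deriv p t ^ 2 - c * p t ^ 2) atBot (nhds 0) := by
    intro c
    have := (hlim'.pow 2).sub ((hlim.pow 2).const_mul c)
    simpa using this
  have hupper : ∀ t ≤ -T, deriv p t ^ 2 - K * p t ^ 2 ≤ 0 := by
    intro t ht
    have hanti : AntitoneOn (fun t => deriv p t ^ 2 - K * p t ^ 2) (Iic (-T)) := by
      apply antitoneOn_of_deriv_nonpos (convex_Iic _)
      · exact fun t _ => (henergy K t).continuousAt.continuousWithinAt
      · exact fun t _ => (henergy K t).differentiableAt.differentiableWithinAt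
      · intro t ht
        rw [interior_Iic] at ht
        rw [(henergy K t).deriv]
        have := (h2 t (le_of_lt ht)).2
        exact mul_nonpos_of_nonneg_of_nonpos (by have := hp' t; positivity) (by linarith)
    refine ge_of_tendsto (henlim K) ?_
    filter_upwards [eventually_le_atBot t] with s hs
    exact hanti (show s ≤ -T from hs.trans ht) ht hs
  have hlower : ∀ t ≤ -T, 0 ≤ deriv p t ^ 2 - κ * p t ^ 2 := by
    intro t ht
    have hm : MonotoneOn (fun t => deriv p t ^ 2 - κ * p t ^ 2) (Iic (-T)) := by
      apply monotoneOn_of_deriv_nonneg (convex_Iic _)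
      · exact fun t _ => (henergy κ t).continuousAt.continuousWithinAt
      · exact fun t _ => (henergy κ t).differentiableAt.differentiableWithinAt
      · intro t ht
        rw [interior_Iic] at ht
        rw [(henergy κ t).deriv]
        have := (h2 t (le_of_lt ht)).1
        exact mul_nonneg (by have := hp' t; positivity) (by linarith)
    refine le_of_tendsto (henlim κ) ?_
    filter_upwards [eventually_le_atBot t] with s hs
    exact hm (show s ≤ -T from hs.trans ht) ht hs
  have hlower' : ∀ t ≤ -T, √κ * p t ≤ deriv p t := by
    intro t ht
    apply abs_le_of_sq_le_sq' _ (hp' t).le |>.2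
    rw [mul_pow, Real.sq_sqrt hκ.le]
    linarith [hlower t ht]
  refine ⟨?_, ?_⟩
  · intro t ht
    apply abs_le_of_sq_le_sq' _ (mul_nonneg (Real.sqrt_nonneg _) (hpos t).le) |>.2
    rw [mul_pow, Real.sq_sqrt hK.le]
    linarith [hupper t ht]
  · intro k
    set σ := √κ with hσ
    have hσ0 : 0 < σ := Real.sqrt_pos.2 hκ
    have hexp : ∀ t, HasDerivAt (fun t => p t * Real.exp (-σ * t))
        ((deriv p t - σ * p t) * Real.exp (-σ * t)) t := by
      intro t
      have h1 : HasDerivAt (fun t => -σ * t) (-σ) t := by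
        simpa using (hasDerivAt_id t).const_mul (-σ)
      refine ((hd t).1.mul h1.exp).congr_deriv ?_
      ring
    have hm : MonotoneOn (fun t => p t * Real.exp (-σ * t)) (Iic (-T)) := by
      apply monotoneOn_of_deriv_nonneg (convex_Iic _)
      · exact fun t _ => (hexp t).continuousAt.continuousWithinAt
      · exact fun t _ => (hexp t).differentiableAt.differentiableWithinAt
      · intro t ht
        rw [interior_Iic] at ht
        rw [(hexp t).deriv]
        exact mul_nonneg (by linarith [hlower' t (le_of_lt ht)]) (Real.exp_pos _).le
    set C := p (-T) * Real.exp (-σ * (-T)) with hC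
    have hbound : ∀ t, T ≤ t → p (-t) ≤ C * Real.exp (-σ * t) := by
      intro t ht
      have h := hm (show -t ≤ -T by linarith) (show -T ≤ -T from le_rfl) (by linarith)
      simp only at h
      have e : Real.exp (-σ * -t) * Real.exp (-σ * t) = 1 := by
        rw [← Real.exp_add]; simp
      calc p (-t) = p (-t) * Real.exp (-σ * -t) * Real.exp (-σ * t) := by
            rw [mul_assoc, e, mul_one]
        _ ≤ C * Real.exp (-σ * t) := mul_le_mul_of_nonneg_right h (Real.exp_pos _).le
    have hlimk : Tendsto (fun t : ℝ => C * (t ^ k * Real.exp (-σ * t))) atTop (nhds 0) := by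
      have := (tendsto_rpow_mul_exp_neg_mul_atTop_nhds_zero (k : ℝ) σ hσ0).const_mul C
      simpa [Real.rpow_natCast] using this
    refine tendsto_of_tendsto_of_tendsto_of_le_of_le' tendsto_const_nhds hlimk ?_ ?_
    · filter_upwards [eventually_ge_atTop 0] with t ht
      exact mul_nonneg (by positivity) (hpos _).le
    · filter_upwards [eventually_ge_atTop 0, eventually_ge_atTop T] with t ht ht'
      calc t ^ k * p (-t) ≤ t ^ k * (C * Real.exp (-σ * t)) :=
            mul_le_mul_of_nonneg_left (hbound t ht') (by positivity)
        _ = _ := by ring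

/-- The tail behaviour of the one-dimensional profile. -/
structure ProfileTails (f g : ℝ → ℝ) (δ₀ T κ₁ : ℝ) : Prop where
  T_pos : 0 < T
  κ₁_pos : 0 < κ₁
  left : ∀ t ≤ -T, κ₁ * deriv g t ≤ f (g t) ∧ g t ≤ -1 + δ₀ / 2
  right : ∀ t, T ≤ t → f (g t) ≤ -(κ₁ * deriv g t) ∧ 1 - δ₀ ≤ g t
  left_decay : ∀ k : ℕ, Tendsto (fun t => t ^ k * (1 + g (-t))) atTop (nhds 0)
  right_decay : ∀ k : ℕ, Tendsto (fun t => t ^ k * (1 - g t)) atTop (nhds 0)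

lemma IsOneDSolution.exists_profileTails {W g : ℝ → ℝ} {K κ δ₀ : ℝ}
    (hf : IsBistable (deriv W) K κ δ₀) (hg : IsOneDSolution W g) :
    ∃ T κ₁, ProfileTails (deriv W) g δ₀ T κ₁ := by
  obtain ⟨hgC, hgm, hgeq, hg', -, hgt, hgb⟩ := hg
  have hδ := hf.δ₀_pos
  have hδ1 := hf.δ₀_lt
  have hev1 : ∀ᶠ t in atBot, g t < -1 + δ₀ / 2 := hgb.eventually (gt_mem_nhds (by linarith))
  have hev2 : ∀ᶠ t in atTop, 1 - δ₀ < g t := hgt.eventually (lt_mem_nhds (by linarith))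
  obtain ⟨T₁, hT₁⟩ := eventually_atBot.1 hev1
  obtain ⟨T₂, hT₂⟩ := eventually_atTop.1 hev2
  set T := max 1 (max (-T₁) T₂) with hT
  have hTa : 1 ≤ T := le_max_left _ _
  have hTb : -T₁ ≤ T := (le_max_left _ _).trans (le_max_right _ _)
  have hTc : T₂ ≤ T := (le_max_right _ _).trans (le_max_right _ _)
  have hd := hgC.hasDerivAt_two
  have hK := hf.K_pos
  have hκ := hf.κ_pos
  -- the left tail
  have e1 : deriv (fun t => 1 + g t) = deriv g := by
    ext t; rw [deriv_const_add]
  have hl := decay_of_deriv2_bounds (p := fun t => 1 + g t) (T := T) hK hκ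
    (contDiff_const.add hgC) (fun t => by linarith [(hgm t).1])
    (fun t => by rw [e1]; exact hg' t)
    (by have := hgb.const_add 1; simpa using this)
    (by
      intro t ht
      rw [e1, hgeq]
      have h1 := hf.mono_left (-1) (g t) le_rfl (hgm t).1.le (by
        have := hT₁ t (by linarith)
        linarith)
      have h2 := hf.lipschitz (g t) (Ioo_subset_Icc_self (hgm t)) (-1) (by simp)
      rw [hf.left_zero] at h1 h2
      rw [abs_of_nonneg (show 0 ≤ g t - -1 by linarith [(hgm t).1])] at h2
      exact ⟨by linarith, by linarith [le_abs_self (deriv W (g t) - 0)]⟩)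
  -- the right tail
  have e2 : deriv (fun t => 1 - g (-t)) = fun t => deriv g (-t) := by
    ext t
    have := ((hd (-t)).1.comp t (hasDerivAt_neg t)).const_sub 1
    simpa using this.deriv
  have e3 : deriv (fun t => deriv g (-t)) = fun t => -deriv (deriv g) (-t) := by
    ext t
    have := ((hd (-t)).2.comp t (hasDerivAt_neg t))
    simpa [Function.comp_def] using this.deriv
  have hr := decay_of_deriv2_bounds (p := fun t => 1 - g (-t)) (T := T) hK hκ
    (contDiff_const.sub (hgC.comp contDiff_neg)) (fun t => by linarith [(hgm (-t)).2])
    (fun t => by rw [e2]; exact hg' _)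
    (by have := (hgt.comp tendsto_neg_atBot_atTop).const_sub 1; simpa using this)
    (by
      intro t ht
      rw [e2, e3]
      simp only [hgeq]
      have h1 := hf.mono_right (g (-t)) 1 (by
        have := hT₂ (-t) (by linarith)
        linarith) (hgm (-t)).2.le le_rfl
      have h2 := hf.lipschitz (g (-t)) (Ioo_subset_Icc_self (hgm (-t))) 1 (by simp)
      rw [hf.right_zero] at h1 h2
      rw [abs_of_nonpos (show g (-t) - 1 ≤ 0 by linarith [(hgm (-t)).2])] at h2
      exact ⟨by linarith, by linarith [neg_abs_le (deriv W (g (-t)) - 0)]⟩)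
  have hsK : 0 < √K := Real.sqrt_pos.2 hK
  refine ⟨T, κ / √K, by linarith, by positivity, ?_, ?_, hl.2, ?_⟩
  · intro t ht
    have hsmall := hT₁ t (by linarith)
    refine ⟨?_, hsmall.le⟩
    have h1 := hf.mono_left (-1) (g t) le_rfl (hgm t).1.le (by linarith)
    have h2 := hl.1 t ht
    rw [e1] at h2
    rw [hf.left_zero] at h1
    calc κ / √K * deriv g t ≤ κ / √K * (√K * (1 + g t)) := by gcongr
      _ = κ * (1 + g t) := by field_simp
      _ ≤ _ := by linarith
  · intro t ht
    have hsmall := hT₂ t (by linarith)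
    refine ⟨?_, hsmall.le⟩
    have h1 := hf.mono_right (g t) 1 hsmall.le (hgm t).2.le le_rfl
    have h2 := hr.1 (-t) (by linarith)
    rw [e2] at h2
    rw [hf.right_zero] at h1
    simp only [neg_neg] at h2
    have : κ / √K * deriv g t ≤ κ * (1 - g t) := by
      calc κ / √K * deriv g t ≤ κ / √K * (√K * (1 - g t)) := by gcongr
        _ = κ * (1 - g t) := by field_simp
    linarith
  · intro k
    simpa using hr.2 k

end Profile

section Barrier

variable {n : ℕ}
local notation "E" => EuclideanSpace ℝ (Fin n)

/-- The pointwise differential inequality behind the radial barrier, away from the profile's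
transition layer on the left. -/
lemma barrier_ineq_left {N ρ κ₁ K₁ γ F FD Q p e : ℝ} (hN : 0 ≤ N) (hρ : 0 < ρ) (hγ : 0 < γ)
    (hK₁ : 2 * N < κ₁ * K₁) (hF : κ₁ * γ ≤ F) (hκ₁ : 0 < κ₁) (hFD : F ≤ FD) (hQ : 0 ≤ Q)
    (hQ1 : Q ≤ 1) (hp : K₁ ≤ p) (hpρ : p ≤ ρ) (he : 0 ≤ e) :
    Q * (F * (1 - p / ρ) ^ 2 + γ * (-e / ρ)) + N / ρ * (γ * (1 - p / ρ)) < FD := by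
  have hF0 : 0 < F := lt_of_lt_of_le (by positivity) hF
  have hp1 : p / ρ ≤ 1 := (div_le_one hρ).2 hpρ
  have hK0 : 0 < K₁ := by
    by_contra h
    push Not at h
    nlinarith
  have hp0 : K₁ / ρ ≤ p / ρ := by gcongr
  have hKρ : 0 < K₁ / ρ := by positivity
  set q := p / ρ
  have h1 : Q * (F * (1 - q) ^ 2 + γ * (-e / ρ)) ≤ F * (1 - q) := by
    have a1 : γ * (-e / ρ) ≤ 0 :=
      mul_nonpos_of_nonneg_of_nonpos hγ.le (div_nonpos_of_nonpos_of_nonneg (by linarith) hρ.le)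
    have a2 : F * (1 - q) ^ 2 ≤ F * (1 - q) := by
      apply mul_le_mul_of_nonneg_left _ hF0.le
      nlinarith
    have a3 : 0 ≤ F * (1 - q) := mul_nonneg hF0.le (by linarith)
    nlinarith
  have h2 : N / ρ * (γ * (1 - q)) ≤ N / ρ * γ := by
    apply mul_le_mul_of_nonneg_left _ (by positivity)
    nlinarith
  have h3 : N / ρ * γ < F * (K₁ / ρ) := by
    have : N * γ < F * K₁ := by nlinarith
    calc N / ρ * γ = N * γ / ρ := by ring
      _ < F * K₁ / ρ := by gcongr
      _ = _ := by ring
  nlinarith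

/-- The pointwise differential inequality behind the radial barrier, away from the profile's
transition layer on the right. -/
lemma barrier_ineq_right {N ρ κ₁ K₁ γ F FD Q p e : ℝ} (hN : 0 ≤ N) (hρ : 0 < ρ) (hγ : 0 < γ)
    (hK₁ : 2 * N < κ₁ * K₁) (hF : F ≤ -(κ₁ * γ)) (hκ₁ : 0 < κ₁) (hFD : F ≤ FD)
    (hQ1 : 1 ≤ Q) (hp : K₁ ≤ p) (hpρ : p ≤ ρ) (he : 0 ≤ e) :
    Q * (F * (1 + p / ρ) ^ 2 + γ * (-e / ρ)) + N / ρ * (γ * (1 + p / ρ)) < FD := by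
  have hF0 : F < 0 := lt_of_le_of_lt hF (by nlinarith)
  have hp1 : p / ρ ≤ 1 := (div_le_one hρ).2 hpρ
  have hK0 : 0 < K₁ := by
    by_contra h
    push Not at h
    nlinarith
  have hp0 : K₁ / ρ ≤ p / ρ := by gcongr
  have hKρ : 0 < K₁ / ρ := by positivity
  set q := p / ρ
  have h1 : Q * (F * (1 + q) ^ 2 + γ * (-e / ρ)) ≤ F * (1 + q) := by
    have a1 : γ * (-e / ρ) ≤ 0 :=
      mul_nonpos_of_nonneg_of_nonpos hγ.le (div_nonpos_of_nonpos_of_nonneg (by linarith) hρ.le)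
    have a2 : F * (1 + q) ^ 2 ≤ F * (1 + q) := by
      apply mul_le_mul_of_nonpos_left _ hF0.le
      nlinarith
    have a3 : F * (1 + q) ≤ 0 := mul_nonpos_of_nonpos_of_nonneg hF0.le (by linarith)
    nlinarith
  have h2 : N / ρ * (γ * (1 + q)) ≤ N / ρ * (γ * 2) := by
    gcongr; linarith
  have h3 : N / ρ * (γ * 2) < -F * (K₁ / ρ) := by
    have : N * γ * 2 < -F * K₁ := by nlinarith
    calc N / ρ * (γ * 2) = N * γ * 2 / ρ := by ring
      _ < -F * K₁ / ρ := by gcongr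
      _ = _ := by ring
  nlinarith

/-- The pointwise differential inequality behind the radial barrier in the transition layer. -/
lemma barrier_ineq_mid {N ρ K K₁ S Λ m G B γ F FD Q q p e : ℝ} (hN : 0 ≤ N) (hρ : 0 < ρ)
    (hm : 0 < m) (hmγ : m ≤ γ) (hγG : γ ≤ G) (hF : |F| ≤ B) (hFD : F - K / ρ ≤ FD)
    (hQ : |Q - 1| ≤ 2 * S / ρ) (hSρ : 4 * S ≤ ρ) (hq : |q - 1| ≤ p / ρ) (hp0 : 0 ≤ p) (hpρ : p ≤ ρ)
    (he : 0 ≤ e) (hΛ : 0 < Λ) (hpe : p = K₁ + e / Λ) (hΛm : 12 * B ≤ Λ * m)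
    (hbig : B * (8 * S + 3 * K₁) + 2 * N * G + K < e * m / 4) :
    Q * (F * q ^ 2 + γ * (-e / ρ)) + N / ρ * (γ * q) < FD := by
  have hB : 0 ≤ B := (abs_nonneg _).trans hF
  have hp1 : p / ρ ≤ 1 := (div_le_one hρ).2 hpρ
  have hS1 : 2 * S / ρ ≤ 1 / 2 := by rw [div_le_iff₀ hρ]; linarith
  obtain ⟨hQ1, hQ2⟩ := abs_le.1 hQ
  obtain ⟨hq1, hq2⟩ := abs_le.1 hq
  have hq0 : 0 ≤ q := by linarith
  have hqq : q ≤ 2 := by linarith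
  have hQh : 1 / 2 ≤ Q := by linarith
  have h1 : |Q * q ^ 2 - 1| ≤ (8 * S + 3 * p) / ρ := by
    have e1 : Q * q ^ 2 - 1 = (Q - 1) * q ^ 2 + (q - 1) * (q + 1) := by ring
    rw [e1]
    refine (abs_add_le _ _).trans ?_
    rw [abs_mul, abs_mul, abs_of_nonneg (sq_nonneg q), abs_of_nonneg (show 0 ≤ q + 1 by linarith)]
    have a1 : |Q - 1| * q ^ 2 ≤ 2 * S / ρ * 4 := by
      apply mul_le_mul hQ (by nlinarith) (sq_nonneg _) ((abs_nonneg _).trans hQ)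
    have a2 : |q - 1| * (q + 1) ≤ p / ρ * 3 :=
      mul_le_mul hq (by linarith) (by linarith) (by positivity)
    calc _ ≤ 2 * S / ρ * 4 + p / ρ * 3 := add_le_add a1 a2
      _ = _ := by ring
  have h2 : F * (Q * q ^ 2 - 1) ≤ B * ((8 * S + 3 * p) / ρ) := by
    refine (le_abs_self _).trans ?_
    rw [abs_mul]
    exact mul_le_mul hF h1 (abs_nonneg _) hB
  have heρ : 0 ≤ e / ρ := by positivity
  have h3 : 1 / 2 * (m * (e / ρ)) ≤ Q * (γ * (e / ρ)) := by
    apply mul_le_mul hQh _ (by positivity) (by linarith)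
    gcongr
  have h4 : N / ρ * (γ * q) ≤ N / ρ * (G * 2) := by
    gcongr
    linarith
  have h5 : B * (8 * S + 3 * p) + 2 * N * G + K < e * m / 2 := by
    have : B * (3 * (e / Λ)) ≤ e * m / 4 := by
      have : B * (3 * (e / Λ)) = (12 * B) * (e / Λ) / 4 := by ring
      rw [this]
      have : 12 * B * (e / Λ) ≤ Λ * m * (e / Λ) := by gcongr
      have e2 : Λ * m * (e / Λ) = e * m := by field_simp
      linarith
    rw [hpe]
    nlinarith
  have h6 : (B * (8 * S + 3 * p) + 2 * N * G + K) / ρ < (e * m / 2) / ρ := by gcongr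
  have e3 : (B * (8 * S + 3 * p) + 2 * N * G + K) / ρ
      = B * ((8 * S + 3 * p) / ρ) + N / ρ * (G * 2) + K / ρ := by ring
  have e4 : (e * m / 2) / ρ = 1 / 2 * (m * (e / ρ)) := by ring
  have e5 : Q * (F * q ^ 2 + γ * (-e / ρ)) = F + F * (Q * q ^ 2 - 1) - Q * (γ * (e / ρ)) := by ring
  rw [e5]
  rw [e3, e4] at h6
  linarith

/-- A reparametrization of the line which turns the one-dimensional profile, composed with a
radial function of gradient one on the sphere of radius `ρ`, into a strict supersolution. -/
structure IsStretch (n : ℕ) (f g : ℝ → ℝ) (τ : ℝ → ℝ → ℝ) (M A : ℝ) : Prop where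
  one_le : 1 ≤ M
  A_pos : 0 < A
  cont : ContinuousOn (fun p : ℝ × ℝ => τ p.1 p.2) {p | 0 < p.1}
  self_le : ∀ ρ, 0 < ρ → ∀ s, s ≤ τ ρ s
  le_add : ∀ ρ, 0 < ρ → ∀ s, τ ρ s ≤ s + A * (|s| + 1) / ρ
  one_sub_le : ∀ ρ, M ≤ ρ → 1 - g ρ ≤ 1 / ρ
  super : ∀ ρ, M ≤ ρ → ∀ (y p : EuclideanSpace ℝ (Fin n)) (δ : ℝ), 0 ≤ δ → δ ≤ 1 / ρ →
    (‖p - y‖ ^ 2 - ρ ^ 2) / (2 * ρ) ≠ 0 →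
    g (τ ρ ((‖p - y‖ ^ 2 - ρ ^ 2) / (2 * ρ))) + δ ≤ 1 →
    ContDiffAt ℝ 2 (fun x => g (τ ρ ((‖x - y‖ ^ 2 - ρ ^ 2) / (2 * ρ))) + δ) p ∧
    lap n (fun x => g (τ ρ ((‖x - y‖ ^ 2 - ρ ^ 2) / (2 * ρ))) + δ) p <
      f (g (τ ρ ((‖p - y‖ ^ 2 - ρ ^ 2) / (2 * ρ))) + δ)

/-- The explicit stretching function. -/
def stretch (K₁ B Λ ρ s : ℝ) : ℝ := s + (K₁ * |s| + B / Λ * (1 - Real.exp (-Λ * |s|))) / ρ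

lemma stretch_derivs {K₁ B Λ ρ s δ : ℝ} {g : ℝ → ℝ} (hg : ContDiff ℝ 2 g) (hΛ : Λ ≠ 0) {σ : ℝ}
    (hσ : σ ^ 2 = 1) (hs : 0 < σ * s) :
    ContDiffAt ℝ 2 (fun t => g (stretch K₁ B Λ ρ t) + δ) s ∧
    deriv (fun t => g (stretch K₁ B Λ ρ t) + δ) s =
      deriv g (stretch K₁ B Λ ρ s) * (1 + σ * ((K₁ + B * Real.exp (-Λ * |s|)) / ρ)) ∧
    deriv (deriv (fun t => g (stretch K₁ B Λ ρ t) + δ)) s =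
      deriv (deriv g) (stretch K₁ B Λ ρ s) *
        (1 + σ * ((K₁ + B * Real.exp (-Λ * |s|)) / ρ)) ^ 2 +
      deriv g (stretch K₁ B Λ ρ s) * (-(B * Λ * Real.exp (-Λ * |s|)) / ρ) := by
  have habs : ∀ t, 0 < σ * t → |t| = σ * t := by
    intro t ht
    have h1 : |σ| = 1 := by
      have : |σ| ^ 2 = 1 := by rw [sq_abs, hσ]
      nlinarith [abs_nonneg σ]
    rw [← abs_of_pos ht, abs_mul, h1, one_mul]
  set τ : ℝ → ℝ := fun t => t + (K₁ * (σ * t) + B / Λ * (1 - Real.exp (-Λ * (σ * t)))) / ρ with hτ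
  set τ' : ℝ → ℝ := fun t => 1 + σ * ((K₁ + B * Real.exp (-Λ * (σ * t))) / ρ) with hτ'
  have hopen : ∀ t, 0 < σ * t → ∀ᶠ r in nhds t, 0 < σ * r := fun t ht =>
    (continuous_const.mul continuous_id).continuousAt.eventually (lt_mem_nhds ht)
  have heq : ∀ t, 0 < σ * t → stretch K₁ B Λ ρ t = τ t := fun t ht => by
    simp only [stretch, hτ, habs t ht]
  have hev : ∀ t, 0 < σ * t →
      (fun t => g (stretch K₁ B Λ ρ t) + δ) =ᶠ[nhds t] fun t => g (τ t) + δ := by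
    intro t ht
    filter_upwards [hopen t ht] with r hr
    simp only [heq r hr]
  have hexp : ∀ t, HasDerivAt (fun t => Real.exp (-Λ * (σ * t)))
      (Real.exp (-Λ * (σ * t)) * (-Λ * σ)) t := by
    intro t
    have h1 : HasDerivAt (fun t => -Λ * (σ * t)) (-Λ * σ) t := by
      simpa using ((hasDerivAt_id t).const_mul σ).const_mul (-Λ)
    exact h1.exp
  have hdτ : ∀ t, HasDerivAt τ (τ' t) t := by
    intro t
    have h1 : HasDerivAt (fun t => K₁ * (σ * t)) (K₁ * σ) t := by
      simpa using ((hasDerivAt_id t).const_mul σ).const_mul K₁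
    have h2 := (((hexp t).const_sub 1).const_mul (B / Λ))
    refine ((hasDerivAt_id t).add ((h1.add h2).div_const ρ)).congr_deriv ?_
    simp only [hτ']
    field_simp
  have hdτ' : ∀ t, HasDerivAt τ' (-(B * Λ * Real.exp (-Λ * (σ * t))) / ρ) t := by
    intro t
    refine (((((hexp t).const_mul B).const_add K₁).div_const ρ).const_mul σ |>.const_add 1).congr_deriv ?_
    have : σ * (B * (Real.exp (-Λ * (σ * t)) * (-Λ * σ)) / ρ)
      = σ ^ 2 * (-(B * Λ * Real.exp (-Λ * (σ * t))) / ρ) := by ring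
    rw [this, hσ, one_mul]
  have hd := hg.hasDerivAt_two
  have hd1 : ∀ t, HasDerivAt (fun t => g (τ t) + δ) (deriv g (τ t) * τ' t) t := fun t =>
    ((hd (τ t)).1.comp t (hdτ t)).add_const δ
  have hD1 : ∀ t, 0 < σ * t →
      deriv (fun t => g (stretch K₁ B Λ ρ t) + δ) t = deriv g (τ t) * τ' t := fun t ht => by
    rw [(hev t ht).deriv_eq, (hd1 t).deriv]
  have hD2 : deriv (deriv (fun t => g (stretch K₁ B Λ ρ t) + δ)) s =
      deriv (deriv g) (τ s) * τ' s * τ' s +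
        deriv g (τ s) * (-(B * Λ * Real.exp (-Λ * (σ * s))) / ρ) := by
    have : deriv (fun t => g (stretch K₁ B Λ ρ t) + δ) =ᶠ[nhds s]
        fun t => deriv g (τ t) * τ' t := by
      filter_upwards [hopen s hs] with r hr using hD1 r hr
    rw [this.deriv_eq]
    exact (((hd (τ s)).2.comp s (hdτ s)).mul (hdτ' s)).deriv
  refine ⟨?_, ?_, ?_⟩
  · refine ContDiffAt.congr_of_eventuallyEq ?_ (hev s hs)
    have : ContDiff ℝ 2 τ := by
      simp only [hτ]
      fun_prop
    exact ((hg.comp this).add contDiff_const).contDiffAt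
  · rw [hD1 s hs, heq s hs, habs s hs]
  · rw [hD2, heq s hs, habs s hs]
    ring

end Barrier

section BarrierExistence

set_option maxHeartbeats 1000000 in
lemma exists_isStretch (n : ℕ) {W g : ℝ → ℝ} {K κ δ₀ T κ₁ : ℝ}
    (hf : IsBistable (deriv W) K κ δ₀) (hg : IsOneDSolution W g)
    (ht : ProfileTails (deriv W) g δ₀ T κ₁) :
    ∃ τ M A, IsStretch n (deriv W) g τ M A := by
  obtain ⟨hgC, hgm, hgeq, hg', -, -, -⟩ := hg
  set f := deriv W with hfdef
  have hT := ht.T_pos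
  have hκ₁ := ht.κ₁_pos
  have hK := hf.K_pos
  have hδ₀ := hf.δ₀_pos
  set S := 2 * T + 2 with hS
  have hS0 : 0 < S := by positivity
  have hcont : Continuous (deriv g) := hgC.continuous_deriv (by norm_num)
  have hne : (Icc (-(S + 1)) (S + 1)).Nonempty := ⟨0, by constructor <;> linarith⟩
  obtain ⟨tm, -, htm⟩ := isCompact_Icc.exists_isMinOn hne hcont.continuousOn
  obtain ⟨tM, -, htM⟩ := isCompact_Icc.exists_isMaxOn hne hcont.continuousOn
  set m := deriv g tm
  set G := deriv g tM
  have hm : 0 < m := hg' tm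
  have hG : 0 < G := hg' tM
  have hmle : ∀ t ∈ Icc (-(S + 1)) (S + 1), m ≤ deriv g t := fun t h => htm h
  have hGle : ∀ t ∈ Icc (-(S + 1)) (S + 1), deriv g t ≤ G := fun t h => htM h
  clear_value m G S
  have hfB : ∀ a ∈ Icc (-1 : ℝ) 1, |f a| ≤ 2 * K := by
    intro a ha
    have := hf.lipschitz a ha (-1) (by simp)
    rw [hf.left_zero, sub_zero, abs_of_nonneg (show 0 ≤ a - -1 by linarith [ha.1])] at this
    linarith [mul_le_mul_of_nonneg_left (show a - -1 ≤ 2 by linarith [ha.2]) hK.le]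
  set N : ℝ := (n : ℝ) with hN
  have hN0 : 0 ≤ N := Nat.cast_nonneg n
  set K₁ := (2 * N + 1) / κ₁ with hK₁
  have hK₁0 : 0 < K₁ := by positivity
  have hK₁' : 2 * N < κ₁ * K₁ := by rw [hK₁, mul_div_cancel₀ _ hκ₁.ne']; linarith
  set Λ := 12 * (2 * K) / m with hΛ
  have hΛ0 : 0 < Λ := by positivity
  have hΛm : 12 * (2 * K) ≤ Λ * m := by rw [hΛ, div_mul_cancel₀ _ hm.ne']
  set X := 2 * K * (8 * S + 3 * K₁) + 2 * N * G + K with hX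
  have hX0 : 0 < X := by positivity
  set B := (X + 1) * 4 / (Λ * m * Real.exp (-Λ * S)) with hB
  have hexpS := Real.exp_pos (-Λ * S)
  have hB0 : 0 < B := by positivity
  have hBX : X < B * Λ * Real.exp (-Λ * S) * m / 4 := by
    have : B * Λ * Real.exp (-Λ * S) * m / 4 = X + 1 := by
      rw [hB]; field_simp
    linarith
  have hev : ∀ᶠ t in atTop, 1 - g t ≤ 1 / t := by
    filter_upwards [(ht.right_decay 1).eventually (gt_mem_nhds (one_pos)), eventually_gt_atTop 0]
      with t h1 h2
    rw [le_div_iff₀ h2]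
    linarith
  obtain ⟨M₀, hM₀⟩ := eventually_atTop.1 hev
  have hBΛ : 0 < B / Λ := by positivity
  set A := K₁ + B / Λ with hA
  set M := max 1 (max M₀ (4 * (K₁ + B) + 4 * (B / Λ) + 4 * S + A * (S + 1) + 2 / δ₀)) with hM
  have h2δ : 0 < 2 / δ₀ := by positivity
  have hA0 : 0 < A := by positivity
  have hAS : 0 < A * (S + 1) := by positivity
  have hMbig : ∀ ρ, M ≤ ρ →
      1 ≤ ρ ∧ M₀ ≤ ρ ∧ 4 * (K₁ + B) + 4 * (B / Λ) + 4 * S + A * (S + 1) + 2 / δ₀ ≤ ρ :=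
    fun ρ h => ⟨(le_max_left _ _).trans h,
      ((le_max_left _ _).trans (le_max_right _ _)).trans h,
      ((le_max_right _ _).trans (le_max_right _ _)).trans h⟩
  have hM1 : 1 ≤ M := le_max_left _ _
  clear_value M A B X Λ K₁ N
  have hle1 : ∀ r : ℝ, 0 ≤ r → 0 ≤ 1 - Real.exp (-Λ * r) ∧ 1 - Real.exp (-Λ * r) ≤ 1 :=
    fun r hr => ⟨by
      have : Real.exp (-Λ * r) ≤ 1 := Real.exp_le_one_iff.2 (by linarith [mul_nonneg hΛ0.le hr])
      linarith, by linarith [Real.exp_pos (-Λ * r)]⟩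
  have hself : ∀ ρ, 0 < ρ → ∀ s, s ≤ stretch K₁ B Λ ρ s := by
    intro ρ hρ s
    have := (hle1 |s| (abs_nonneg s)).1
    have h0 := abs_nonneg s
    unfold stretch
    have : 0 ≤ (K₁ * |s| + B / Λ * (1 - Real.exp (-Λ * |s|))) / ρ := by positivity
    linarith
  have hadd' : ∀ ρ, 0 < ρ → ∀ s, stretch K₁ B Λ ρ s ≤ s + (K₁ * |s| + B / Λ) / ρ := by
    intro ρ hρ s
    have h1 := (hle1 |s| (abs_nonneg s)).2
    unfold stretch
    gcongr
    exact mul_le_of_le_one_right hBΛ.le h1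
  have hadd : ∀ ρ, 0 < ρ → ∀ s, stretch K₁ B Λ ρ s ≤ s + A * (|s| + 1) / ρ := by
    intro ρ hρ s
    refine (hadd' ρ hρ s).trans ?_
    gcongr
    rw [hA]
    linarith [mul_nonneg hBΛ.le (abs_nonneg s)]
  refine ⟨stretch K₁ B Λ, M, A, hM1, hA0, ?_, hself, hadd, ?_, ?_⟩
  · unfold stretch
    refine ContinuousOn.add (by fun_prop) (ContinuousOn.div (by fun_prop) (by fun_prop) ?_)
    intro p hp
    exact (show 0 < p.1 from hp).ne'
  · intro ρ hρ
    exact hM₀ ρ (hMbig ρ hρ).2.1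
  · intro ρ hρ y p δ hδ0 hδ1 hs hle
    obtain ⟨h1, -, h3⟩ := hMbig ρ hρ
    have hρ0 : 0 < ρ := by linarith
    set s := (‖p - y‖ ^ 2 - ρ ^ 2) / (2 * ρ) with hsdef
    set σ : ℝ := if 0 < s then 1 else -1 with hσ
    have hσ2 : σ ^ 2 = 1 := by rw [hσ]; split_ifs <;> norm_num
    have hσs : 0 < σ * s := by
      rw [hσ]
      split_ifs with h
      · linarith
      · have : s < 0 := lt_of_le_of_ne (not_lt.1 h) hs
        linarith
    obtain ⟨c1, c2, c3⟩ := stretch_derivs (K₁ := K₁) (B := B) (Λ := Λ) (ρ := ρ) (s := s) (δ := δ)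
      hgC hΛ0.ne' hσ2 hσs
    have efun : (fun x : EuclideanSpace ℝ (Fin n) => g (stretch K₁ B Λ ρ ((‖x - y‖ ^ 2 - ρ ^ 2) / (2 * ρ))) + δ) =
        fun x : EuclideanSpace ℝ (Fin n) => (fun t => g (stretch K₁ B Λ ρ t) + δ)
          (1 / (2 * ρ) * ‖x - y‖ ^ 2 + -(ρ / 2)) := by
      ext x
      have : (‖x - y‖ ^ 2 - ρ ^ 2) / (2 * ρ) = 1 / (2 * ρ) * ‖x - y‖ ^ 2 + -(ρ / 2) := by
        field_simp
        ring
      simp only [this]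
    have es : 1 / (2 * ρ) * ‖p - y‖ ^ 2 + -(ρ / 2) = s := by
      rw [hsdef]; field_simp; ring
    obtain ⟨r1, r2⟩ := lap_radial (1 / (2 * ρ)) (-(ρ / 2)) y p (by rw [es]; exact c1)
    rw [efun]
    refine ⟨r1, ?_⟩
    rw [r2, es, c2, c3, hgeq]
    set e := B * Λ * Real.exp (-Λ * |s|) with he
    set P' := K₁ + B * Real.exp (-Λ * |s|) with hP'
    set t := stretch K₁ B Λ ρ s with htdef
    have hexp1 : Real.exp (-Λ * |s|) ≤ 1 := by linarith [(hle1 |s| (abs_nonneg s)).1]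
    have hexp0 := Real.exp_pos (-Λ * |s|)
    have he0 : 0 ≤ e := by positivity
    have hP1 : K₁ ≤ P' := by
      have : 0 < B * Real.exp (-Λ * |s|) := by positivity
      linarith
    have hP2 : P' ≤ ρ := by
      have : B * Real.exp (-Λ * |s|) ≤ B := mul_le_of_le_one_right hB0.le hexp1
      linarith
    have hQ : 4 * (1 / (2 * ρ)) ^ 2 * ‖p - y‖ ^ 2 = 1 + 2 * s / ρ := by
      rw [hsdef]; field_simp; ring
    have hQ0 : 0 ≤ 1 + 2 * s / ρ := by rw [← hQ]; positivity
    have hγ := hg' t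
    have hgt := hgm t
    have hmem : g t ∈ Icc (-1 : ℝ) 1 := Ioo_subset_Icc_self hgt
    have hmem' : g t + δ ∈ Icc (-1 : ℝ) 1 := ⟨by linarith [hgt.1], hle⟩
    have e1 : ∀ v₁ v₂ : ℝ, v₁ * (4 * (1 / (2 * ρ)) ^ 2 * ‖p - y‖ ^ 2) + 2 * (1 / (2 * ρ)) * n * v₂
        = (1 + 2 * s / ρ) * v₁ + N / ρ * v₂ := by
      intro v₁ v₂
      rw [hQ, hN]; field_simp
    rw [e1]
    have hts := hself ρ hρ0 s
    have hts' := hadd ρ hρ0 s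
    have hts'' := hadd' ρ hρ0 s
    have hδδ : δ ≤ δ₀ / 2 := by
      refine hδ1.trans ?_
      rw [div_le_iff₀ hρ0]
      have : 2 / δ₀ ≤ ρ := by linarith
      rw [div_le_iff₀ hδ₀] at this
      linarith
    rcases lt_or_ge S |s| with hbig | hsmall
    · rcases lt_or_ge s 0 with hneg | hpos
      · have hσ' : σ = -1 := by rw [hσ, if_neg (not_lt.2 hneg.le)]
        have hsS : |s| = -s := abs_of_neg hneg
        rw [hσ']
        have htT : t ≤ -T := by
          have a1 : (K₁ * |s| + B / Λ) / ρ ≤ |s| / 4 + 1 / 4 := by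
            rw [div_le_iff₀ hρ0]
            have : 4 * K₁ * |s| ≤ ρ * |s| :=
              mul_le_mul_of_nonneg_right (by linarith) (abs_nonneg s)
            linarith
          rw [hsS] at a1 hbig hts''
          linarith
        obtain ⟨l1, l2⟩ := ht.left t htT
        have hFD : f (g t) ≤ f (g t + δ) := by
          have := hf.mono_left (g t) (g t + δ) hmem.1 (by linarith) (by linarith)
          have h5 : 0 ≤ κ * (g t + δ - g t) := mul_nonneg hf.κ_pos.le (by linarith)
          linarith
        have hQ1 : 1 + 2 * s / ρ ≤ 1 := by
          have : 2 * s / ρ ≤ 0 := div_nonpos_of_nonpos_of_nonneg (by linarith) hρ0.le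
          linarith
        have := barrier_ineq_left hN0 hρ0 hγ hK₁' l1 hκ₁ hFD hQ0 hQ1 hP1 hP2 he0
        refine lt_of_eq_of_lt ?_ this
        ring
      · have hs0 : 0 < s := lt_of_le_of_ne hpos hs.symm
        have hσ' : σ = 1 := by rw [hσ, if_pos hs0]
        rw [abs_of_pos hs0] at hbig
        rw [hσ']
        obtain ⟨l1, l2⟩ := ht.right t (by linarith)
        have hFD : f (g t) ≤ f (g t + δ) := by
          have := hf.mono_right (g t) (g t + δ) l2 (by linarith) hle
          have h5 : 0 ≤ κ * (g t + δ - g t) := mul_nonneg hf.κ_pos.le (by linarith)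
          linarith
        have hQ1 : 1 ≤ 1 + 2 * s / ρ := by
          have : 0 ≤ 2 * s / ρ := by positivity
          linarith
        have := barrier_ineq_right hN0 hρ0 hγ hK₁' l1 hκ₁ hFD hQ1 hP1 hP2 he0
        refine lt_of_eq_of_lt ?_ this
        ring
    · have htI : t ∈ Icc (-(S + 1)) (S + 1) := by
        have a1 : A * (|s| + 1) / ρ ≤ 1 := by
          rw [div_le_iff₀ hρ0]
          have : A * (|s| + 1) ≤ A * (S + 1) := by gcongr
          linarith
        obtain ⟨b1, b2⟩ := abs_le.1 hsmall
        constructor <;> linarith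
      have hFD : f (g t) - K / ρ ≤ f (g t + δ) := by
        have := hf.lipschitz (g t) hmem (g t + δ) hmem'
        rw [show g t - (g t + δ) = -δ by ring, abs_neg, abs_of_nonneg hδ0] at this
        have h6 : K * δ ≤ K / ρ := by
          calc K * δ ≤ K * (1 / ρ) := by gcongr
            _ = _ := by ring
        linarith [le_abs_self (f (g t) - f (g t + δ))]
      have hQa : |1 + 2 * s / ρ - 1| ≤ 2 * S / ρ := by
        rw [show 1 + 2 * s / ρ - 1 = 2 * s / ρ by ring, abs_div, abs_of_pos hρ0, abs_mul, abs_two]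
        gcongr
      have hP0 : 0 ≤ P' := by linarith
      have hq : |1 + σ * (P' / ρ) - 1| ≤ P' / ρ := by
        have h7 : |σ| = 1 := by rw [hσ]; split_ifs <;> simp
        rw [add_sub_cancel_left, abs_mul, h7, one_mul, abs_of_nonneg (by positivity)]
      refine barrier_ineq_mid (K₁ := K₁) hN0 hρ0 hm (hmle t htI) (hGle t htI) (hfB _ hmem) hFD hQa (by linarith)
        hq hP0 hP2 he0 hΛ0 ?_ hΛm ?_
      · rw [hP', he]; field_simp
      · rw [← hX]
        refine hBX.trans_le ?_
        have : Real.exp (-Λ * S) ≤ Real.exp (-Λ * |s|) := by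
          apply Real.exp_le_exp.2; linarith [mul_le_mul_of_nonneg_left hsmall hΛ0.le]
        rw [he]
        gcongr

end BarrierExistence

section Sliding

variable {n : ℕ}
local notation "E" => EuclideanSpace ℝ (Fin n)

lemma pos_of_no_first_contact {X : Type*} [TopologicalSpace X] [T2Space X] {K : Set X}
    (hK : IsCompact K) {F : ℝ × X → ℝ} (hF : ContinuousOn F (Icc 0 1 ×ˢ K))
    (h0 : ∀ x ∈ K, 0 < F (0, x))
    (hno : ∀ t ∈ Icc (0 : ℝ) 1, ∀ x ∈ K, F (t, x) = 0 → (∀ z ∈ K, 0 ≤ F (t, z)) → False) :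
    ∀ t ∈ Icc (0 : ℝ) 1, ∀ x ∈ K, 0 < F (t, x) := by
  by_contra! hcon
  obtain ⟨t₁, ht₁, x₁, hx₁, h₁⟩ := hcon
  have hc : IsCompact (Icc (0 : ℝ) 1 ×ˢ K) := isCompact_Icc.prod hK
  set Z := (Icc (0 : ℝ) 1 ×ˢ K) ∩ F ⁻¹' Iic 0 with hZ
  have hZc : IsCompact Z :=
    hc.of_isClosed_subset (hF.preimage_isClosed_of_isClosed hc.isClosed isClosed_Iic)
      inter_subset_left
  obtain ⟨⟨t₀, x₀⟩, ⟨⟨ht₀, hx₀⟩, hF₀⟩, hmin⟩ := hZc.exists_isMinOn ⟨(t₁, x₁), ⟨ht₁, hx₁⟩, h₁⟩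
    continuous_fst.continuousOn
  have hF₀' : F (t₀, x₀) ≤ 0 := hF₀
  have ht0 : 0 < t₀ := by
    rcases ht₀.1.eq_or_lt with h | h
    · have h := h
      simp only at h
      have := h0 x₀ hx₀
      rw [h] at this
      linarith
    · exact h
  have hpos : ∀ z ∈ K, 0 ≤ F (t₀, z) := by
    intro z hz
    have hcont : ContinuousOn (fun t => F (t, z)) (Icc 0 1) :=
      hF.comp (by fun_prop) fun t ht => ⟨ht, hz⟩
    have h1 : ContinuousWithinAt (fun t => F (t, z)) (Ioo 0 t₀) t₀ :=
      (hcont t₀ ht₀).mono fun t ht => ⟨ht.1.le, ht.2.le.trans ht₀.2⟩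
    have hcl : t₀ ∈ closure (Ioo 0 t₀) := by
      rw [closure_Ioo ht0.ne]; exact ⟨ht0.le, le_rfl⟩
    have hne : (nhdsWithin t₀ (Ioo 0 t₀)).NeBot := mem_closure_iff_nhdsWithin_neBot.1 hcl
    refine ge_of_tendsto h1 ?_
    filter_upwards [self_mem_nhdsWithin] with t ht
    by_contra! h
    have : t₀ ≤ t := hmin (show (t, z) ∈ Z from ⟨⟨⟨ht.1.le, ht.2.le.trans ht₀.2⟩, hz⟩, h.le⟩)
    linarith [ht.2]
  exact hno t₀ ht₀ x₀ hx₀ (le_antisymm hF₀' (hpos x₀ hx₀)) hpos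

/-- `u` is a solution of `Δu = f(u)` with values in `[-1,1]` in the ball of radius `L`. -/
structure IsSol (n : ℕ) (f : ℝ → ℝ) (L : ℝ) (u : EuclideanSpace ℝ (Fin n) → ℝ) : Prop where
  contDiff : ContDiffOn ℝ 2 u (ball 0 L)
  abs_le : ∀ x ∈ ball (0 : EuclideanSpace ℝ (Fin n)) L, |u x| ≤ 1
  eq : ∀ x ∈ ball (0 : EuclideanSpace ℝ (Fin n)) L, lap n u x = f (u x)

variable {f g : ℝ → ℝ} {τ : ℝ → ℝ → ℝ} {M A L : ℝ} {u : EuclideanSpace ℝ (Fin n) → ℝ}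

lemma IsStretch.no_contact (hS : IsStretch n f g τ M A) (hu : IsSol n f L u) {ρ δ : ℝ}
    (hρ : M ≤ ρ) (hδ0 : 0 ≤ δ) (hδ : δ ≤ 1 / ρ) {y p : E} (hp : p ∈ ball (0 : E) L)
    (hs : (‖p - y‖ ^ 2 - ρ ^ 2) / (2 * ρ) ≠ 0)
    (heq : g (τ ρ ((‖p - y‖ ^ 2 - ρ ^ 2) / (2 * ρ))) + δ = u p)
    (hge : ∀ᶠ x : E in nhds p, u x ≤ g (τ ρ ((‖x - y‖ ^ 2 - ρ ^ 2) / (2 * ρ))) + δ) : False := by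
  obtain ⟨h1, h2⟩ := hS.super ρ hρ y p δ hδ0 hδ hs
    (heq.trans_le ((le_abs_self _).trans (hu.abs_le p hp)))
  have hup : ContDiffAt ℝ 2 u p := hu.contDiff.contDiffAt (isOpen_ball.mem_nhds hp)
  have := lap_le_lap_of_isLocalMin_sub h1 hup (by
    filter_upwards [hge] with x hx
    simp only [heq, sub_self]
    linarith)
  rw [hu.eq p hp, ← heq] at this
  linarith

set_option maxHeartbeats 1000000 in
/-- The sliding argument with balls of varying radius contained in the negativity set. -/
lemma IsStretch.sliding_ball (hS : IsStretch n f g τ M A) (hu : IsSol n f L u)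
    (hgm : StrictMono g) (hgc : Continuous g) (hg0 : g 0 = 0) (hg1 : ∀ t, g t ∈ Ioo (-1 : ℝ) 1)
    {U : Set E} (hU : Convex ℝ U) (hneg : ∀ x ∈ U, u x < 0)
    {x₀ : E} (h0U : closedBall x₀ M ⊆ U) (h0L : closedBall x₀ (2 * M) ⊆ ball 0 L)
    (hstart : ∀ x ∈ closedBall x₀ (2 * M), u x ≤ -1 + (1 - g M))
    {y : E} {ρ : ℝ} (hρ : M ≤ ρ) (hyU : closedBall y ρ ⊆ U) (hyL : closedBall y (2 * ρ) ⊆ ball 0 L)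
    {z : E} (hz : ‖z‖ ≤ 2) :
    u (y + ρ • z) < g (τ ρ (ρ * (‖z‖ ^ 2 - 1) / 2)) + (1 - g ρ) := by
  have hM := hS.one_le
  set r : ℝ → ℝ := fun t => (1 - t) * M + t * ρ with hr
  set c : ℝ → E := fun t => (1 - t) • x₀ + t • y with hc
  have hrM : ∀ t ∈ Icc (0 : ℝ) 1, M ≤ r t := by
    intro t ht
    simp only [hr]
    linarith [mul_nonneg ht.1 (sub_nonneg.2 hρ)]
  have hconv : ∀ t (z : E), c t + r t • z = (1 - t) • (x₀ + M • z) + t • (y + ρ • z) := by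
    intro t z
    simp only [hr, hc, smul_add, add_smul, smul_smul]
    abel
  have hball : ∀ (x : E) (a b : ℝ) (z : E), 0 ≤ a → ‖z‖ ≤ b → x + a • z ∈ closedBall x (b * a) := by
    intro x a b z ha hz
    rw [mem_closedBall, dist_eq_norm, add_sub_cancel_left, norm_smul, Real.norm_eq_abs,
      abs_of_nonneg ha, mul_comm]
    gcongr
  have hinL : ∀ t ∈ Icc (0 : ℝ) 1, ∀ z : E, ‖z‖ ≤ 2 → c t + r t • z ∈ ball (0 : E) L := by
    intro t ht z hz
    rw [hconv]
    exact (convex_ball (0 : E) L) (h0L (hball _ _ _ _ (by linarith) hz))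
      (hyL (hball _ _ _ _ (by linarith) hz)) (by linarith [ht.2]) ht.1 (by ring)
  have hinU : ∀ t ∈ Icc (0 : ℝ) 1, ∀ z : E, ‖z‖ ≤ 1 → c t + r t • z ∈ U := by
    intro t ht z hz
    rw [hconv]
    exact hU (h0U (by simpa using hball x₀ M 1 z (by linarith) hz))
      (hyU (by simpa using hball y ρ 1 z (by linarith) hz)) (by linarith [ht.2]) ht.1 (by ring)
  set F : ℝ × E → ℝ := fun q => g (τ (r q.1) (r q.1 * (‖q.2‖ ^ 2 - 1) / 2)) + (1 - g (r q.1))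
    - u (c q.1 + r q.1 • q.2) with hF
  have hrc : Continuous r := by simp only [hr]; fun_prop
  have hcc : Continuous c := by simp only [hc]; fun_prop
  have hFc : ContinuousOn F (Icc 0 1 ×ˢ closedBall (0 : E) 2) := by
    have h2 : MapsTo (fun q : ℝ × E => (r q.1, r q.1 * (‖q.2‖ ^ 2 - 1) / 2))
        (Icc 0 1 ×ˢ closedBall (0 : E) 2) {p | 0 < p.1} := by
      intro q hq
      have := hrM q.1 (mem_prod.1 hq).1
      exact lt_of_lt_of_le (by linarith : (0 : ℝ) < M) this
    have h3 : MapsTo (fun q : ℝ × E => c q.1 + r q.1 • q.2)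
        (Icc 0 1 ×ˢ closedBall (0 : E) 2) (ball 0 L) := by
      intro q hq
      exact hinL q.1 (mem_prod.1 hq).1 q.2 (mem_closedBall_zero_iff.1 (mem_prod.1 hq).2)
    refine ContinuousOn.sub (ContinuousOn.add (hgc.comp_continuousOn ?_) (by fun_prop)) ?_
    · have h1 : ContinuousOn (fun q : ℝ × E => (r q.1, r q.1 * (‖q.2‖ ^ 2 - 1) / 2))
          (Icc 0 1 ×ˢ closedBall (0 : E) 2) := by fun_prop
      exact hS.cont.comp h1 h2
    · exact hu.contDiff.continuousOn.comp (by fun_prop) h3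
  have key := pos_of_no_first_contact (isCompact_closedBall (0 : E) 2) hFc ?_ ?_ 1 (by simp) z
    (by simpa using hz)
  · simp only [hF, hr, hc] at key
    simp only [sub_self, zero_smul, zero_mul, zero_add, one_smul, one_mul] at key
    linarith
  · intro z hz
    rw [mem_closedBall_zero_iff] at hz
    have h1 := hstart _ (hball x₀ M 2 z (by linarith) hz)
    have h2 := (hg1 (τ M (M * (‖z‖ ^ 2 - 1) / 2))).1
    simp only [hF, hr, hc, sub_zero, zero_smul, zero_mul, add_zero, one_smul, one_mul]
    linarith
  · intro t ht z hz hFz hFge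
    rw [mem_closedBall_zero_iff] at hz
    have hrt := hrM t ht
    have hr0 : 0 < r t := by linarith
    have hδ1 := (hg1 (r t)).2
    have hs : ∀ w : E, (‖c t + r t • w - c t‖ ^ 2 - r t ^ 2) / (2 * r t)
        = r t * (‖w‖ ^ 2 - 1) / 2 := by
      intro w
      rw [add_sub_cancel_left, norm_smul, Real.norm_eq_abs, abs_of_pos hr0]
      field_simp
    simp only [hF] at hFz
    have hself := hS.self_le (r t) hr0 (r t * (‖z‖ ^ 2 - 1) / 2)
    rcases eq_or_lt_of_le hz with h2 | h2
    · have h3 : r t < τ (r t) (r t * (‖z‖ ^ 2 - 1) / 2) := by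
        refine lt_of_lt_of_le ?_ hself
        rw [h2]; linarith
      have h4 := hgm h3
      have h5 := (le_abs_self _).trans (hu.abs_le _ (hinL t ht z hz))
      linarith
    by_cases h1 : ‖z‖ = 1
    · have h3 := hneg _ (hinU t ht z h1.le)
      have h4 : 0 ≤ τ (r t) (r t * (‖z‖ ^ 2 - 1) / 2) := by
        refine le_trans ?_ hself
        rw [h1]; simp
      have h5 := hgm.monotone h4
      linarith
    · refine hS.no_contact hu hrt (y := c t) (p := c t + r t • z) (δ := 1 - g (r t))
        (by linarith) (hS.one_sub_le _ hrt) (hinL t ht z hz) ?_ ?_ ?_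
      · rw [hs]
        have : ‖z‖ ^ 2 - 1 ≠ 0 := by
          intro h
          have : (‖z‖ - 1) * (‖z‖ + 1) = 0 := by linarith
          rcases mul_eq_zero.1 this with h | h
          · exact h1 (by linarith)
          · linarith [norm_nonneg z]
        positivity
      · rw [hs]; linarith
      · have hcont : ContinuousAt (fun x : E => ‖(r t)⁻¹ • (x - c t)‖) (c t + r t • z) := by
          fun_prop
        have hlt : ‖(r t)⁻¹ • (c t + r t • z - c t)‖ < 2 := by
          rw [add_sub_cancel_left, smul_smul, inv_mul_cancel₀ hr0.ne', one_smul]; exact h2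
        filter_upwards [hcont.eventually (gt_mem_nhds hlt)] with x hx
        have hx' : x = c t + r t • ((r t)⁻¹ • (x - c t)) := by
          rw [smul_smul, mul_inv_cancel₀ hr0.ne', one_smul]; abel
        have h6 := hFge ((r t)⁻¹ • (x - c t)) (by simpa using hx.le)
        simp only [hF] at h6
        rw [← hs, ← hx'] at h6
        linarith

end Sliding

section UpperBound

variable {n : ℕ}
local notation "E" => EuclideanSpace ℝ (Fin n)

lemma mem_tangent_ball_iff {R : ℝ} (hR : 0 < R) (i : Fin n) (x : E) :
    x ∈ ball (-(R • (stdVec i : E))) R ↔ ‖x‖ ^ 2 + 2 * R * x i < 0 := by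
  rw [mem_ball, dist_eq_norm, sub_neg_eq_add, ← sq_lt_sq₀ (norm_nonneg _) hR.le,
    norm_add_smul_stdVec_sq]
  constructor <;> intro h <;> linarith

lemma abs_coord_le (i : Fin n) (x : E) : |x i| ≤ ‖x‖ := by
  simpa using PiLp.norm_apply_le x i

/-- The comparison of a solution with the barrier on the lateral boundary. -/
lemma lateral_bound {g : ℝ → ℝ} {τ : ℝ → ℝ → ℝ} {M A ℓ : ℝ} {u : EuclideanSpace ℝ (Fin n) → ℝ}
    (hgm : StrictMono g) (hg1 : ∀ t, g t ∈ Ioo (-1 : ℝ) 1) (hA : 0 < A) (hM : 1 ≤ M)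
    (hτ : ∀ ρ, 0 < ρ → ∀ s, τ ρ s ≤ s + A * (|s| + 1) / ρ)
    (h1 : 1 - g (ℓ / 2) < 1 / (2 * ℓ ^ 20)) (h2 : 1 + g (-(ℓ / 8)) < 1 / (2 * ℓ ^ 20))
    (hℓ : 2 * M ≤ ℓ) (hℓ2 : 2 ≤ ℓ) (hℓ3 : 8 * ℓ ^ 2 + 16 * A * (ℓ + 2) ≤ ℓ ^ 4 / 5)
    (hℓ4 : A / 2 + 2 * A / ℓ ≤ ℓ / 8) (i : Fin n)
    (hu1 : ∀ x ∈ ball (0 : E) (ℓ ^ 8), |u x| ≤ 1)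
    (hslide : ∀ (y z : E) (ρ : ℝ), M ≤ ρ →
      closedBall y ρ ⊆ ball (-(ℓ ^ 20 • (stdVec i : E))) (ℓ ^ 20) ∩ ball 0 (ℓ ^ 8) →
      closedBall y (2 * ρ) ⊆ ball 0 (ℓ ^ 8) → ‖z‖ ≤ 2 →
      u (y + ρ • z) < g (τ ρ (ρ * (‖z‖ ^ 2 - 1) / 2)) + (1 - g ρ))
    {x : E} (hx : ‖x‖ = ℓ ^ 8 / 2) :
    u x < g (x i + 2 * ‖x‖ ^ 2 / ℓ ^ 20) + 1 / ℓ ^ 20 := by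
  have hℓ0 : 0 < ℓ := by linarith
  set L := ℓ ^ 8 with hL
  have hL0 : 0 < L := by positivity
  have hLℓ : 128 * ℓ ≤ L := by
    have : (2 : ℝ) ^ 7 ≤ ℓ ^ 7 := by gcongr
    have h := mul_le_mul_of_nonneg_right this hℓ0.le
    rw [hL]
    linarith
  set η := 1 / ℓ ^ 4 with hη
  have hη0 : 0 < η := by positivity
  have hη1 : η ≤ 1 := by
    rw [hη, div_le_one (by positivity)]
    exact one_le_pow₀ (by linarith)
  have hLη : L ^ 2 = ℓ ^ 20 * η := by rw [hL, hη]; field_simp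
  have hs0 : x i + 2 * ‖x‖ ^ 2 / ℓ ^ 20 = x i + η / 2 := by
    rw [hx, hL, hη]; field_simp
  have hhalf : 1 / (2 * ℓ ^ 20) + 1 / (2 * ℓ ^ 20) = 1 / ℓ ^ 20 := by field_simp; ring
  have hRpos : 0 < 1 / (2 * ℓ ^ 20) := by positivity
  have hxL : x ∈ ball (0 : E) L := by rw [mem_ball_zero_iff, hx]; linarith
  have hux := (le_abs_self _).trans (hu1 x hxL)
  have hmemU : ∀ w : E, ‖w‖ ≤ 3 * L / 4 → w i ≤ -(3 * η / 10) →
      w ∈ ball (-(ℓ ^ 20 • (stdVec i : E))) (ℓ ^ 20) ∩ ball 0 L := by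
    intro w hw hwi
    refine ⟨(mem_tangent_ball_iff (by positivity) i w).2 ?_, by
      rw [mem_ball_zero_iff]; linarith⟩
    have a1 : ‖w‖ ^ 2 ≤ (3 * L / 4) ^ 2 := by gcongr
    have a2 : 2 * ℓ ^ 20 * w i ≤ 2 * ℓ ^ 20 * (-(3 * η / 10)) := by gcongr
    have a3 : 0 < L ^ 2 := by positivity
    have a4 : 2 * ℓ ^ 20 * (-(3 * η / 10)) = -(6 / 10) * L ^ 2 := by rw [hLη]; ring
    linarith
  rw [hs0]
  set d := -(x i) - 3 * η / 10 with hd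
  have hxi : x i = -d - 3 * η / 10 := by rw [hd]; ring
  rcases le_or_gt ℓ d with hdl | hdl
  · have hsl := hslide x 0 (ℓ / 2) (by linarith) ?_ ?_ (by simp)
    · rw [smul_zero, add_zero, norm_zero] at hsl
      have hs : ℓ / 2 * (0 ^ 2 - 1) / 2 = -(ℓ / 4) := by ring
      rw [hs] at hsl
      have h3 := hτ (ℓ / 2) (by positivity) (-(ℓ / 4))
      rw [abs_neg, abs_of_pos (by positivity)] at h3
      have h4 : A * (ℓ / 4 + 1) / (ℓ / 2) = A / 2 + 2 * A / ℓ := by field_simp; ring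
      have h5 : τ (ℓ / 2) (-(ℓ / 4)) ≤ -(ℓ / 8) := by linarith
      have h6 := hgm.monotone h5
      have h7 := (hg1 (x i + η / 2)).1
      linarith
    · intro w hw
      rw [mem_closedBall, dist_eq_norm] at hw
      apply hmemU
      · have := norm_le_norm_add_norm_sub' w x
        linarith
      · have := (le_abs_self _).trans (abs_coord_le i (w - x))
        rw [PiLp.sub_apply] at this
        linarith
    · intro w hw
      rw [mem_closedBall, dist_eq_norm] at hw
      rw [mem_ball_zero_iff]
      have := norm_le_norm_add_norm_sub' w x
      linarith
  rcases le_or_gt d (-ℓ) with hdl' | hdl'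
  · have h3 : ℓ / 2 ≤ x i + η / 2 := by linarith
    have h4 := hgm.monotone h3
    linarith
  · set ρ := L / 16 with hρ
    have hρ0 : 0 < ρ := by positivity
    have hdρ : |d| ≤ ℓ := abs_le.2 ⟨hdl'.le, hdl.le⟩
    have hρd : 0 < ρ - d := by linarith
    have hnorm : ‖((ρ - d) / ρ) • (stdVec i : E)‖ = (ρ - d) / ρ := by
      rw [norm_smul, Real.norm_eq_abs, abs_of_pos (by positivity)]
      simp [stdVec]
    have hy : ‖x - (ρ - d) • (stdVec i : E)‖ ≤ L / 2 + ρ + ℓ := by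
      refine (norm_sub_le _ _).trans ?_
      rw [norm_smul, Real.norm_eq_abs, abs_of_pos hρd, hx]
      simp [stdVec]
      linarith
    have hyi : (x - (ρ - d) • (stdVec i : E)) i = -(3 * η / 10) - ρ := by
      simp [stdVec]
      linarith
    have hsl := hslide (x - (ρ - d) • (stdVec i : E)) (((ρ - d) / ρ) • (stdVec i : E)) ρ
      (by linarith) ?_ ?_ ?_
    · have hpt : x - (ρ - d) • (stdVec i : E) + ρ • ((ρ - d) / ρ) • (stdVec i : E) = x := by
        rw [smul_smul, mul_div_cancel₀ _ hρ0.ne', sub_add_cancel]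
      rw [hpt, hnorm] at hsl
      have hs : ρ * (((ρ - d) / ρ) ^ 2 - 1) / 2 = -d + d ^ 2 / (2 * ρ) := by field_simp; ring
      rw [hs] at hsl
      set s := -d + d ^ 2 / (2 * ρ) with hsdef
      have hd2 : d ^ 2 ≤ ℓ ^ 2 := sq_le_sq' hdl'.le hdl.le
      have hq : d ^ 2 / (2 * ρ) ≤ ℓ ^ 2 / (2 * ρ) := by gcongr
      have hq0 : 0 ≤ d ^ 2 / (2 * ρ) := by positivity
      have hq1 : ℓ ^ 2 / (2 * ρ) ≤ 1 := by
        rw [div_le_one (by positivity)]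
        have : ℓ ^ 4 ≤ ℓ ^ 8 := pow_le_pow_right₀ (by linarith) (by norm_num)
        have hAℓ : 0 ≤ 16 * A * (ℓ + 2) := by positivity
        rw [hρ, hL]
        linarith
      have hs1 : |s| + 1 ≤ ℓ + 2 := by
        have : |s| ≤ |-d| + |d ^ 2 / (2 * ρ)| := abs_add_le _ _
        rw [abs_neg, abs_of_nonneg hq0] at this
        linarith
      have h3 := hτ ρ hρ0 s
      have h4 : A * (|s| + 1) / ρ ≤ A * (ℓ + 2) / ρ := by gcongr
      have h5 : ℓ ^ 2 / (2 * ρ) + A * (ℓ + 2) / ρ ≤ η / 5 := by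
        have : ℓ ^ 2 / (2 * ρ) + A * (ℓ + 2) / ρ = (8 * ℓ ^ 2 + 16 * A * (ℓ + 2)) / ℓ ^ 8 := by
          rw [hρ, hL]; field_simp; ring
        rw [this, div_le_iff₀ (by positivity)]
        have : η / 5 * ℓ ^ 8 = ℓ ^ 4 / 5 := by rw [hη]; field_simp
        rw [this]
        exact hℓ3
      have h6 : τ ρ s ≤ x i + η / 2 := by linarith
      have h7 := hgm.monotone h6
      have h8 : ℓ / 2 ≤ ρ := by linarith
      have h9 := hgm.monotone h8
      linarith
    · intro w hw
      rw [mem_closedBall, dist_eq_norm] at hw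
      apply hmemU
      · have := norm_le_norm_add_norm_sub' w (x - (ρ - d) • (stdVec i : E))
        linarith
      · have := (le_abs_self _).trans (abs_coord_le i (w - (x - (ρ - d) • (stdVec i : E))))
        rw [PiLp.sub_apply, hyi] at this
        linarith
    · intro w hw
      rw [mem_closedBall, dist_eq_norm] at hw
      rw [mem_ball_zero_iff]
      have := norm_le_norm_add_norm_sub' w (x - (ρ - d) • (stdVec i : E))
      linarith
    · rw [hnorm, div_le_iff₀ hρ0]
      linarith

end UpperBound

section Translate

variable {n : ℕ}
local notation "E" => EuclideanSpace ℝ (Fin n)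

variable {f g : ℝ → ℝ} {τ : ℝ → ℝ → ℝ} {M A L R : ℝ} {u : EuclideanSpace ℝ (Fin n) → ℝ}

set_option maxHeartbeats 1000000 in
/-- The sliding argument translating a barrier of radius `R / 4` in the vertical direction. -/
lemma IsStretch.sliding_translate (hS : IsStretch n f g τ M A) (hu : IsSol n f L u)
    (hgm : StrictMono g) (hgc : Continuous g) (hg0 : g 0 = 0) (i : Fin n)
    (hR : 4 * M ≤ R) (hL : 0 < L) (hLR : 2 * L ≤ R) (hstart : 1 - g (L / 2) < 1 / R)
    (hneg : ∀ x ∈ ball (-(R • (stdVec i : E))) R ∩ ball 0 L, u x < 0) (hu0 : u 0 = 0)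
    (hlat : ∀ x : E, ‖x‖ = L / 2 → u x < g (x i + 2 * ‖x‖ ^ 2 / R) + 1 / R)
    {x : E} (hx : ‖x‖ ≤ L / 2) :
    u x < g (τ (R / 4) (x i + 2 * ‖x‖ ^ 2 / R)) + 1 / R := by
  have hM := hS.one_le
  have hR0 : 0 < R := by linarith
  set ρ := R / 4 with hρ
  have hρ0 : 0 < ρ := by positivity
  have hMρ : M ≤ ρ := by linarith
  have hδ0 : 0 < 1 / R := by positivity
  have hδ : 1 / R ≤ 1 / ρ := by
    apply one_div_le_one_div_of_le hρ0
    linarith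
  set s : ℝ → E → ℝ := fun t x => (‖x - (-((t + ρ) • (stdVec i : E)))‖ ^ 2 - ρ ^ 2) / (2 * ρ)
    with hsdef
  have hs : ∀ t x, s t x = x i + t + 2 * (‖x‖ ^ 2 + 2 * x i * t + t ^ 2) / R := by
    intro t x
    simp only [hsdef]
    rw [sub_neg_eq_add, norm_add_smul_stdVec_sq, hρ]
    field_simp
    ring
  have hs0 : ∀ x, s 0 x = x i + 2 * ‖x‖ ^ 2 / R := by
    intro x
    rw [hs]; simp
  have hsmono : ∀ t x, 0 ≤ t → ‖x‖ ≤ L / 2 → s 0 x ≤ s t x := by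
    intro t x ht hx
    rw [hs0, hs]
    have h1 := (abs_le.1 ((abs_coord_le i x).trans hx)).1
    have h2 : -1 ≤ 4 * x i / R := by
      rw [le_div_iff₀ hR0]; linarith
    have h3 := mul_le_mul_of_nonneg_left h2 ht
    have h4 : 0 ≤ 2 * t ^ 2 / R := by positivity
    have h5 : 2 * (‖x‖ ^ 2 + 2 * x i * t + t ^ 2) / R
        = 2 * ‖x‖ ^ 2 / R + t * (4 * x i / R) + 2 * t ^ 2 / R := by
      field_simp; ring
    linarith
  have hscont : Continuous fun p : ℝ × E => s p.1 p.2 := by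
    simp only [hsdef]
    fun_prop
  have hsxcont : ∀ t, Continuous fun x : E => s t x := by
    intro t
    simp only [hsdef]
    fun_prop
  have hself : ∀ s, s ≤ τ ρ s := hS.self_le ρ hρ0
  set F : ℝ × E → ℝ := fun p => g (τ ρ (s ((1 - p.1) * L) p.2)) + 1 / R - u p.2 with hF
  have hFc : ContinuousOn F (Icc 0 1 ×ˢ closedBall 0 (L / 2)) := by
    refine ContinuousOn.sub (ContinuousOn.add (hgc.comp_continuousOn ?_) (by fun_prop)) ?_
    · have h1 : Continuous (fun q : ℝ × E => (ρ, s ((1 - q.1) * L) q.2)) := by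
        refine continuous_const.prodMk (hscont.comp (f := fun q : ℝ × E => ((1 - q.1) * L, q.2)) ?_)
        fun_prop
      exact hS.cont.comp h1.continuousOn fun q _ => hρ0
    · refine hu.contDiff.continuousOn.comp (by fun_prop) fun q hq => ?_
      have := hq.2
      rw [mem_closedBall_zero_iff] at this
      rw [mem_ball_zero_iff]
      linarith
  have key := pos_of_no_first_contact (isCompact_closedBall (0 : E) (L / 2)) hFc ?_ ?_ 1 (by simp) x
    (by simpa using hx)
  · simp only [hF, sub_self, zero_mul, hs0] at key
    linarith
  · intro x hx
    rw [mem_closedBall_zero_iff] at hx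
    simp only [hF, sub_zero, one_mul]
    have h1 := (abs_le.1 ((abs_coord_le i x).trans hx)).1
    have h2 : L / 2 ≤ s L x := by
      rw [hs, ← norm_add_smul_stdVec_sq]
      have : 0 ≤ 2 * ‖x + L • stdVec i‖ ^ 2 / R := by positivity
      linarith
    have h3 := hgm.monotone (h2.trans (hself _))
    have h4 := (le_abs_self _).trans (hu.abs_le x (by rw [mem_ball_zero_iff]; linarith))
    linarith
  · intro σ hσ x hx hFx hFge
    rw [mem_closedBall_zero_iff] at hx
    have hxL : x ∈ ball (0 : E) L := by rw [mem_ball_zero_iff]; linarith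
    set t := (1 - σ) * L with ht
    have ht0 : 0 ≤ t := mul_nonneg (by linarith [hσ.2]) hL.le
    have hsm := hsmono t x ht0 hx
    simp only [hF, ← ht] at hFx
    rcases eq_or_lt_of_le hx with h2 | h2
    · have h3 := hlat x h2
      rw [← hs0] at h3
      have h4 := hgm.monotone (hsm.trans (hself _))
      linarith
    by_cases h1 : s t x = 0
    · rw [h1, hs0] at hsm
      have h3 := hgm.monotone (hself 0)
      rw [hg0] at h3
      rw [h1] at hFx
      have hux : u x ≤ 0 := by
        by_cases hx0 : x = 0
        · rw [hx0, hu0]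
        · refine (hneg x ⟨(mem_tangent_ball_iff hR0 i x).2 ?_, hxL⟩).le
          have h4 : 0 < ‖x‖ ^ 2 := by have := norm_pos_iff.2 hx0; positivity
          have h5 := mul_le_mul_of_nonneg_left hsm hR0.le
          have h6 : R * (x i + 2 * ‖x‖ ^ 2 / R) = R * x i + 2 * ‖x‖ ^ 2 := by field_simp
          linarith
      linarith
    · refine hS.no_contact hu hMρ hδ0.le hδ hxL (y := -((t + ρ) • (stdVec i : E))) h1 ?_ ?_
      · change g (τ ρ (s t x)) + 1 / R = u x
        linarith
      · filter_upwards [(isOpen_ball (x := (0 : E)) (ε := L / 2)).mem_nhds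
          (by rw [mem_ball_zero_iff]; exact h2)] with z hz
        have h6 := hFge z (ball_subset_closedBall hz)
        simp only [hF, ← ht] at h6
        change u z ≤ g (τ ρ (s t z)) + 1 / R
        linarith

end Translate

section UpperBoundConclusion

variable {n : ℕ}
local notation "E" => EuclideanSpace ℝ (Fin n)

lemma ProfileTails.eventually_lt {f g : ℝ → ℝ} {δ₀ T κ₁ : ℝ} (ht : ProfileTails f g δ₀ T κ₁)
    (k : ℕ) : ∀ᶠ ℓ : ℝ in atTop, 1 - g (ℓ / 2) < 1 / (2 * ℓ ^ k) ∧
      1 + g (-(ℓ / 8)) < 1 / (2 * ℓ ^ k) := by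
  have h1 := (ht.right_decay k).comp (tendsto_id.atTop_div_const (r := (2 : ℝ)) (by norm_num))
  have h2 := (ht.left_decay k).comp (tendsto_id.atTop_div_const (r := (8 : ℝ)) (by norm_num))
  have e1 := h1.eventually (gt_mem_nhds (show (0 : ℝ) < 1 / (2 * 2 ^ k) by positivity))
  have e2 := h2.eventually (gt_mem_nhds (show (0 : ℝ) < 1 / (2 * 8 ^ k) by positivity))
  filter_upwards [e1, e2, eventually_gt_atTop 0] with ℓ a1 a2 hℓ
  simp only [Function.comp_apply, id] at a1 a2
  rw [div_pow, div_mul_eq_mul_div, div_lt_div_iff₀ (by positivity) (by positivity), one_mul] at a1 a2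
  rw [lt_div_iff₀ (by positivity), lt_div_iff₀ (by positivity)]
  constructor
  · have : 0 < (2 : ℝ) ^ k := by positivity
    refine lt_of_mul_lt_mul_right (a := (2 : ℝ) ^ k) ?_ this.le
    linarith
  · have : 0 < (8 : ℝ) ^ k := by positivity
    refine lt_of_mul_lt_mul_right (a := (8 : ℝ) ^ k) ?_ this.le
    linarith

lemma exists_lipschitz_bound {g : ℝ → ℝ} (hg : ContDiff ℝ 2 g) (a b : ℝ) :
    ∃ G, 0 < G ∧ ∀ s ∈ Icc a b, ∀ t ∈ Icc a b, |g s - g t| ≤ G * |s - t| := by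
  have hc : Continuous (deriv g) := hg.continuous_deriv (by norm_num)
  obtain ⟨G, hG⟩ := (isCompact_Icc (a := a) (b := b)).exists_bound_of_continuousOn hc.continuousOn
  refine ⟨max G 1, by positivity, fun s hs t ht => ?_⟩
  have := (convex_Icc a b).norm_image_sub_le_of_norm_deriv_le (f := g) (C := max G 1)
    (fun x _ => (hg.differentiable (by norm_num)) x)
    (fun x hx => (hG x hx).trans (le_max_left _ _)) ht hs
  simpa using this

set_option maxHeartbeats 2000000 in
/-- A solution whose negativity set contains a large ball tangent at the origin lies below the
one-dimensional profile up to an error of order `1 / R`. -/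
lemma exists_upper_bound {W g : ℝ → ℝ} {K κ δ₀ T κ₁ : ℝ}
    (hf : IsBistable (deriv W) K κ δ₀) (hg : IsOneDSolution W g)
    (ht : ProfileTails (deriv W) g δ₀ T κ₁) (i : Fin n) {B : ℝ} (hB : 0 < B) :
    ∃ c, 0 < c ∧ ∃ C, 0 < C ∧ ∃ ℓ₀ : ℝ, ∀ ℓ, ℓ₀ ≤ ℓ → ∀ u : E → ℝ,
      IsSol n (deriv W) (ℓ ^ 8) u →
      (∀ x ∈ ball (-(ℓ ^ 20 • (stdVec i : E))) (ℓ ^ 20) ∩ ball 0 (ℓ ^ 8), u x < 0) → u 0 = 0 →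
      ∀ x₀ ∈ ball (-((ℓ ^ 8 / 2) • (stdVec i : E))) (ℓ ^ 8 / 4), u x₀ ≤ -1 + c →
      ∀ x : E, ‖x‖ ≤ B → u x ≤ g (x i) + C / ℓ ^ 20 := by
  obtain ⟨τ, M, A, hS⟩ := exists_isStretch n hf hg ht
  obtain ⟨hgC, hg1, hgeq, hgd, hg0, -, -⟩ := hg
  have hgm : StrictMono g := strictMono_of_deriv_pos hgd
  have hgc : Continuous g := hgC.continuous
  have hM := hS.one_le
  have hA := hS.A_pos
  obtain ⟨CH, hCH, hH⟩ := harnack_lap n (r₀ := 4 * M) (by linarith) hf.K_pos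
  set D := 2 * B ^ 2 + 4 * A * (B + 2 * B ^ 2 + 1) with hD
  have hD0 : 0 < D := by positivity
  obtain ⟨G, hG0, hG⟩ := exists_lipschitz_bound hgC (-B) (B + D)
  have hgM := (hg1 M).2
  refine ⟨(1 - g M) / CH, div_pos (by linarith) hCH, G * D + 1, by positivity, ?_⟩
  obtain ⟨ℓ₁, hℓ₁⟩ := eventually_atTop.1 (ht.eventually_lt 20)
  refine ⟨max (max ℓ₁ (128 * M)) (max (2 * B) (5 * (8 + 16 * A))), ?_⟩
  intro ℓ hℓ u hu hneg hu0 x₀ hx₀ hux₀ x hx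
  have hℓa : ℓ₁ ≤ ℓ := (le_max_left _ _).trans ((le_max_left _ _).trans hℓ)
  have hℓb : 128 * M ≤ ℓ := (le_max_right _ _).trans ((le_max_left _ _).trans hℓ)
  have hℓc : 2 * B ≤ ℓ := (le_max_left _ _).trans ((le_max_right _ _).trans hℓ)
  have hℓd : 5 * (8 + 16 * A) ≤ ℓ := (le_max_right _ _).trans ((le_max_right _ _).trans hℓ)
  obtain ⟨h1, h2⟩ := hℓ₁ ℓ hℓa
  have hℓ2 : 128 ≤ ℓ := by linarith
  have hℓ0 : 0 < ℓ := by linarith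
  have hpow1 : ℓ ≤ ℓ ^ 8 := le_self_pow₀ (by linarith) (by norm_num)
  have hpow2 : 128 * ℓ ^ 8 ≤ ℓ ^ 20 := by
    have a1 : ℓ ≤ ℓ ^ 12 := le_self_pow₀ (by linarith) (by norm_num)
    have a2 : 128 * ℓ ^ 8 ≤ ℓ ^ 12 * ℓ ^ 8 := by gcongr; linarith
    calc _ ≤ _ := a2
      _ = _ := by ring
  have hℓ3 : 8 * ℓ ^ 2 + 16 * A * (ℓ + 2) ≤ ℓ ^ 4 / 5 := by
    have a1 : ℓ ≤ ℓ ^ 2 := le_self_pow₀ (by linarith) (by norm_num)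
    have a2 : 2 * ℓ ≤ ℓ ^ 2 := by rw [sq]; gcongr; linarith
    have a3 : 16 * A * (ℓ + 2) ≤ 16 * A * ℓ ^ 2 := by gcongr; linarith
    have a4 : 5 * (8 + 16 * A) * ℓ ^ 2 ≤ ℓ ^ 2 * ℓ ^ 2 := by gcongr; linarith
    have a5 : ℓ ^ 2 * ℓ ^ 2 = ℓ ^ 4 := by ring
    linarith
  have hℓ4 : A / 2 + 2 * A / ℓ ≤ ℓ / 8 := by
    have : 2 * A / ℓ ≤ A := by
      rw [div_le_iff₀ hℓ0]
      have : A * 2 ≤ A * ℓ := by gcongr; linarith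
      linarith
    linarith
  have hL0 : 0 < ℓ ^ 8 := by positivity
  have hR0 : 0 < ℓ ^ 20 := by positivity
  have hUU : ∀ w : E, ‖w - x₀‖ ≤ 16 * M → w ∈ ball (0 : E) (ℓ ^ 8) := by
    intro w hw
    rw [mem_ball_zero_iff]
    rw [mem_ball, dist_eq_norm] at hx₀
    have a1 := norm_le_norm_add_norm_sub' w x₀
    have a2 := norm_le_norm_add_norm_sub' x₀ (-((ℓ ^ 8 / 2) • (stdVec i : E)))
    have a3 : ‖-((ℓ ^ 8 / 2) • (stdVec i : E))‖ = ℓ ^ 8 / 2 := by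
      rw [norm_neg, norm_smul, Real.norm_eq_abs, abs_of_pos (by positivity)]
      simp [stdVec]
    linarith
  have hU : Convex ℝ (ball (-(ℓ ^ 20 • (stdVec i : E))) (ℓ ^ 20) ∩ ball 0 (ℓ ^ 8)) :=
    (convex_ball _ _).inter (convex_ball _ _)
  have h0U : closedBall x₀ M ⊆ ball (-(ℓ ^ 20 • (stdVec i : E))) (ℓ ^ 20) ∩ ball 0 (ℓ ^ 8) := by
    intro w hw
    rw [mem_closedBall, dist_eq_norm] at hw
    have hwL := hUU w (by linarith)
    refine ⟨(mem_tangent_ball_iff hR0 i w).2 ?_, hwL⟩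
    rw [mem_ball_zero_iff] at hwL
    rw [mem_ball, dist_eq_norm] at hx₀
    have a1 := (le_abs_self _).trans ((abs_coord_le i (w - x₀)).trans hw)
    have a2 := (le_abs_self _).trans ((abs_coord_le i _).trans hx₀.le)
    have a3 : (x₀ - -((ℓ ^ 8 / 2) • (stdVec i : E))) i = x₀ i + ℓ ^ 8 / 2 := by simp [stdVec]
    rw [a3] at a2
    rw [PiLp.sub_apply] at a1
    have a4 : ‖w‖ ^ 2 ≤ ℓ ^ 8 * ℓ ^ 8 := by
      rw [sq]; gcongr
    have a5 : 2 * ℓ ^ 20 * w i ≤ 2 * ℓ ^ 20 * (-(ℓ ^ 8 / 8)) := by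
      gcongr; linarith
    have a6 : 128 * ℓ ^ 8 * ℓ ^ 8 ≤ ℓ ^ 20 * ℓ ^ 8 := by gcongr
    have a7 : 0 < ℓ ^ 8 * ℓ ^ 8 := by positivity
    linarith
  have h0L : closedBall x₀ (2 * M) ⊆ ball 0 (ℓ ^ 8) := by
    intro w hw
    rw [mem_closedBall, dist_eq_norm] at hw
    exact hUU w (by linarith)
  have hst : ∀ x ∈ closedBall x₀ (2 * M), u x ≤ -1 + (1 - g M) := by
    have hsub : ball x₀ (4 * (4 * M)) ⊆ ball (0 : E) (ℓ ^ 8) := by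
      intro w hw
      rw [mem_ball, dist_eq_norm] at hw
      exact hUU w (by linarith)
    intro z hz
    have key := hH x₀ (fun x => 1 + u x) (contDiffOn_const.add (hu.contDiff.mono hsub)) ?_ ?_ z ?_
    · have a1 : CH * (1 + u x₀) ≤ CH * ((1 - g M) / CH) := by gcongr; linarith
      rw [mul_div_cancel₀ _ hCH.ne'] at a1
      linarith
    · intro w hw
      have := (abs_le.1 (hu.abs_le w (hsub hw))).1
      linarith
    · intro w hw
      have a1 := abs_le.1 (hu.abs_le w (hsub hw))
      have a2 : ContDiffAt ℝ 2 u w := hu.contDiff.contDiffAt (isOpen_ball.mem_nhds (hsub hw))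
      rw [lap_add contDiffAt_const a2, lap_const, zero_add, hu.eq w (hsub hw)]
      have a3 := hf.lipschitz (u w) ⟨a1.1, a1.2⟩ (-1) (by simp)
      rw [hf.left_zero, sub_zero, abs_of_nonneg (a := u w - -1) (by linarith)] at a3
      linarith
    · have : 4 * M / 2 = 2 * M := by ring
      rwa [this]
  have hlat : ∀ x : E, ‖x‖ = ℓ ^ 8 / 2 →
      u x < g (x i + 2 * ‖x‖ ^ 2 / ℓ ^ 20) + 1 / ℓ ^ 20 := by
    intro x hx
    exact lateral_bound hgm hg1 hA hM hS.le_add h1 h2 (by linarith) (by linarith) hℓ3 hℓ4 i hu.abs_le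
      (fun y z ρ hρ hyU hyL hz => hS.sliding_ball hu hgm hgc hg0 hg1 hU hneg h0U h0L hst hρ hyU hyL
        hz) hx
  have hst2 : 1 - g (ℓ ^ 8 / 2) < 1 / ℓ ^ 20 := by
    have a1 : g (ℓ / 2) ≤ g (ℓ ^ 8 / 2) := hgm.monotone (by linarith)
    have a2 : 1 / (2 * ℓ ^ 20) ≤ 1 / ℓ ^ 20 := one_div_le_one_div_of_le hR0 (by linarith)
    linarith
  have hfin := hS.sliding_translate hu hgm hgc hg0 i (R := ℓ ^ 20) (by linarith) hL0 (by linarith)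
    hst2 hneg hu0 hlat (x := x) (by linarith)
  refine hfin.le.trans ?_
  have hR1 : 1 ≤ ℓ ^ 20 := one_le_pow₀ (by linarith)
  generalize ℓ ^ 20 = R at hR0 hR1 ⊢
  have hxi := abs_le.1 ((abs_coord_le i x).trans hx)
  have b1 : 2 * ‖x‖ ^ 2 / R ≤ 2 * B ^ 2 / R := by gcongr
  have b2 : 2 * B ^ 2 / R ≤ 2 * B ^ 2 := div_le_self (by positivity) hR1
  have b3 : 0 ≤ 2 * ‖x‖ ^ 2 / R := by positivity
  have b4 : |x i + 2 * ‖x‖ ^ 2 / R| ≤ B + 2 * B ^ 2 := by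
    rw [abs_le]; constructor <;> linarith [sq_nonneg B]
  have b5 := hS.le_add (R / 4) (by linarith) (x i + 2 * ‖x‖ ^ 2 / R)
  have b6 : A * (|x i + 2 * ‖x‖ ^ 2 / R| + 1) / (R / 4) ≤ A * (B + 2 * B ^ 2 + 1) / (R / 4) := by
    gcongr
  have b7 : 2 * B ^ 2 / R + A * (B + 2 * B ^ 2 + 1) / (R / 4) = D / R := by
    rw [hD]; field_simp
  have b8 : D / R ≤ D := div_le_self hD0.le hR1
  have b9 : 0 < D / R := by positivity
  have c1 := hgm.monotone (show τ (R / 4) (x i + 2 * ‖x‖ ^ 2 / R) ≤ x i + D / R by linarith)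
  have c2 := hG (x i + D / R) ⟨by linarith, by linarith⟩ (x i) ⟨by linarith, by linarith⟩
  rw [add_sub_cancel_left, abs_of_pos b9] at c2
  have c3 := (le_abs_self _).trans c2
  have c4 : (G * D + 1) / R = G * (D / R) + 1 / R := by ring
  rw [c4]
  linarith

end UpperBoundConclusion

section Estimates

variable {n : ℕ}
local notation "E" => EuclideanSpace ℝ (Fin n)

lemma contDiff_coord (i : Fin n) : ContDiff ℝ 2 (fun x : E => x i) :=
  (EuclideanSpace.proj i : E →L[ℝ] ℝ).contDiff

lemma contDiff_profile {g : ℝ → ℝ} (hg : ContDiff ℝ 2 g) (i : Fin n) :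
    ContDiff ℝ 2 (fun x : E => g (x i)) :=
  hg.comp (contDiff_coord i)

lemma lap_profile {g : ℝ → ℝ} (hg : ContDiff ℝ 2 g) (i : Fin n) (p : E) :
    lap n (fun x : E => g (x i)) p = deriv (deriv g) (p i) := by
  have := lap_of_quadratic_lines (F := fun x : E => g (x i)) (p := p) (ψ := g) (s₀ := p i)
    (a := fun j => if j = i then 1 else 0) (b := fun _ => 0)
    (contDiff_profile hg i).contDiffAt hg.contDiffAt (by
      intro j t
      simp [stdVec, eq_comm])
  simpa using this

/-- A solution vanishing at the origin which is bounded above by the one-dimensional profile up to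
a small error is close to that profile. -/
lemma exists_abs_sub_profile_le {W g : ℝ → ℝ} {K κ δ₀ : ℝ} (hf : IsBistable (deriv W) K κ δ₀)
    (hg : IsOneDSolution W g) (i : Fin n) :
    ∃ C, 0 < C ∧ ∀ (L ε : ℝ) (u : E → ℝ), IsSol n (deriv W) L u → 32 ≤ L → 0 ≤ ε → u 0 = 0 →
      (∀ x : E, ‖x‖ ≤ 32 → u x ≤ g (x i) + ε) → ∀ x : E, ‖x‖ ≤ 4 → |u x - g (x i)| ≤ C * ε := by
  obtain ⟨CH, hCH, hH⟩ := harnack_lap n (r₀ := 8) (by norm_num) hf.K_pos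
  obtain ⟨hgC, hg1, hgeq, -, hg0, -, -⟩ := hg
  refine ⟨2 * CH, by positivity, fun L ε u hu hL hε hu0 hup x hx => ?_⟩
  have hsub : ball (0 : E) (4 * 8) ⊆ ball 0 L := ball_subset_ball (by linarith)
  have hw : ContDiff ℝ 2 (fun x : E => g (x i) + 2 * ε) :=
    (contDiff_profile hgC i).add contDiff_const
  have hle : ∀ x ∈ ball (0 : E) (4 * 8), |u x - g (x i)| ≤ g (x i) + 2 * ε - u x := by
    intro x hx
    rw [mem_ball_zero_iff] at hx
    have := hup x (by linarith)
    rw [abs_le]; constructor <;> linarith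
  have key := hH 0 (fun x => g (x i) + 2 * ε - u x)
    (hw.contDiffOn.sub (hu.contDiff.mono hsub)) ?_ ?_ x (by simpa using (by linarith))
  · simp only [PiLp.zero_apply, hg0, hu0] at key
    have := hle x (by rw [mem_ball_zero_iff]; linarith)
    linarith
  · exact fun x hx => (abs_nonneg _).trans (hle x hx)
  · intro x hx
    have hux : ContDiffAt ℝ 2 u x := hu.contDiff.contDiffAt (isOpen_ball.mem_nhds (hsub hx))
    rw [lap_sub hw.contDiffAt hux, lap_add (contDiff_profile hgC i).contDiffAt contDiffAt_const,
      lap_const, add_zero, lap_profile hgC, hgeq, hu.eq x (hsub hx)]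
    have h1 := hf.lipschitz (g (x i)) ⟨(hg1 _).1.le, (hg1 _).2.le⟩ (u x)
      (abs_le.1 (hu.abs_le x (hsub hx)))
    rw [abs_sub_comm (g (x i))] at h1
    exact h1.trans (mul_le_mul_of_nonneg_left (hle x hx) hf.K_pos.le)

/-- First derivative estimates for a solution close to the one-dimensional profile. -/
lemma abs_fderiv_sub_profile_le {W g : ℝ → ℝ} {K κ δ₀ : ℝ} (hf : IsBistable (deriv W) K κ δ₀)
    (hg : IsOneDSolution W g) (i : Fin n) {L ε : ℝ} {u : E → ℝ} (hu : IsSol n (deriv W) L u)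
    (hL : 4 ≤ L) (hclose : ∀ x : E, ‖x‖ ≤ 4 → |u x - g (x i)| ≤ ε) {x : E} (hx : ‖x‖ ≤ 3)
    (j : Fin n) :
    |fderiv ℝ u x (stdVec j) - if j = i then deriv g (x i) else 0| ≤ (2 * n + K) * ε := by
  obtain ⟨hgC, hg1, hgeq, -, hg0, -, -⟩ := hg
  have hε : 0 ≤ ε := (abs_nonneg _).trans (hclose x (by linarith))
  have hball : ∀ z ∈ ball x 1, ‖z‖ < 4 := by
    intro z hz
    rw [mem_ball, dist_eq_norm] at hz
    have := norm_le_norm_add_norm_sub' z x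
    linarith
  have hsub : ∀ z ∈ ball x 1, z ∈ ball (0 : E) L := by
    intro z hz
    rw [mem_ball_zero_iff]
    linarith [hball z hz]
  have key := abs_fderiv_le_interior (v := fun x => u x - g (x i)) (x := x) (r := 1) (A := ε)
    (N := K * ε) one_pos ((hu.contDiff.mono hsub).sub (contDiff_profile hgC i).contDiffOn)
    (fun z hz => hclose z (hball z hz).le) ?_ j
  · have hux : DifferentiableAt ℝ u x :=
      (hu.contDiff.contDiffAt (isOpen_ball.mem_nhds (hsub x (mem_ball_self one_pos)))
        ).differentiableAt (by norm_num)
    have hgd : HasDerivAt g (deriv g (x i)) (x i) :=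
      (hgC.differentiable (by norm_num) _).hasDerivAt
    have hgx : HasFDerivAt (fun x : E => g (x i))
        (deriv g (x i) • (EuclideanSpace.proj i : E →L[ℝ] ℝ)) x :=
      hgd.comp_hasFDerivAt x
        (EuclideanSpace.proj i : E →L[ℝ] ℝ).hasFDerivAt
    have h2 := (hux.hasFDerivAt.sub hgx).fderiv
    have h3 : fderiv ℝ (fun x : E => u x - g (x i)) x = _ := h2
    rw [h3] at key
    have h4 : (deriv g (x i) • (EuclideanSpace.proj i : E →L[ℝ] ℝ))
        (stdVec j : E) = if j = i then deriv g (x i) else 0 := by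
      simp [stdVec, eq_comm]
    rw [sub_apply, h4] at key
    refine key.trans ?_
    have := mul_nonneg hf.K_pos.le hε
    linarith
  · intro z hz
    have huz : ContDiffAt ℝ 2 u z := hu.contDiff.contDiffAt (isOpen_ball.mem_nhds (hsub z hz))
    rw [lap_sub huz (contDiff_profile hgC i).contDiffAt, lap_profile hgC, hgeq,
      hu.eq z (hsub z hz)]
    refine (hf.lipschitz (u z) (abs_le.1 (hu.abs_le z (hsub z hz))) (g (z i))
      ⟨(hg1 _).1.le, (hg1 _).2.le⟩).trans ?_
    exact mul_le_mul_of_nonneg_left (hclose z (hball z hz).le) hf.K_pos.le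

/-- A bound for a partial derivative of a solution gives a bound for its derivatives. -/
lemma abs_fderiv_fderiv_le {f : ℝ → ℝ} {K κ δ₀ : ℝ} (hf : IsBistable f K κ δ₀)
    {L A : ℝ} {u : E → ℝ} (hu : IsSol n f L u) (hL : 3 < L) (j : Fin n)
    (hA : ∀ x : E, ‖x‖ ≤ 3 → |fderiv ℝ u x (stdVec j)| ≤ A) {x : E} (hx : ‖x‖ < 2) (k : Fin n) :
    |fderiv ℝ (fun y => fderiv ℝ u y (stdVec k)) x (stdVec j)| ≤ (4 * n + K) * A := by
  have hA0 : 0 ≤ A := (abs_nonneg _).trans (hA x (by linarith))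
  have hdiff : ∀ z : E, ‖z‖ ≤ 3 → DifferentiableAt ℝ u z := fun z hz =>
    (hu.contDiff.contDiffAt (isOpen_ball.mem_nhds (by rw [mem_ball_zero_iff]; linarith))
      ).differentiableAt (by norm_num)
  have hquot : ∀ t : ℝ, 0 < t → t < 1 / 2 →
      |t⁻¹ * (fderiv ℝ u (x + t • stdVec j) (stdVec k) - fderiv ℝ u x (stdVec k))|
        ≤ (4 * n + K) * A := by
    intro t ht0 ht
    have hstep : ∀ s ∈ Icc 0 t, ∀ z ∈ ball x (1 / 2), ‖z + s • (stdVec j : E)‖ < 3 := by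
      intro s hs z hz
      rw [mem_ball, dist_eq_norm] at hz
      have h1 := norm_le_norm_add_norm_sub' z x
      have h2 := norm_add_le z (s • (stdVec j : E))
      have h3 : ‖s • (stdVec j : E)‖ = s := by
        rw [norm_smul, Real.norm_eq_abs, abs_of_nonneg hs.1]; simp [stdVec]
      linarith [hs.2]
    have hstep0 : ∀ z ∈ ball x (1 / 2), ‖z‖ < 3 := by
      intro z hz
      simpa using hstep 0 ⟨le_rfl, ht0.le⟩ z hz
    have hinL : ∀ z : E, ‖z‖ < 3 → z ∈ ball (0 : E) L := by
      intro z hz; rw [mem_ball_zero_iff]; linarith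
    have hshift : ∀ z ∈ ball x (1 / 2), ContDiffAt ℝ 2 (fun y => u (y + t • stdVec j)) z := by
      intro z hz
      have := hu.contDiff.contDiffAt (isOpen_ball.mem_nhds (hinL _ (hstep t ⟨ht0.le, le_rfl⟩ z hz)))
      exact this.comp z (f := fun y => y + t • stdVec j) (by fun_prop)
    have hcd : ∀ z ∈ ball x (1 / 2), ContDiffAt ℝ 2 u z := fun z hz =>
      hu.contDiff.contDiffAt (isOpen_ball.mem_nhds (hinL _ (hstep0 z hz)))
    have hdq : ∀ z ∈ ball x (1 / 2), |u (z + t • stdVec j) - u z| ≤ t * A := by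
      intro z hz
      have := (convex_Icc (0 : ℝ) t).norm_image_sub_le_of_norm_hasDerivWithin_le
        (f := fun s => u (z + s • stdVec j))
        (f' := fun s => fderiv ℝ u (z + s • stdVec j) (stdVec j)) (C := A)
        (fun s hs => ((hdiff _ (hstep s hs z hz).le).hasFDerivAt.comp_hasDerivAt s
          (hasDerivAt_line z _ s)).hasDerivWithinAt)
        (fun s hs => hA _ (hstep s hs z hz).le)
        (left_mem_Icc.2 ht0.le) (right_mem_Icc.2 ht0.le)
      simp only [zero_smul, add_zero, sub_zero, Real.norm_eq_abs, abs_of_pos ht0] at this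
      linarith
    have hdq2 : ∀ z ∈ ball x (1 / 2), |t⁻¹ * (u (z + t • stdVec j) - u z)| ≤ A := by
      intro z hz
      rw [abs_mul, abs_of_pos (inv_pos.2 ht0), inv_mul_le_iff₀ ht0]
      exact hdq z hz
    have key := abs_fderiv_le_interior (v := fun y => t⁻¹ * (u (y + t • stdVec j) - u y)) (x := x)
      (r := 1 / 2) (A := A) (N := K * A) (by norm_num)
      (fun z hz => (contDiffAt_const.mul ((hshift z hz).sub (hcd z hz))).contDiffWithinAt)
      hdq2 ?_ k
    · have hx2 := mem_ball_self (x := x) (ε := 1 / 2) (by norm_num)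
      have e1 : fderiv ℝ (fun y => t⁻¹ * (u (y + t • stdVec j) - u y)) x
          = t⁻¹ • (fderiv ℝ u (x + t • stdVec j) - fderiv ℝ u x) := by
        have h1 : DifferentiableAt ℝ (fun y => u (y + t • stdVec j)) x :=
          (hshift x hx2).differentiableAt (by norm_num)
        have h2 : DifferentiableAt ℝ u x := (hcd x hx2).differentiableAt (by norm_num)
        have h3 := ((h1.hasFDerivAt.sub h2.hasFDerivAt).const_mul t⁻¹).fderiv
        rw [fderiv_comp_add_right] at h3
        exact h3
      rw [e1] at key
      simp only [smul_apply, sub_apply, smul_eq_mul] at key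
      refine key.trans ?_
      have := mul_nonneg hf.K_pos.le hA0
      have e2 : 2 * n * A / (1 / 2) = 4 * n * A := by ring
      rw [e2]
      linarith
    · intro z hz
      rw [lap_const_mul t⁻¹ ((hshift z hz).sub (hcd z hz)), lap_sub (hshift z hz) (hcd z hz),
        lap_comp_add, hu.eq _ (hinL _ (hstep t ⟨ht0.le, le_rfl⟩ z hz)),
        hu.eq _ (hinL _ (hstep0 z hz)), abs_mul, abs_of_pos (inv_pos.2 ht0), inv_mul_le_iff₀ ht0]
      have h1 := hf.lipschitz _ (abs_le.1 (hu.abs_le _ (hinL _ (hstep t ⟨ht0.le, le_rfl⟩ z hz))))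
        _ (abs_le.1 (hu.abs_le _ (hinL _ (hstep0 z hz))))
      have h2 := mul_le_mul_of_nonneg_left (hdq z hz) hf.K_pos.le
      linarith
  have hcx : ContDiffAt ℝ 2 u x :=
    hu.contDiff.contDiffAt (isOpen_ball.mem_nhds (by rw [mem_ball_zero_iff]; linarith))
  have hd := (differentiableAt_fderiv_apply hcx (stdVec k)).hasFDerivAt
  have hline : HasDerivAt (fun t : ℝ => fderiv ℝ u (x + t • stdVec j) (stdVec k))
      (fderiv ℝ (fun y => fderiv ℝ u y (stdVec k)) x (stdVec j)) 0 := by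
    have hd' : HasFDerivAt (fun y => fderiv ℝ u y (stdVec k))
        (fderiv ℝ (fun y => fderiv ℝ u y (stdVec k)) x) (x + (0 : ℝ) • stdVec j) := by
      simpa using hd
    exact hd'.comp_hasDerivAt 0 (hasDerivAt_line x _ 0)
  have hlim := (hasDerivAt_iff_tendsto_slope_zero.1 hline).mono_left
    (nhdsWithin_mono 0 (fun y (hy : y ∈ Ioi (0 : ℝ)) => ne_of_gt hy))
  refine le_of_tendsto hlim.abs ?_
  filter_upwards [Ioo_mem_nhdsGT (show (0 : ℝ) < 1 / 2 by norm_num)] with t ht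
  simpa using hquot t ht.1 ht.2

end Estimates

section Flat

variable {n : ℕ}
local notation "E" => EuclideanSpace ℝ (Fin n)

/-- The orthogonal projection onto the hyperplane `x i = 0`. -/
def flat (i : Fin n) : EuclideanSpace ℝ (Fin n) →L[ℝ] EuclideanSpace ℝ (Fin n) :=
  ContinuousLinearMap.id ℝ _ -
    (EuclideanSpace.proj i : EuclideanSpace ℝ (Fin n) →L[ℝ] ℝ).smulRight (stdVec i)

lemma flat_apply (i : Fin n) (x : E) : flat i x = x - x i • stdVec i := by
  simp [flat]

lemma flat_add_coord (i : Fin n) (x : E) : flat i x + x i • stdVec i = x := by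
  rw [flat_apply, sub_add_cancel]

lemma flat_coord (i : Fin n) (x : E) : flat i x i = 0 := by
  simp [flat_apply, stdVec]

lemma flat_stdVec (i j : Fin n) : flat i (stdVec j : E) = if j = i then 0 else stdVec j := by
  rw [flat_apply]
  split_ifs with h
  · subst h; simp [stdVec]
  · simp [stdVec, Ne.symm h]

lemma flat_flat_add (i : Fin n) (x : E) (t : ℝ) : flat i (flat i x + t • stdVec i) = flat i x := by
  rw [map_add, map_smul, flat_stdVec, if_pos rfl, smul_zero, add_zero, flat_apply i (flat i x),
    flat_coord, zero_smul, sub_zero]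

lemma norm_flat_add_sq (i : Fin n) (x : E) (t : ℝ) :
    ‖flat i x + t • stdVec i‖ ^ 2 = ‖flat i x‖ ^ 2 + t ^ 2 := by
  rw [norm_add_smul_stdVec_sq, flat_coord]; ring

lemma norm_flat_le (i : Fin n) (x : E) : ‖flat i x‖ ≤ ‖x‖ := by
  rw [← sq_le_sq₀ (norm_nonneg _) (norm_nonneg _)]
  conv_rhs => rw [← flat_add_coord i x, norm_flat_add_sq]
  linarith [sq_nonneg (x i)]

lemma abs_apply_flat_le {ℓ : E →L[ℝ] ℝ} {i : Fin n} {ε : ℝ} (hε : 0 ≤ ε)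
    (h : ∀ j, j ≠ i → |ℓ (stdVec j)| ≤ ε) (x : E) : |ℓ (flat i x)| ≤ n * ε * ‖x‖ := by
  have h1 : ‖ℓ.comp (flat i)‖ ≤ n * ε := by
    refine (norm_le_sum_abs_stdVec _).trans ?_
    have : ∀ j ∈ Finset.univ, |(ℓ.comp (flat i)) (stdVec j)| ≤ ε := by
      intro j _
      rw [ContinuousLinearMap.comp_apply, flat_stdVec]
      split_ifs with hj
      · simpa using hε
      · exact h j hj
    simpa using Finset.sum_le_card_nsmul _ _ _ this
  exact ContinuousLinearMap.le_of_opNorm_le _ h1 x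

lemma abs_apply_le_of_stdVec {ℓ : E →L[ℝ] ℝ} {ε : ℝ}
    (h : ∀ j, |ℓ (stdVec j)| ≤ ε) (x : E) : |ℓ x| ≤ n * ε * ‖x‖ := by
  have h1 : ‖ℓ‖ ≤ n * ε := by
    refine (norm_le_sum_abs_stdVec _).trans ?_
    simpa using Finset.sum_le_card_nsmul _ _ _ fun j (_ : j ∈ Finset.univ) => h j
  exact ContinuousLinearMap.le_of_opNorm_le _ h1 x

/-- A cutoff function depending only on the projection to the hyperplane `x i = 0`. -/
lemma exists_flat_cutoff (i : Fin n) :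
    ∃ (η : E → ℝ) (C : ℝ), 0 < C ∧ ContDiff ℝ 2 η ∧ (∀ z, ‖flat i z‖ ≤ 1 → η z = 1) ∧
      (∀ z, 5 / 4 ≤ ‖flat i z‖ → η z = 0) ∧
      ∀ k ≤ 2, ∀ z, ‖iteratedFDeriv ℝ k η z‖ ≤ C := by
  let b : ContDiffBump (0 : E) := ⟨1, 5 / 4, by norm_num, by norm_num⟩
  have hb : ContDiff ℝ 2 b := b.contDiff
  have hbd : ∀ k ≤ 2, ∃ C, ∀ z, ‖iteratedFDeriv ℝ k b z‖ ≤ C := by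
    intro k hk
    exact (hb.continuous_iteratedFDeriv (by exact_mod_cast hk)).bounded_above_of_compact_support
      (b.hasCompactSupport.iteratedFDeriv k)
  have hcomp : ∀ k ≤ 2, ∀ z, ‖iteratedFDeriv ℝ k (fun z => b (flat i z)) z‖
      ≤ ‖iteratedFDeriv ℝ k b (flat i z)‖ := by
    intro k hk z
    have := (flat i).iteratedFDeriv_comp_right hb z (i := k) (by exact_mod_cast hk)
    have h2 : iteratedFDeriv ℝ k (fun z => b (flat i z)) z = _ := this
    rw [h2]
    refine (ContinuousMultilinearMap.norm_compContinuousLinearMap_le _ _).trans ?_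
    refine mul_le_of_le_one_right (norm_nonneg _) ?_
    rw [Finset.prod_const]
    refine pow_le_one₀ (norm_nonneg _) ?_
    exact (flat i).opNorm_le_bound zero_le_one fun x => by simpa using norm_flat_le i x
  obtain ⟨C₀, h0⟩ := hbd 0 (by norm_num)
  obtain ⟨C₁, h1⟩ := hbd 1 (by norm_num)
  obtain ⟨C₂, h2⟩ := hbd 2 le_rfl
  refine ⟨fun z => b (flat i z), max 1 (max C₀ (max C₁ C₂)), by positivity,
    hb.comp (flat i).contDiff, fun z hz => b.one_of_mem_closedBall (by simpa [b] using hz),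
    fun z hz => b.zero_of_le_dist (by simpa [b] using hz), fun k hk z => ?_⟩
  refine (hcomp k hk z).trans (le_trans ?_ (le_max_right _ _))
  interval_cases k
  · exact (h0 _).trans (le_max_left _ _)
  · exact (h1 _).trans ((le_max_left _ _).trans (le_max_right _ _))
  · exact (h2 _).trans ((le_max_right _ _).trans (le_max_right _ _))

/-- Multiplication by a cutoff function controls the second derivative globally. -/
lemma contDiff_mul_cutoff {η h : E → ℝ} {U : Set E} {s C D : ℝ} {i : Fin n}
    (hs : 5 / 4 < s) (hU : U = {z | ‖flat i z‖ < s})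
    (hη : ContDiff ℝ 2 η) (hη0 : ∀ z, 5 / 4 ≤ ‖flat i z‖ → η z = 0)
    (hηC : ∀ k ≤ 2, ∀ z, ‖iteratedFDeriv ℝ k η z‖ ≤ C)
    (hh : ContDiffOn ℝ 2 h U) (hC : 0 ≤ C) (hD : 0 ≤ D)
    (hhD : ∀ k ≤ 2, ∀ z ∈ U, ‖iteratedFDeriv ℝ k h z‖ ≤ D) :
    ContDiff ℝ 2 (fun z => η z * h z) ∧
      ∀ z, ‖iteratedFDeriv ℝ 2 (fun z => η z * h z) z‖ ≤ 4 * C * D := by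
  have hUo : IsOpen U := by
    rw [hU]; exact isOpen_lt (by fun_prop) continuous_const
  have hzero : ∀ z, z ∉ U → (fun z => η z * h z) =ᶠ[nhds z] fun _ => 0 := by
    intro z hz
    have hz' : 5 / 4 < ‖flat i z‖ := by
      rw [hU, mem_ofPred_eq, not_lt] at hz; linarith
    have : ContinuousAt (fun z => ‖flat i z‖) z := by fun_prop
    filter_upwards [this.eventually (lt_mem_nhds hz')] with y hy
    rw [hη0 y hy.le, zero_mul]
  refine ⟨contDiff_iff_contDiffAt.2 fun z => ?_, fun z => ?_⟩
  · by_cases hz : z ∈ U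
    · exact hη.contDiffAt.mul (hh.contDiffAt (hUo.mem_nhds hz))
    · exact contDiffAt_const.congr_of_eventuallyEq (hzero z hz)
  · by_cases hz : z ∈ U
    · have := norm_iteratedFDerivWithin_mul_le (n := 2) hη.contDiffOn hh hUo.uniqueDiffOn hz le_rfl
      simp only [iteratedFDerivWithin_of_isOpen _ hUo hz] at this
      refine this.trans ?_
      simp only [Finset.sum_range_succ, Finset.sum_range_zero, Nat.choose]
      have a := fun k hk => mul_le_mul (hηC k hk z) (hhD (2 - k) (by omega) z hz) (norm_nonneg _) hC
      have a0 := a 0 (by norm_num)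
      have a1 := a 1 (by norm_num)
      have a2 := a 2 (by norm_num)
      norm_num at a0 a1 a2 ⊢
      linarith
    · rw [((hzero z hz).iteratedFDeriv ℝ 2).self_of_nhds]
      simp
      positivity

end Flat

section Graph

variable {n : ℕ}
local notation "E" => EuclideanSpace ℝ (Fin n)

/-- Bounds for the first and second derivatives of `u` in the ball of radius `2`, which are small
except in the direction `i`, in which `u` is strictly increasing. -/
structure IsAlmostFlat (n : ℕ) (i : Fin n) (m Λ ε : ℝ) (u : EuclideanSpace ℝ (Fin n) → ℝ) :
    Prop where
  contDiffAt : ∀ x, ‖x‖ < 2 → ContDiffAt ℝ 2 u x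
  tangential : ∀ x, ‖x‖ < 2 → ∀ b, |fderiv ℝ u x (flat i b)| ≤ ε * ‖b‖
  normal : ∀ x, ‖x‖ < 2 → m ≤ fderiv ℝ u x (stdVec i)
  tangential₂ : ∀ x, ‖x‖ < 2 → ∀ a b, |fderiv ℝ (fderiv ℝ u) x a (flat i b)| ≤ ε * ‖a‖ * ‖b‖
  normal₂ : ∀ x, ‖x‖ < 2 → ∀ a, |fderiv ℝ (fderiv ℝ u) x a (stdVec i)| ≤ Λ * ‖a‖

/-- `h` parametrizes the zero set of `u` over `‖flat i z‖ < 3 / 2`. -/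
structure IsZeroGraph (n : ℕ) (i : Fin n) (u h : EuclideanSpace ℝ (Fin n) → ℝ) : Prop where
  mem : ∀ z, ‖flat i z‖ < 3 / 2 → h z ∈ Ioo (-1 : ℝ) 1
  eq_zero : ∀ z, ‖flat i z‖ < 3 / 2 → u (flat i z + h z • stdVec i) = 0
  unique : ∀ z, ‖flat i z‖ < 3 / 2 → ∀ t ∈ Ioo (-1 : ℝ) 1, u (flat i z + t • stdVec i) = 0 → t = h z

variable {i : Fin n} {m Λ ε : ℝ} {u h : EuclideanSpace ℝ (Fin n) → ℝ}

lemma norm_flat_add_lt {z : E} {t : ℝ} (hz : ‖flat i z‖ < 3 / 2) (ht : t ∈ Icc (-1 : ℝ) 1) :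
    ‖flat i z + t • stdVec i‖ < 2 := by
  rw [← sq_lt_sq₀ (norm_nonneg _) (by norm_num), norm_flat_add_sq]
  have h1 : ‖flat i z‖ ^ 2 < (3 / 2) ^ 2 := by gcongr
  have h2 : t ^ 2 ≤ 1 := by rw [sq_le_one_iff_abs_le_one]; exact abs_le.2 ht
  linarith

lemma IsAlmostFlat.hasDerivAt (hu : IsAlmostFlat n i m Λ ε u) {z : E} {t : ℝ}
    (hz : ‖flat i z‖ < 3 / 2) (ht : t ∈ Icc (-1 : ℝ) 1) :
    HasDerivAt (fun t => u (flat i z + t • stdVec i))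
      (fderiv ℝ u (flat i z + t • stdVec i) (stdVec i)) t :=
  ((hu.contDiffAt _ (norm_flat_add_lt hz ht)).differentiableAt (by norm_num)).hasFDerivAt
    |>.comp_hasDerivAt t (hasDerivAt_line _ _ t)

lemma IsAlmostFlat.mul_sub_le (hu : IsAlmostFlat n i m Λ ε u) {z : E} (hz : ‖flat i z‖ < 3 / 2)
    {s t : ℝ} (hs : s ∈ Icc (-1 : ℝ) 1) (ht : t ∈ Icc (-1 : ℝ) 1) (hst : s ≤ t) :
    m * (t - s) ≤ u (flat i z + t • stdVec i) - u (flat i z + s • stdVec i) := by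
  refine (convex_Icc (-1 : ℝ) 1).mul_sub_le_image_sub_of_le_deriv
    (f := fun t => u (flat i z + t • stdVec i)) (C := m)
    (fun x hx => (hu.hasDerivAt hz hx).continuousAt.continuousWithinAt) ?_ ?_ s hs t ht hst
  · intro x hx
    exact (hu.hasDerivAt hz (interior_subset hx)).differentiableAt.differentiableWithinAt
  · intro x hx
    rw [(hu.hasDerivAt hz (interior_subset hx)).deriv]
    exact hu.normal _ (norm_flat_add_lt hz (interior_subset hx))

lemma IsAlmostFlat.abs_flat_le (hu : IsAlmostFlat n i m Λ ε u) (hu0 : u 0 = 0) {z : E}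
    (hz : ‖flat i z‖ < 3 / 2) : |u (flat i z)| ≤ ε * (3 / 2) := by
  have hseg : ∀ s ∈ Icc (0 : ℝ) 1, ‖s • flat i z‖ < 2 := by
    intro s hs
    rw [norm_smul, Real.norm_eq_abs, abs_of_nonneg hs.1]
    have := mul_le_of_le_one_left (norm_nonneg (flat i z)) hs.2
    linarith
  have hff : flat i (flat i z) = flat i z := by simpa using flat_flat_add i z 0
  have hε : 0 ≤ ε * ‖flat i z‖ := by
    have := hu.tangential 0 (by simp) (flat i z)
    exact (abs_nonneg _).trans this
  have key := (convex_Icc (0 : ℝ) 1).norm_image_sub_le_of_norm_hasDerivWithin_le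
    (f := fun s => u (s • flat i z)) (f' := fun s => fderiv ℝ u (s • flat i z) (flat i z))
    (C := ε * ‖flat i z‖)
    (fun s hs => by
      have h1 := ((hu.contDiffAt _ (hseg s hs)).differentiableAt (by norm_num)).hasFDerivAt
      have h2 : HasDerivAt (fun s : ℝ => s • flat i z) (flat i z) s := by
        simpa using (hasDerivAt_id s).smul_const (flat i z)
      exact (h1.comp_hasDerivAt s h2).hasDerivWithinAt)
    (fun s hs => by
      have := hu.tangential _ (hseg s hs) (flat i z)
      rwa [hff] at this)
    (left_mem_Icc.2 zero_le_one) (right_mem_Icc.2 zero_le_one)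
  simp only [one_smul, zero_smul, hu0, sub_zero, Real.norm_eq_abs, abs_one, mul_one] at key
  rcases (norm_nonneg (flat i z)).eq_or_lt with h0 | h0
  · have : flat i z = 0 := norm_eq_zero.1 h0.symm
    rw [this, hu0, abs_zero]
    have := hu.tangential 0 (by simp) (stdVec i)
    have h1 : ‖(stdVec i : E)‖ = 1 := by simp [stdVec]
    rw [h1] at this
    have := (abs_nonneg _).trans this
    linarith
  · have hε0 : 0 ≤ ε := nonneg_of_mul_nonneg_left hε h0
    exact key.trans (by gcongr)

lemma IsAlmostFlat.exists_isZeroGraph (hu : IsAlmostFlat n i m Λ ε u) (hu0 : u 0 = 0) (hm : 0 < m)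
    (hε : 2 * ε ≤ m) (hε0 : 0 < ε) : ∃ h, IsZeroGraph n i u h ∧
      ∀ z, ‖flat i z‖ < 3 / 2 → |h z| ≤ 2 * ε / m := by
  have hex : ∀ z : E, ‖flat i z‖ < 3 / 2 →
      ∃ t ∈ Ioo (-1 : ℝ) 1, u (flat i z + t • stdVec i) = 0 := by
    intro z hz
    have h1 := abs_le.1 (hu.abs_flat_le hu0 hz)
    have h2 := hu.mul_sub_le hz (s := 0) (t := 1) (by simp) (by simp) zero_le_one
    have h3 := hu.mul_sub_le hz (s := -1) (t := 0) (by simp) (by simp) (by norm_num)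
    rw [zero_smul, add_zero] at h2 h3
    have hc : ContinuousOn (fun t : ℝ => u (flat i z + t • stdVec i)) (Icc (-1) 1) :=
      fun x hx => (hu.hasDerivAt hz hx).continuousAt.continuousWithinAt
    obtain ⟨t, ht, ht0⟩ := intermediate_value_Ioo (by norm_num : (-1 : ℝ) ≤ 1) hc
      (show (0 : ℝ) ∈ Ioo _ _ from ⟨by linarith, by linarith⟩)
    exact ⟨t, ht, ht0⟩
  choose! h hmem hzero using hex
  refine ⟨h, ⟨hmem, hzero, ?_⟩, ?_⟩
  · intro z hz t ht ht0
    have hI := Ioo_subset_Icc_self (a := (-1 : ℝ)) (b := 1)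
    rcases le_total t (h z) with hle | hle
    · have := hu.mul_sub_le hz (hI ht) (hI (hmem z hz)) hle
      rw [ht0, hzero z hz, sub_zero] at this
      have := nonpos_of_mul_nonpos_right this hm
      linarith
    · have := hu.mul_sub_le hz (hI (hmem z hz)) (hI ht) hle
      rw [ht0, hzero z hz, sub_zero] at this
      have := nonpos_of_mul_nonpos_right this hm
      linarith
  · intro z hz
    have hI := Ioo_subset_Icc_self (hmem z hz)
    have h1 := abs_le.1 (hu.abs_flat_le hu0 hz)
    rw [le_div_iff₀ hm]
    rcases le_total 0 (h z) with hle | hle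
    · have := hu.mul_sub_le hz (s := 0) (by simp) hI hle
      rw [hzero z hz, zero_smul, add_zero] at this
      rw [abs_of_nonneg hle]
      linarith
    · have := hu.mul_sub_le hz (t := 0) hI (by simp) hle
      rw [hzero z hz, zero_smul, add_zero] at this
      rw [abs_of_nonpos hle]
      linarith

lemma IsZeroGraph.contDiffAt (hh : IsZeroGraph n i u h) (hu : IsAlmostFlat n i m Λ ε u)
    (hm : 0 < m) {z : E} (hz : ‖flat i z‖ < 3 / 2) : ContDiffAt ℝ 2 h z := by
  set Φ : E × ℝ → E := fun p => flat i p.1 + p.2 • stdVec i with hΦ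
  have hΦc : ContDiff ℝ 2 Φ :=
    ((flat i).contDiff.comp contDiff_fst).add (contDiff_snd.smul contDiff_const)
  have hI := Ioo_subset_Icc_self (hh.mem z hz)
  have hF : ContDiffAt ℝ 2 (fun p : E × ℝ => u (Φ p)) (z, h z) :=
    (hu.contDiffAt _ (norm_flat_add_lt hz hI)).comp (z, h z) hΦc.contDiffAt
  have hd := hu.normal _ (norm_flat_add_lt hz hI)
  set d := fderiv ℝ u (flat i z + h z • stdVec i) (stdVec i) with hdd
  have hpart : fderiv ℝ (fun p : E × ℝ => u (Φ p)) (z, h z) ∘L .inr ℝ E ℝ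
      = ContinuousLinearMap.toSpanSingleton ℝ d := by
    apply ContinuousLinearMap.ext_ring
    have h1 := ((hF.differentiableAt (by norm_num)).hasFDerivAt.comp_hasDerivAt (h z)
      ((hasDerivAt_const (h z) z).prodMk (hasDerivAt_id (h z))))
    have h2 := h1.unique (hu.hasDerivAt hz hI)
    simpa using h2
  have hinv : (fderiv ℝ (fun p : E × ℝ => u (Φ p)) (z, h z) ∘L .inr ℝ E ℝ).IsInvertible := by
    rw [hpart]
    refine ⟨ContinuousLinearEquiv.unitsEquivAut ℝ (Units.mk0 d (by linarith)), ?_⟩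
    ext
    simp
  have hψ := hF.contDiffAt_implicitFunction (by norm_num) hinv
  refine hψ.congr_of_eventuallyEq ?_
  have hself := hF.implicitFunction_apply_self (by norm_num) hinv
  have heq := hF.eventually_apply_implicitFunction (by norm_num) hinv
  have hmem : ∀ᶠ y in nhds z, hF.implicitFunction (by norm_num) hinv y ∈ Ioo (-1 : ℝ) 1 := by
    refine hψ.continuousAt.eventually (isOpen_Ioo.mem_nhds ?_)
    have : hF.implicitFunction (by norm_num) hinv z = h z := hself
    rw [this]
    exact hh.mem z hz
  have hcont : ContinuousAt (fun z => ‖flat i z‖) z := by fun_prop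
  filter_upwards [heq, hmem, hcont.eventually (gt_mem_nhds hz)] with y h1 h2 h3
  exact (hh.unique y h3 _ h2 (h1.trans (hh.eq_zero z hz))).symm

end Graph

section GraphDerivatives

variable {n : ℕ}
local notation "E" => EuclideanSpace ℝ (Fin n)

variable {i : Fin n} {m Λ ε : ℝ} {u h : EuclideanSpace ℝ (Fin n) → ℝ}

lemma IsZeroGraph.hasFDerivAt_graph (hh : IsZeroGraph n i u h) (hu : IsAlmostFlat n i m Λ ε u)
    (hm : 0 < m) {z : E} (hz : ‖flat i z‖ < 3 / 2) :
    HasFDerivAt (fun z => flat i z + h z • stdVec i)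
      (flat i + (fderiv ℝ h z).smulRight (stdVec i)) z :=
  (flat i).hasFDerivAt.add
    (((hh.contDiffAt hu hm hz).differentiableAt (by norm_num)).hasFDerivAt.smul_const (stdVec i))

lemma IsZeroGraph.fderiv_apply (hh : IsZeroGraph n i u h) (hu : IsAlmostFlat n i m Λ ε u)
    (hm : 0 < m) {z : E} (hz : ‖flat i z‖ < 3 / 2) (b : E) :
    fderiv ℝ h z b = -(fderiv ℝ u (flat i z + h z • stdVec i) (flat i b)
      / fderiv ℝ u (flat i z + h z • stdVec i) (stdVec i)) := by
  have hlt := norm_flat_add_lt hz (Ioo_subset_Icc_self (hh.mem z hz))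
  have h1 := ((hu.contDiffAt _ hlt).differentiableAt (by norm_num)).hasFDerivAt.comp z
    (hh.hasFDerivAt_graph hu hm hz)
  have hcont : ContinuousAt (fun z => ‖flat i z‖) z := by fun_prop
  have h2 : (u ∘ fun z => flat i z + h z • stdVec i) =ᶠ[nhds z] fun _ => 0 := by
    filter_upwards [hcont.eventually (gt_mem_nhds hz)] with y hy
    exact hh.eq_zero y hy
  have h3 := (h1.congr_of_eventuallyEq h2.symm).unique (hasFDerivAt_const (0 : ℝ) z)
  have h4 := congrArg (fun ℓ : E →L[ℝ] ℝ => ℓ b) h3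
  simp only [ContinuousLinearMap.comp_apply, add_apply, ContinuousLinearMap.smulRight_apply,
    map_add, map_smul, smul_eq_mul, zero_apply] at h4
  have hpos := hu.normal _ hlt
  rw [← neg_div, eq_div_iff (by linarith)]
  linarith

lemma IsZeroGraph.abs_fderiv_le (hh : IsZeroGraph n i u h) (hu : IsAlmostFlat n i m Λ ε u)
    (hm : 0 < m) {z : E} (hz : ‖flat i z‖ < 3 / 2) (b : E) :
    |fderiv ℝ h z b| ≤ ε / m * ‖b‖ := by
  have hlt := norm_flat_add_lt hz (Ioo_subset_Icc_self (hh.mem z hz))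
  have h1 := hu.tangential _ hlt b
  have h2 := hu.normal _ hlt
  rw [hh.fderiv_apply hu hm hz, abs_neg, abs_div,
    abs_of_pos (a := fderiv ℝ u _ (stdVec i)) (by linarith), div_mul_eq_mul_div]
  exact div_le_div₀ ((abs_nonneg _).trans h1) h1 hm h2

lemma IsZeroGraph.abs_fderiv_fderiv_le (hh : IsZeroGraph n i u h) (hu : IsAlmostFlat n i m Λ ε u)
    (hm : 0 < m) (hε : ε ≤ m) (hΛ : 0 ≤ Λ) {z : E} (hz : ‖flat i z‖ < 3 / 2) (a b : E) :
    |fderiv ℝ (fderiv ℝ h) z a b| ≤ (2 / m + 2 * Λ / m ^ 2) * ε * ‖a‖ * ‖b‖ := by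
  have hlt := norm_flat_add_lt hz (Ioo_subset_Icc_self (hh.mem z hz))
  set q := flat i z + h z • stdVec i with hq
  have hfd : HasFDerivAt (fderiv ℝ u) (fderiv ℝ (fderiv ℝ u) q) q :=
    (((hu.contDiffAt _ hlt).fderiv_right (m := 1) (by norm_num)).differentiableAt
      (by norm_num)).hasFDerivAt
  have hqd := hh.hasFDerivAt_graph hu hm hz
  have hcomp : HasFDerivAt (fun y => fderiv ℝ u (flat i y + h y • stdVec i))
      ((fderiv ℝ (fderiv ℝ u) q).comp (flat i + (fderiv ℝ h z).smulRight (stdVec i))) z :=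
    HasFDerivAt.comp z hfd hqd
  have hline := hasDerivAt_line z a 0
  have hz0 : z + (0 : ℝ) • a = z := by simp
  set v := flat i a + fderiv ℝ h z a • stdVec i with hv
  have hcl : HasDerivAt (fun t : ℝ => fderiv ℝ u (flat i (z + t • a) + h (z + t • a) • stdVec i))
      (fderiv ℝ (fderiv ℝ u) q v) 0 := by
    have h1 := HasFDerivAt.comp_hasDerivAt (0 : ℝ) (by rw [hz0]; exact hcomp) hline
    exact h1
  have hc : ∀ w, HasDerivAt
      (fun t : ℝ => fderiv ℝ u (flat i (z + t • a) + h (z + t • a) • stdVec i) w)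
      (fderiv ℝ (fderiv ℝ u) q v w) 0 := by
    intro w
    simpa using hcl.clm_apply (hasDerivAt_const (0 : ℝ) w)
  have hs := hu.normal q hlt
  have hs0 : 0 < fderiv ℝ u q (stdVec i) := by linarith
  have hquot := ((hc (flat i b)).div (hc (stdVec i)) (by
    simp only [hz0, ← hq]; exact hs0.ne')).neg
  simp only [hz0, ← hq] at hquot
  have hcont : ContinuousAt (fun t : ℝ => ‖flat i (z + t • a)‖) 0 := by fun_prop
  have hev : (fun t : ℝ => fderiv ℝ h (z + t • a) b) =ᶠ[nhds 0]
      -((fun t : ℝ => fderiv ℝ u (flat i (z + t • a) + h (z + t • a) • stdVec i) (flat i b)) /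
        fun t : ℝ => fderiv ℝ u (flat i (z + t • a) + h (z + t • a) • stdVec i) (stdVec i)) := by
    have hlt3 : ‖flat i (z + (0 : ℝ) • a)‖ < 3 / 2 := by rw [hz0]; exact hz
    filter_upwards [hcont.eventually (gt_mem_nhds hlt3)] with t ht
    exact hh.fderiv_apply hu hm ht b
  have hleft : HasDerivAt (fun t : ℝ => fderiv ℝ h (z + t • a) b)
      (fderiv ℝ (fderiv ℝ h) z a b) 0 := by
    have h1 : HasFDerivAt (fderiv ℝ h) (fderiv ℝ (fderiv ℝ h) z) (z + (0 : ℝ) • a) := by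
      rw [hz0]
      exact (((hh.contDiffAt hu hm hz).fderiv_right (m := 1) (by norm_num)).differentiableAt
        (by norm_num)).hasFDerivAt
    have h2 : HasDerivAt (fun t : ℝ => fderiv ℝ h (z + t • a)) (fderiv ℝ (fderiv ℝ h) z a) 0 :=
      HasFDerivAt.comp_hasDerivAt (0 : ℝ) h1 hline
    simpa using h2.clm_apply (hasDerivAt_const (0 : ℝ) b)
  have heq := hleft.unique (hquot.congr_of_eventuallyEq hev)
  have hvle : ‖v‖ ≤ 2 * ‖a‖ := by
    have h1 := hh.abs_fderiv_le hu hm hz a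
    have h2 : ε / m ≤ 1 := by rw [div_le_one hm]; exact hε
    have h3 := mul_le_mul_of_nonneg_right h2 (norm_nonneg a)
    have h4 : ‖fderiv ℝ h z a • (stdVec i : E)‖ = |fderiv ℝ h z a| := by
      rw [norm_smul, Real.norm_eq_abs]; simp [stdVec]
    have h5 := norm_add_le (flat i a) (fderiv ℝ h z a • (stdVec i : E))
    have h6 := norm_flat_le i a
    linarith
  have e1 := hu.tangential₂ q hlt v b
  have e2 := hu.normal₂ q hlt v
  have e3 := hu.tangential q hlt b
  have hε0 : 0 ≤ ε := by
    have h1 := (abs_nonneg _).trans (hu.tangential q hlt (stdVec i))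
    have h2 : ‖(stdVec i : E)‖ = 1 := by simp [stdVec]
    rwa [h2, mul_one] at h1
  rw [heq, abs_neg]
  set S := fderiv ℝ u q (stdVec i)
  set P := fderiv ℝ u q (flat i b)
  set Q := fderiv ℝ (fderiv ℝ u) q v (flat i b)
  set N := fderiv ℝ (fderiv ℝ u) q v (stdVec i)
  have hsplit : (Q * S - P * N) / S ^ 2 = Q / S - P * N / S ^ 2 := by
    field_simp
  rw [hsplit]
  refine (abs_sub _ _).trans ?_
  rw [abs_div, abs_div, abs_mul, abs_of_pos hs0, abs_of_pos (pow_pos hs0 2)]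
  have f1 : |Q| / S ≤ ε * (2 * ‖a‖) * ‖b‖ / m := by
    refine div_le_div₀ (by positivity) (e1.trans ?_) hm hs
    gcongr
  have f2 : |P| * |N| / S ^ 2 ≤ (ε * ‖b‖) * (Λ * (2 * ‖a‖)) / m ^ 2 := by
    refine div_le_div₀ (by positivity) ?_ (by positivity) (by gcongr)
    refine mul_le_mul e3 (e2.trans ?_) (abs_nonneg _) (by positivity)
    gcongr
  refine (add_le_add f1 f2).trans (le_of_eq ?_)
  field_simp

/-- The zero set of an almost flat function is a graph with small second derivatives. -/
lemma exists_graph (i : Fin n) {m Λ : ℝ} (hm : 0 < m) (hΛ : 0 ≤ Λ) :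
    ∃ C, 0 < C ∧ ∀ (ε : ℝ) (u : E → ℝ), 0 < ε → 2 * ε ≤ m → IsAlmostFlat n i m Λ ε u → u 0 = 0 →
      ∃ h : E → ℝ, ContDiff ℝ 2 h ∧ (∀ z, ‖iteratedFDeriv ℝ 2 h z‖ ≤ C * ε) ∧
        ∀ x ∈ ball (0 : E) 1, (u x = 0 ↔ x i = h (x - x i • stdVec i)) := by
  obtain ⟨η, Cη, hCη, hη, hη1, hη0, hηC⟩ := exists_flat_cutoff i
  refine ⟨4 * Cη * (2 / m + 2 * Λ / m ^ 2), by positivity, fun ε u hε0 hε hu hu0 => ?_⟩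
  obtain ⟨h, hh, hhle⟩ := hu.exists_isZeroGraph hu0 hm hε hε0
  have key := contDiff_mul_cutoff (η := η) (h := h) (s := 3 / 2) (C := Cη)
    (D := (2 / m + 2 * Λ / m ^ 2) * ε) (i := i) (by norm_num) rfl hη hη0 hηC
    (fun z hz => (hh.contDiffAt hu hm hz).contDiffWithinAt) hCη.le (by positivity) ?_
  · refine ⟨fun z => η z * h z, key.1, fun z => (key.2 z).trans (le_of_eq (by ring)), ?_⟩
    intro x hx
    rw [mem_ball_zero_iff] at hx
    rw [← flat_apply]
    have hff : flat i (flat i x) = flat i x := by simpa using flat_flat_add i x 0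
    have hfx := norm_flat_le i x
    have hfx' : ‖flat i (flat i x)‖ < 3 / 2 := by rw [hff]; linarith
    have hxi : x i ∈ Ioo (-1 : ℝ) 1 := abs_lt.1 ((abs_coord_le i x).trans_lt hx)
    change u x = 0 ↔ x i = η (flat i x) * h (flat i x)
    rw [hη1 (flat i x) (by rw [hff]; linarith), one_mul]
    constructor
    · intro hux
      refine hh.unique _ hfx' _ hxi ?_
      rwa [hff, flat_add_coord]
    · intro hxh
      have := hh.eq_zero _ hfx'
      rwa [hff, ← hxh, flat_add_coord] at this
  · have hB : 0 ≤ 2 * Λ / m ^ 2 * ε := by positivity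
    have hB2 : 2 * ε / m = 2 / m * ε := by ring
    have hB3 : 0 < ε / m := by positivity
    have hB4 : ε / m = 1 / 2 * (2 / m * ε) := by ring
    intro k hk z hz
    interval_cases k
    · rw [norm_iteratedFDeriv_zero, Real.norm_eq_abs]
      have := hhle z hz
      linarith
    · rw [norm_iteratedFDeriv_one]
      refine (ContinuousLinearMap.opNorm_le_bound _ hB3.le fun b =>
        hh.abs_fderiv_le hu hm hz b).trans ?_
      linarith
    · refine ContinuousMultilinearMap.opNorm_le_bound (by positivity) fun v => ?_
      rw [iteratedFDeriv_two_apply, Fin.prod_univ_two, ← mul_assoc]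
      exact hh.abs_fderiv_fderiv_le hu hm (by linarith) hΛ hz _ _

end GraphDerivatives

section AlmostFlat

variable {n : ℕ}
local notation "E" => EuclideanSpace ℝ (Fin n)

lemma fderiv_fderiv_apply {u : E → ℝ} {x : E} (hu : ContDiffAt ℝ 2 u x) (a b : E) :
    fderiv ℝ (fderiv ℝ u) x a b = fderiv ℝ (fun y => fderiv ℝ u y b) x a := by
  have h1 : HasFDerivAt (fderiv ℝ u) (fderiv ℝ (fderiv ℝ u) x) x :=
    ((hu.fderiv_right (m := 1) (by norm_num)).differentiableAt (by norm_num)).hasFDerivAt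
  have h2 := h1.clm_apply (hasFDerivAt_const b x)
  rw [h2.fderiv]
  simp

/-- A solution which is close to the one-dimensional profile is almost flat. -/
lemma exists_isAlmostFlat {W g : ℝ → ℝ} {K κ δ₀ : ℝ} (hf : IsBistable (deriv W) K κ δ₀)
    (hg : IsOneDSolution W g) (i : Fin n) :
    ∃ m, 0 < m ∧ ∃ Λ, 0 ≤ Λ ∧ ∃ C, 0 < C ∧ ∃ ε₀, 0 < ε₀ ∧ ∀ (L ε : ℝ) (u : E → ℝ),
      IsSol n (deriv W) L u → 4 ≤ L → 0 ≤ ε → ε ≤ ε₀ →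
      (∀ x : E, ‖x‖ ≤ 4 → |u x - g (x i)| ≤ ε) → IsAlmostFlat n i m Λ (C * ε) u := by
  have hgd : Continuous (deriv g) := hg.1.continuous_deriv (by norm_num)
  have hgpos : ∀ t, 0 < deriv g t := hg.2.2.2.1
  obtain ⟨t₀, -, ht₀⟩ := (isCompact_Icc (a := (-3 : ℝ)) (b := 3)).exists_isMinOn
    (nonempty_Icc.2 (by norm_num)) hgd.continuousOn
  obtain ⟨t₁, -, ht₁⟩ := (isCompact_Icc (a := (-3 : ℝ)) (b := 3)).exists_isMaxOn
    (nonempty_Icc.2 (by norm_num)) hgd.continuousOn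
  have hm₀ := hgpos t₀
  have hG := hgpos t₁
  have hmin : ∀ t ∈ Icc (-3 : ℝ) 3, deriv g t₀ ≤ deriv g t := fun t ht => ht₀ ht
  have hmax : ∀ t ∈ Icc (-3 : ℝ) 3, deriv g t ≤ deriv g t₁ := fun t ht => ht₁ ht
  set m₀ := deriv g t₀
  set G := deriv g t₁
  clear_value m₀ G
  have hK := hf.K_pos
  have hn : (0 : ℝ) ≤ n := Nat.cast_nonneg n
  set D : ℝ := 2 * n + K with hD
  set H : ℝ := 4 * n + K with hH
  have hDpos : 0 < D := by positivity
  have hHpos : 0 < H := by positivity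
  refine ⟨m₀ / 2, by positivity, n * (H * (G + 1)), by positivity,
    n * D + n * (n * (H * D)) + 1, by positivity, min 1 (m₀ / 2) / D, by positivity,
    fun L ε u hu hL hε hε₀ hclose => ?_⟩
  have hA : D * ε ≤ min 1 (m₀ / 2) := by
    rw [le_div_iff₀ hDpos] at hε₀
    linarith
  have hA1 : D * ε ≤ 1 := hA.trans (min_le_left _ _)
  have hA2 : D * ε ≤ m₀ / 2 := hA.trans (min_le_right _ _)
  have hdiff : ∀ x : E, ‖x‖ < 2 → ContDiffAt ℝ 2 u x := fun x hx =>
    hu.contDiff.contDiffAt (isOpen_ball.mem_nhds (by rw [mem_ball_zero_iff]; linarith))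
  have hcoord : ∀ x : E, ‖x‖ ≤ 3 → x i ∈ Icc (-3 : ℝ) 3 := fun x hx =>
    abs_le.1 ((abs_coord_le i x).trans hx)
  have hfirst : ∀ x : E, ‖x‖ ≤ 3 → ∀ j, j ≠ i → |fderiv ℝ u x (stdVec j)| ≤ D * ε := by
    intro x hx j hj
    simpa [hj] using abs_fderiv_sub_profile_le hf hg i hu hL hclose hx j
  have hfirst_i : ∀ x : E, ‖x‖ ≤ 3 → |fderiv ℝ u x (stdVec i) - deriv g (x i)| ≤ D * ε := by
    intro x hx
    simpa using abs_fderiv_sub_profile_le hf hg i hu hL hclose hx i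
  have hfirst_le : ∀ x : E, ‖x‖ ≤ 3 → |fderiv ℝ u x (stdVec i)| ≤ G + 1 := by
    intro x hx
    have h1 := abs_le.1 (hfirst_i x hx)
    have h2 := hmax _ (hcoord x hx)
    have h3 := hgpos (x i)
    rw [abs_le]
    constructor <;> linarith
  have hsecond : ∀ x : E, ‖x‖ < 2 → ∀ (j : Fin n) (A : ℝ),
      (∀ z : E, ‖z‖ ≤ 3 → |fderiv ℝ u z (stdVec j)| ≤ A) →
      ∀ a : E, |fderiv ℝ (fderiv ℝ u) x a (stdVec j)| ≤ n * (H * A) * ‖a‖ := by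
    intro x hx j A hjA a
    have hsymm : IsSymmSndFDerivAt ℝ u x := (hdiff x hx).isSymmSndFDerivAt (by simp)
    rw [hsymm.eq]
    refine abs_apply_le_of_stdVec (fun k => ?_) a
    rw [fderiv_fderiv_apply (hdiff x hx)]
    exact abs_fderiv_fderiv_le hf hu (by linarith) j hjA hx k
  have e1 : n * (D * ε) ≤ (n * D + n * (n * (H * D)) + 1) * ε := by
    have : 0 ≤ n * (n * (H * D)) * ε := by positivity
    linarith
  have e2 : n * (n * (H * (D * ε))) ≤ (n * D + n * (n * (H * D)) + 1) * ε := by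
    have : 0 ≤ n * D * ε := by positivity
    linarith
  refine ⟨hdiff, fun x hx b => ?_, fun x hx => ?_, fun x hx a b => ?_, fun x hx a => ?_⟩
  · refine (abs_apply_flat_le (by positivity) (hfirst x (by linarith)) b).trans ?_
    gcongr
  · have h1 := abs_le.1 (hfirst_i x (by linarith))
    have h2 := hmin _ (hcoord x (by linarith))
    linarith
  · refine (abs_apply_flat_le (ε := n * (H * (D * ε)) * ‖a‖) (by positivity)
      (fun j hj => hsecond x hx j _ (fun z hz => hfirst z hz j hj) a) b).trans ?_
    rw [← mul_assoc]
    gcongr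
  · exact hsecond x hx i _ hfirst_le a

end AlmostFlat

/-- Proposition 2.5, localized version: with `u` a solution only in
`B_{R^{2/5}}`, if `B_R(-R eₙ) ∩ B_{R^{2/5}} ⊂ {u<0}` is tangent to `{u=0}` at `0` and `u` is
close to `-1` at some `x₀ ∈ B_{R^{2/5}/4}(-(1/2)R^{2/5} eₙ)`, then in `B₁` the level set
`{u=0}` is a `C²` graph in the `eₙ` direction with second derivatives `≤ C/R` and
`|u - g(xₙ)| ≤ C/R`. -/
theorem estimates_tangent_ball_localized
    (n : ℕ) (hn : 1 ≤ n) (i₀ : Fin n) (hi₀ : (i₀ : ℕ) = n - 1)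
    (W : ℝ → ℝ) (hW : DoubleWell W)
    (g : ℝ → ℝ) (hg : IsOneDSolution W g) :
    ∃ c : ℝ, 0 < c ∧ ∃ C : ℝ, 0 < C ∧ ∃ R₀ : ℝ, ∀ R : ℝ, R₀ ≤ R →
      ∀ u : EuclideanSpace ℝ (Fin n) → ℝ,
        ContDiffOn ℝ 2 u (Metric.ball 0 (R ^ ((2:ℝ)/5))) →
        (∀ x ∈ Metric.ball (0 : EuclideanSpace ℝ (Fin n)) (R ^ ((2:ℝ)/5)), |u x| ≤ 1) →
        (∀ x ∈ Metric.ball (0 : EuclideanSpace ℝ (Fin n)) (R ^ ((2:ℝ)/5)),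
          lap n u x = deriv W (u x)) →
        (∀ x ∈ Metric.ball (-(R • EuclideanSpace.single i₀ (1:ℝ))) R ∩
            Metric.ball (0 : EuclideanSpace ℝ (Fin n)) (R ^ ((2:ℝ)/5)), u x < 0) →
        u 0 = 0 →
      ∀ x₀ ∈ Metric.ball (-((R ^ ((2:ℝ)/5) / 2) • EuclideanSpace.single i₀ (1:ℝ)))
          (R ^ ((2:ℝ)/5) / 4),
        u x₀ ≤ -1 + c →
        (∃ h : EuclideanSpace ℝ (Fin n) → ℝ, ContDiff ℝ 2 h ∧
          (∀ z, ‖iteratedFDeriv ℝ 2 h z‖ ≤ C / R) ∧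
          (∀ x ∈ Metric.ball (0 : EuclideanSpace ℝ (Fin n)) 1,
            (u x = 0 ↔ x i₀ = h (x - x i₀ • EuclideanSpace.single i₀ (1:ℝ))))) ∧
        (∀ x ∈ Metric.ball (0 : EuclideanSpace ℝ (Fin n)) 1,
          |u x - g (x i₀)| ≤ C / R) := by
  obtain ⟨K, κ, δ₀, hf⟩ := hW.exists_isBistable
  obtain ⟨T, κ₁, ht⟩ := hg.exists_profileTails hf
  obtain ⟨c, hc, C₁, hC₁, ℓ₀, hup⟩ := exists_upper_bound hf hg ht i₀ (B := 32) (by norm_num)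
  obtain ⟨C₂, hC₂, hlow⟩ := exists_abs_sub_profile_le hf hg i₀
  obtain ⟨m, hm, Λ, hΛ, C₃, hC₃, ε₀, hε₀, hflat⟩ := exists_isAlmostFlat hf hg i₀
  obtain ⟨C₄, hC₄, hgraph⟩ := exists_graph i₀ hm hΛ
  set C₅ := C₂ * C₁ with hC₅
  have hC₅pos : 0 < C₅ := by positivity
  have hev : ∀ᶠ R : ℝ in atTop, 0 < R ∧ ℓ₀ ≤ R ^ ((1 : ℝ) / 20) ∧ 32 ≤ R ^ ((2 : ℝ) / 5) ∧
      C₅ / ε₀ ≤ R ∧ 2 * (C₃ * C₅) / m ≤ R :=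
    (eventually_gt_atTop 0).and <|
      ((tendsto_rpow_atTop (by norm_num)).eventually_ge_atTop ℓ₀).and <|
      ((tendsto_rpow_atTop (by norm_num)).eventually_ge_atTop 32).and <|
      (eventually_ge_atTop _).and (eventually_ge_atTop _)
  obtain ⟨R₀, hR₀⟩ := eventually_atTop.1 hev
  refine ⟨c, hc, C₄ * C₃ * C₅ + C₅, by positivity, R₀, ?_⟩
  intro R hR u hu hu1 hueq hneg hu0 x₀ hx₀ hux₀
  obtain ⟨hRpos, hℓ, hL, hε, hε'⟩ := hR₀ R hR
  have h20 : (R ^ ((1 : ℝ) / 20)) ^ 20 = R := by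
    rw [← Real.rpow_natCast, ← Real.rpow_mul hRpos.le]; norm_num
  have h8 : (R ^ ((1 : ℝ) / 20)) ^ 8 = R ^ ((2 : ℝ) / 5) := by
    rw [← Real.rpow_natCast, ← Real.rpow_mul hRpos.le]; norm_num
  have hsol : IsSol n (deriv W) (R ^ ((2 : ℝ) / 5)) u := ⟨hu, hu1, hueq⟩
  have hup' := hup _ hℓ u
  rw [h20, h8] at hup'
  have hclose : ∀ x : EuclideanSpace ℝ (Fin n), ‖x‖ ≤ 4 → |u x - g (x i₀)| ≤ C₅ / R := by
    rw [hC₅, mul_div_assoc]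
    exact hlow _ (C₁ / R) u hsol hL (by positivity) hu0 (hup' hsol hneg hu0 x₀ hx₀ hux₀)
  refine ⟨?_, fun x hx => ?_⟩
  · have hsmall : C₅ / R ≤ ε₀ := by
      rw [div_le_iff₀ hε₀] at hε
      rw [div_le_iff₀ hRpos]
      linarith
    have hsmall' : 2 * (C₃ * (C₅ / R)) ≤ m := by
      rw [div_le_iff₀ hm] at hε'
      have : 2 * (C₃ * (C₅ / R)) = 2 * (C₃ * C₅) / R := by ring
      rw [this, div_le_iff₀ hRpos]
      linarith
    obtain ⟨h, hh, hh2, hiff⟩ := hgraph (C₃ * (C₅ / R)) u (by positivity) hsmall'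
      (hflat _ _ u hsol (by linarith) (by positivity) hsmall hclose) hu0
    refine ⟨h, hh, fun z => (hh2 z).trans ?_, hiff⟩
    have h1 : C₄ * (C₃ * (C₅ / R)) = C₄ * C₃ * C₅ / R := by ring
    rw [h1]
    gcongr
    linarith
  · rw [mem_ball_zero_iff] at hx
    refine (hclose x (by linarith)).trans ?_
    gcongr
    have : 0 < C₄ * C₃ * C₅ := by positivity
    linarith

end
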